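/- arXiv:math-ph/0502025 — 2 statements merged into one kernel-verified Lean document; each statement's English description precedes it below -/
import Mathlib

section
/- (Four Denominator Lemma.) For every Λ > 0 there exists a constant C_Λ > 0 such that for every η with 0 < η ≤ min{Λ, 1/2}, every α ∈ [0, 6] with |||α||| ≥ Λ, and every u ∈ 𝕋³, one has ∫_{𝕋³}∫_{𝕋³}∫_{𝕋³} dp dq dr / ( |α − e(p) + iη| · |α − e(q) + iη| · |α − e(r) + iη| · |α − e(p − q + r + u) + iη| ) ≤ C_Λ |log η|^{14}. -/
open MeasureTheory Filter Topology

noncomputable section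

/-- The torus `𝕋³ = [-1/2, 1/2]³` realized as a box in `ℝ³`. -/
def T3 : Set (Fin 3 → ℝ) := Set.pi Set.univ fun _ => Set.Icc (-(1/2) : ℝ) (1/2)

/-- The lattice dispersion relation `e(p) = ∑_j (1 - cos(2π p_j))`. -/
def edisp (p : Fin 3 → ℝ) : ℝ := ∑ j, (1 - Real.cos (2 * Real.pi * p j))

/-- `Θ_ε(α) = ∫_{𝕋³} dq / (α - e(q) + iε)`. -/
def ThetaEps (ε α : ℝ) : ℂ := ∫ q in T3, ((α : ℂ) - (edisp q : ℂ) + (ε : ℂ) * Complex.I)⁻¹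

/-- `Θ` is the limit of `Θ_ε` as `ε → 0⁺`. -/
def IsThetaLimit (Θ : ℝ → ℂ) : Prop :=
  ∀ α : ℝ, Tendsto (fun ε => ThetaEps ε α) (𝓝[>] (0 : ℝ)) (𝓝 (Θ α))

/-- The renormalized dispersion `ω(p) = e(p) + λ² Θ(e(p))`. -/
def omegaR (Θ : ℝ → ℂ) (lam : ℝ) (p : Fin 3 → ℝ) : ℂ :=
  (edisp p : ℂ) + (lam : ℂ) ^ 2 * Θ (edisp p)

/-- A function on `𝕋³`, i.e. a `ℤ³`-periodic function on `ℝ³`. -/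
def ZPeriodic (g : (Fin 3 → ℝ) → ℂ) : Prop :=
  ∀ (p : Fin 3 → ℝ) (n : Fin 3 → ℤ), g (p + fun j => (n j : ℝ)) = g p

/-- The `C¹` norm `‖g‖_∞ + ‖∇g‖_∞`. -/
def C1Norm (g : (Fin 3 → ℝ) → ℂ) : ℝ :=
  (⨆ p : Fin 3 → ℝ, ‖g p‖) + ⨆ p : Fin 3 → ℝ, ‖fderiv ℝ g p‖

/-- `|||α||| = min {|α|, |α-2|, |α-3|, |α-4|, |α-6|}`. -/
def anorm (a : ℝ) : ℝ := min (min (min |a| |a - 2|) (min |a - 3| |a - 4|)) |a - 6|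

/-- Distance between two points of the circle `ℝ/ℤ`. -/
def cdist (x y : ℝ) : ℝ := |x - y - (round (x - y) : ℝ)|

/-- `|||q||| = η + min {dist(q, γ) : γ a critical point of e}` (torus distance);
the critical points are exactly the points with all coordinates in `{0, 1/2}` mod `1`,
and minimizing over them coordinatewise gives the formula below. -/
def tnorm (η : ℝ) (q : Fin 3 → ℝ) : ℝ :=
  η + Real.sqrt (∑ j, (min (cdist (q j) 0) (cdist (q j) (1/2))) ^ 2)

/-- `|∇e(q)|`, the Euclidean length of the gradient of the dispersion relation. -/
def gradNorm (q : Fin 3 → ℝ) : ℝ := Real.sqrt (∑ j, (2 * Real.pi * Real.sin (2 * Real.pi * q j)) ^ 2)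



def fdm : Measure ℝ := volume.restrict (Set.Ioc (-(1/2)) (1/2))

instance fdm_prob : IsProbabilityMeasure fdm := by
  constructor
  simp [fdm]; norm_num

def fdE (x : ℝ) : ℂ := Complex.exp (x * Complex.I)

def fdc (x : ℝ) : ℝ := Real.cos (2 * Real.pi * x)

lemma fdE_norm (x : ℝ) : ‖fdE x‖ = 1 := Complex.norm_exp_ofReal_mul_I x

lemma fdE_add (x y : ℝ) : fdE (x + y) = fdE x * fdE y := by
  simp [fdE, add_mul, Complex.exp_add]

lemma fdE_neg (x : ℝ) : fdE (-x) = (starRingEnd ℂ) (fdE x) := by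
  simp [fdE, ← Complex.exp_conj]

@[fun_prop]
lemma fdE_cont : Continuous fdE := by unfold fdE; fun_prop

@[fun_prop]
lemma fdc_cont : Continuous fdc := by unfold fdc; fun_prop

lemma fdc_add_one (x : ℝ) : fdc (x + 1) = fdc x := by
  unfold fdc; rw [mul_add, mul_one, Real.cos_add_two_pi]

lemma fdc_neg (x : ℝ) : fdc (-x) = fdc x := by
  unfold fdc; rw [mul_neg, Real.cos_neg]

lemma fdm_integral {E : Type*} [NormedAddCommGroup E] [NormedSpace ℝ E] (f : ℝ → E) :
    ∫ x, f x ∂fdm = ∫ x in (-(1/2) : ℝ)..(1/2), f x := by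
  rw [intervalIntegral.integral_of_le (by norm_num), fdm]

lemma fdm_shift {E : Type*} [NormedAddCommGroup E] [NormedSpace ℝ E] (f : ℝ → E)
    (hf : ∀ x, f (x + 1) = f x) (c : ℝ) : ∫ x, f (x + c) ∂fdm = ∫ x, f x ∂fdm := by
  rw [fdm_integral, fdm_integral, intervalIntegral.integral_comp_add_right]
  have h := Function.Periodic.intervalIntegral_add_eq (f := f) (T := 1) hf (-(1/2) + c) (-(1/2))
  convert h using 2 <;> ring

lemma fdm_refl {E : Type*} [NormedAddCommGroup E] [NormedSpace ℝ E] (f : ℝ → E)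
    (hf : ∀ x, f (x + 1) = f x) (c : ℝ) : ∫ x, f (c - x) ∂fdm = ∫ x, f x ∂fdm := by
  rw [fdm_integral, fdm_integral, intervalIntegral.integral_comp_sub_left]
  have h := Function.Periodic.intervalIntegral_add_eq (f := f) (T := 1) hf (c - 1/2) (-(1/2))
  convert h using 2 <;> ring

lemma fd_bes1 (R ε : ℝ) (hR : 0 < R) (hε : 0 < ε) (hε' : ε ≤ Real.pi / 2) :
    ‖∫ θ in ε..(Real.pi / 2), fdE (R * Real.cos θ)‖ ≤ 2 / (R * Real.sin ε) := by
  have hs : ∀ θ ∈ Set.uIcc ε (Real.pi / 2), 0 < Real.sin θ := by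
    intro θ hθ
    rw [Set.uIcc_of_le hε'] at hθ
    exact Real.sin_pos_of_pos_of_lt_pi (by linarith [hθ.1]) (by linarith [hθ.2, Real.pi_pos])
  have hc : ∀ θ ∈ Set.Icc ε (Real.pi / 2), 0 ≤ Real.cos θ := by
    intro θ hθ
    exact Real.cos_nonneg_of_neg_pi_div_two_le_of_le (by linarith [hθ.1, Real.pi_pos]) hθ.2
  set w : ℝ → ℝ := fun θ => 1 / (R * Real.sin θ) with hw
  set w' : ℝ → ℝ := fun θ => - (Real.cos θ / (R * Real.sin θ ^ 2)) with hw'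
  have hwd : ∀ θ ∈ Set.uIcc ε (Real.pi / 2), HasDerivAt w (w' θ) θ := by
    intro θ hθ
    have h := hs θ hθ
    have := ((Real.hasDerivAt_sin θ).const_mul R).inv (by positivity)
    have e : w = (fun y => R * Real.sin y)⁻¹ := by ext; simp [hw]
    rw [e]
    refine this.congr_deriv ?_
    simp only [hw']
    field_simp
  have hvd : ∀ θ ∈ Set.uIcc ε (Real.pi / 2),
      HasDerivAt (fun θ => Complex.I * fdE (R * Real.cos θ))
        (R * Real.sin θ * fdE (R * Real.cos θ)) θ := by
    intro θ _
    have h1 : HasDerivAt (fun θ : ℝ => ((R * Real.cos θ : ℝ) : ℂ) * Complex.I)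
        (((R * (-Real.sin θ) : ℝ) : ℂ) * Complex.I) θ :=
      (((Real.hasDerivAt_cos θ).const_mul R).ofReal_comp).mul_const _
    have h2 := (h1.cexp).const_mul Complex.I
    unfold fdE
    refine h2.congr_deriv ?_
    push_cast
    linear_combination (-(R * Complex.sin θ * Complex.exp (R * Complex.cos θ * Complex.I))) * Complex.I_mul_I
  have hw'c : ContinuousOn w' (Set.uIcc ε (Real.pi / 2)) := by
    simp only [hw']
    refine ContinuousOn.neg (ContinuousOn.div (by fun_prop) (by fun_prop) ?_)
    intro θ hθ
    have := hs θ hθ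
    positivity
  have hwi : IntervalIntegrable w' volume ε (Real.pi / 2) := hw'c.intervalIntegrable
  have key := intervalIntegral.integral_mul_deriv_eq_deriv_mul (u := fun θ => (w θ : ℂ))
    (u' := fun θ => (w' θ : ℂ)) (fun θ hθ => (hwd θ hθ).ofReal_comp) hvd
    ((Complex.continuous_ofReal.comp_continuousOn hw'c).intervalIntegrable)
    (by apply Continuous.intervalIntegrable; fun_prop)
  have e1 : ∫ θ in ε..(Real.pi / 2), fdE (R * Real.cos θ)
      = ∫ θ in ε..(Real.pi / 2), (w θ : ℂ) * (R * Real.sin θ * fdE (R * Real.cos θ)) := by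
    apply intervalIntegral.integral_congr
    intro θ hθ
    have := hs θ hθ
    have h1 : (w θ : ℂ) * (R * Real.sin θ) = 1 := by
      rw [← Complex.ofReal_mul, ← Complex.ofReal_mul]
      simp only [hw]
      rw [one_div, inv_mul_cancel₀ (by positivity)]; simp
    simp only
    rw [← mul_assoc, h1, one_mul]
  rw [e1, key]
  have hwε : 0 < w ε := by
    have := hs ε (by simp)
    simp only [hw]; positivity
  have hwp : 0 < w (Real.pi / 2) := by
    simp only [hw]; simp; positivity
  have hintg : ‖∫ θ in ε..(Real.pi / 2), (w' θ : ℂ) * (Complex.I * fdE (R * Real.cos θ))‖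
      ≤ w ε - w (Real.pi / 2) := by
    have h1 := intervalIntegral.integral_eq_sub_of_hasDerivAt hwd hwi
    have h2 : ‖∫ θ in ε..(Real.pi / 2), (w' θ : ℂ) * (Complex.I * fdE (R * Real.cos θ))‖
      ≤ ∫ θ in ε..(Real.pi / 2), - w' θ := by
      apply intervalIntegral.norm_integral_le_of_norm_le hε'
      · refine Filter.Eventually.of_forall ?_
        intro θ hθ
        have hθ' : θ ∈ Set.Icc ε (Real.pi/2) := ⟨hθ.1.le, hθ.2⟩
        have h3 := hc θ hθ'
        have h4 := hs θ (by rw [Set.uIcc_of_le hε']; exact hθ')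
        rw [norm_mul, norm_mul, fdE_norm, Complex.norm_I, Complex.norm_real, Real.norm_eq_abs]
        simp only [hw', abs_neg, neg_neg]
        rw [abs_of_nonneg (by positivity)]; simp
      · exact hwi.neg
    rw [intervalIntegral.integral_neg, h1] at h2
    linarith
  calc _ ≤ ‖(w (Real.pi/2) : ℂ) * (Complex.I * fdE (R * Real.cos (Real.pi/2)))‖
        + ‖(w ε : ℂ) * (Complex.I * fdE (R * Real.cos ε))‖ + (w ε - w (Real.pi / 2)) := by
        refine (norm_sub_le _ _).trans (add_le_add (norm_sub_le _ _) hintg)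
    _ = 2 / (R * Real.sin ε) := by
        rw [norm_mul, norm_mul, norm_mul, norm_mul, fdE_norm, fdE_norm, Complex.norm_I,
          Complex.norm_real, Complex.norm_real, Real.norm_of_nonneg hwε.le, Real.norm_of_nonneg hwp.le]
        simp only [hw]; ring

lemma fd_bes2 (R : ℝ) (hR : 1 ≤ R) :
    ‖∫ θ in (0:ℝ)..(Real.pi / 2), fdE (R * Real.cos θ)‖ ≤ 5 / Real.sqrt R := by
  have hR0 : 0 < R := by linarith
  have hsR : 1 ≤ Real.sqrt R := by rw [Real.one_le_sqrt]; exact hR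
  set ε := 1 / Real.sqrt R with hε
  have hε0 : 0 < ε := by positivity
  have hε1 : ε ≤ 1 := by rw [hε, div_le_one (by positivity)]; exact hsR
  have hpi := Real.pi_gt_three
  have hpi4 := Real.pi_lt_four
  have hε2 : ε ≤ Real.pi / 2 := by linarith
  have hii : ∀ a b : ℝ, IntervalIntegrable (fun θ => fdE (R * Real.cos θ)) volume a b := by
    intro a b; apply Continuous.intervalIntegrable; fun_prop
  rw [← intervalIntegral.integral_add_adjacent_intervals (hii 0 ε) (hii ε _)]
  have h1 : ‖∫ θ in (0:ℝ)..ε, fdE (R * Real.cos θ)‖ ≤ 1 * |ε - 0| :=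
    intervalIntegral.norm_integral_le_of_norm_le_const (fun x _ => (fdE_norm _).le)
  have h2 := fd_bes1 R ε hR0 hε0 hε2
  have h3 := Real.mul_le_sin hε0.le hε2
  have h4 : 2 / (R * Real.sin ε) ≤ 4 * ε := by
    have h5 : 1/2 * ε ≤ Real.sin ε := by
      refine le_trans ?_ h3
      refine mul_le_mul_of_nonneg_right ?_ hε0.le
      rw [div_le_div_iff₀ (by norm_num) (by positivity)]; linarith
    have hsp : 0 < Real.sin ε := lt_of_lt_of_le (by positivity) h5
    rw [div_le_iff₀ (by positivity)]
    have h6 : R * ε * ε = 1 := by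
      rw [hε]; field_simp; rw [Real.sq_sqrt hR0.le]
    nlinarith [mul_le_mul_of_nonneg_left h5 (by positivity : 0 ≤ R * ε)]
  rw [sub_zero, abs_of_pos hε0] at h1
  calc _ ≤ _ := norm_add_le _ _
    _ ≤ 1 * ε + 4 * ε := add_le_add h1 (h2.trans h4)
    _ = 5 / Real.sqrt R := by rw [hε]; ring

lemma fd_conj (f : ℝ → ℂ) (a b : ℝ) : ∫ x in a..b, (starRingEnd ℂ) (f x)
    = (starRingEnd ℂ) (∫ x in a..b, f x) := by
  simp only [intervalIntegral, integral_conj, map_sub]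

lemma fd_bes3 (R : ℝ) (hR : 1 ≤ R) :
    ‖∫ θ in (-Real.pi)..Real.pi, fdE (R * Real.cos θ)‖ ≤ 20 / Real.sqrt R := by
  have hii : ∀ a b : ℝ, IntervalIntegrable (fun θ => fdE (R * Real.cos θ)) volume a b := by
    intro a b; apply Continuous.intervalIntegrable; fun_prop
  have h0 := fd_bes2 R hR
  have ha : ‖∫ θ in (Real.pi/2)..Real.pi, fdE (R * Real.cos θ)‖ ≤ 5 / Real.sqrt R := by
    have := intervalIntegral.integral_comp_sub_left (a := 0) (b := Real.pi/2)
      (fun θ => fdE (R * Real.cos θ)) Real.pi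
    rw [show Real.pi - Real.pi/2 = Real.pi/2 by ring, sub_zero] at this
    rw [← this]
    simp only [Real.cos_pi_sub, mul_neg, fdE_neg]
    rw [fd_conj, RCLike.norm_conj]
    exact h0
  have hb : ∀ a b : ℝ, ∫ θ in (-b)..(-a), fdE (R * Real.cos θ)
      = ∫ θ in a..b, fdE (R * Real.cos θ) := by
    intro a b
    have := intervalIntegral.integral_comp_neg (a := a) (b := b)
      (fun θ => fdE (R * Real.cos θ))
    rw [← this]; simp
  rw [← intervalIntegral.integral_add_adjacent_intervals (hii (-Real.pi) (-(Real.pi/2))) (hii _ _),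
    ← intervalIntegral.integral_add_adjacent_intervals (hii (-(Real.pi/2)) (-0)) (hii _ _),
    hb, hb, neg_zero,
    ← intervalIntegral.integral_add_adjacent_intervals (hii 0 (Real.pi/2)) (hii _ Real.pi)]
  calc _ ≤ 5 / Real.sqrt R + (5 / Real.sqrt R + (5 / Real.sqrt R + 5 / Real.sqrt R)) := by
        refine (norm_add_le _ _).trans (add_le_add ha ((norm_add_le _ _).trans (add_le_add h0
          ((norm_add_le _ _).trans (add_le_add h0 ha)))))
    _ = _ := by ring

lemma fd_bes4 (R : ℝ) (hR : 0 ≤ R) :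
    ‖∫ x, fdE (R * fdc x) ∂fdm‖ ^ 2 ≤ 32 / (1 + R) := by
  have h1 : ‖∫ x, fdE (R * fdc x) ∂fdm‖ ≤ 1 := by
    have := norm_integral_le_of_norm_le_const (μ := fdm) (f := fun x => fdE (R * fdc x)) (C := 1)
      (Eventually.of_forall fun x => (fdE_norm _).le)
    simpa using this
  rcases le_total R 1 with h | h
  · rw [le_div_iff₀ (by positivity)]
    have := norm_nonneg (∫ x, fdE (R * fdc x) ∂fdm)
    nlinarith [mul_le_one₀ h1 this h1]
  · have h2 : ∫ x, fdE (R * fdc x) ∂fdm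
        = (1 / (2 * Real.pi) : ℝ) • ∫ θ in (-Real.pi)..Real.pi, fdE (R * Real.cos θ) := by
      rw [fdm_integral]
      unfold fdc
      rw [intervalIntegral.integral_comp_mul_left (fun θ => fdE (R * Real.cos θ)) (by positivity)]
      rw [show 2 * Real.pi * (-(1/2)) = -Real.pi by ring,
        show 2 * Real.pi * (1/2) = Real.pi by ring, one_div]
    have h3 := fd_bes3 R h
    have hp := Real.pi_gt_three
    have hs : 0 < Real.sqrt R := Real.sqrt_pos.mpr (by linarith)
    have h4 : ‖∫ x, fdE (R * fdc x) ∂fdm‖ ≤ 4 / Real.sqrt R := by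
      rw [h2, norm_smul, Real.norm_of_nonneg (by positivity)]
      calc _ ≤ 1 / 6 * (20 / Real.sqrt R) := by
            gcongr; linarith
        _ ≤ _ := by
            rw [mul_div_assoc', div_le_div_iff_of_pos_right hs]; norm_num
    calc _ ≤ (4 / Real.sqrt R) ^ 2 := by gcongr
      _ = 16 / R := by rw [div_pow, Real.sq_sqrt hR]; norm_num
      _ ≤ _ := by
        rw [div_le_div_iff₀ (by linarith) (by linarith)]; linarith

lemma fd_B (a b s : ℝ) :
    ‖∫ x, fdE (a * fdc (x + s) + b * fdc x) ∂fdm‖ ^ 2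
      ≤ 32 / (1 + |a| * |Real.sin (2 * Real.pi * s)|) := by
  set z : ℂ := ⟨a * Real.cos (2 * Real.pi * s) + b, a * Real.sin (2 * Real.pi * s)⟩ with hz
  have h1 : ∀ x, a * fdc (x + s) + b * fdc x = ‖z‖ * fdc (x + z.arg / (2 * Real.pi)) := by
    intro x
    unfold fdc
    have e : 2 * Real.pi * (x + z.arg / (2 * Real.pi)) = 2 * Real.pi * x + z.arg := by
      field_simp
    rw [e, Real.cos_add, mul_add, Real.cos_add]
    have hc := Complex.norm_mul_cos_arg z
    have hs := Complex.norm_mul_sin_arg z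
    have hre : z.re = a * Real.cos (2 * Real.pi * s) + b := rfl
    have him : z.im = a * Real.sin (2 * Real.pi * s) := rfl
    linear_combination (-Real.cos (2 * Real.pi * x)) * (hc + hre) + Real.sin (2 * Real.pi * x) * (hs + him)
  simp_rw [h1]
  rw [fdm_shift (fun x => fdE (‖z‖ * fdc x)) (fun x => by simp only [fdc_add_one])]
  refine (fd_bes4 _ (norm_nonneg z)).trans ?_
  have : |a| * |Real.sin (2 * Real.pi * s)| ≤ ‖z‖ := by
    rw [← abs_mul]; exact Complex.abs_im_le_norm z
  gcongr

lemma fd_int {X F : Type*} [TopologicalSpace X] [MeasurableSpace X] [OpensMeasurableSpace X]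
    [NormedAddCommGroup F] [SecondCountableTopology F]
    {μ : Measure X} [IsFiniteMeasure μ] {f : X → F} (hc : Continuous f) (C : ℝ)
    (hC : ∀ x, ‖f x‖ ≤ C) : Integrable f μ :=
  Integrable.of_bound hc.aestronglyMeasurable C (Eventually.of_forall hC)

lemma fd_cont {X Y F : Type*} [NormedAddCommGroup F] [NormedSpace ℝ F] [SecondCountableTopology F] [TopologicalSpace X] [FirstCountableTopology X] [TopologicalSpace Y]
    [MeasurableSpace Y] [OpensMeasurableSpace Y] {μ : Measure Y} [IsFiniteMeasure μ]
    {f : X → Y → F} (hc : Continuous (Function.uncurry f)) (C : ℝ) (hC : ∀ x y, ‖f x y‖ ≤ C) :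
    Continuous fun x => ∫ y, f x y ∂μ := by
  refine continuous_of_dominated (bound := fun _ => C) ?_ ?_ (integrable_const _) ?_
  · intro x
    exact (hc.comp (Continuous.prodMk_right x)).aestronglyMeasurable
  · intro x; exact Eventually.of_forall (hC x)
  · refine Eventually.of_forall fun y => ?_
    exact (hc.comp (Continuous.prodMk_left y))

lemma fd_norm_le {X : Type*} [MeasurableSpace X] {μ : Measure X} [IsProbabilityMeasure μ]
    {f : X → ℂ} (hC : ∀ x, ‖f x‖ ≤ 1) : ‖∫ x, f x ∂μ‖ ≤ 1 := by
  have := norm_integral_le_of_norm_le_const (μ := μ) (f := f) (C := 1) (Eventually.of_forall hC)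
  simpa using this

def fdG (a b c d u x y z : ℝ) : ℂ :=
  fdE (a * fdc x + b * fdc y + c * fdc z + d * fdc (x - y + z + u))

lemma fdG_norm (a b c d u x y z : ℝ) : ‖fdG a b c d u x y z‖ = 1 := fdE_norm _

def fdM (a b c d u : ℝ) : ℂ := ∫ x, ∫ y, ∫ z, fdG a b c d u x y z ∂fdm ∂fdm ∂fdm

lemma fdM_eq (a b c d u : ℝ) :
    fdM a b c d u = ∫ x, ∫ z, ∫ y, fdG a b c d u x y z ∂fdm ∂fdm ∂fdm := by
  unfold fdM
  congr 1; ext x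
  apply integral_integral_swap
  refine fd_int ?_ 1 (fun q => (fdG_norm _ _ _ _ _ _ _ _).le)
  unfold fdG Function.uncurry; fun_prop

lemma fdM_symm (a b c d u : ℝ) : fdM a b c d u = fdM a d c b u := by
  rw [fdM_eq, fdM_eq]
  congr 1; ext x; congr 1; ext z
  rw [← fdm_refl (fun y => fdG a b c d u x y z) _ (x + z + u)]
  · congr 1; ext y
    unfold fdG
    congr 1
    rw [show x - (x + z + u - y) + z + u = y by ring, show x + z + u - y = x - y + z + u by ring]
    ring
  · intro y
    unfold fdG
    rw [fdc_add_one, show x - (y + 1) + z + u = (x - y + z + u) - 1 by ring]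
    have := fdc_add_one (x - y + z + u - 1)
    rw [sub_add_cancel] at this
    rw [this]

def fdA (t : ℝ) : ℝ := ∫ s, 1 / (1 + |t| * |Real.sin (2 * Real.pi * s)|) ∂fdm

lemma fdA_aux_cont (t u : ℝ) :
    Continuous fun s => 1 / (1 + |t| * |Real.sin (2 * Real.pi * (s + u))|) := by
  refine Continuous.div (by fun_prop) (by fun_prop) (fun s => ?_)
  positivity

lemma fdA_aux_le (t s : ℝ) : ‖1 / (1 + |t| * |Real.sin (2 * Real.pi * s)|)‖ ≤ 1 := by
  rw [Real.norm_of_nonneg (by positivity), div_le_one (by positivity)]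
  have : 0 ≤ |t| * |Real.sin (2 * Real.pi * s)| := by positivity
  linarith

lemma fdA_shift (t u : ℝ) :
    ∫ s, 1 / (1 + |t| * |Real.sin (2 * Real.pi * (s + u))|) ∂fdm = fdA t := by
  unfold fdA
  rw [fdm_shift (fun s => 1 / (1 + |t| * |Real.sin (2 * Real.pi * s)|))]
  intro s
  rw [mul_add, mul_one, Real.sin_add_two_pi]

lemma fdM_sup (a b c d u : ℝ) : ‖fdM a b c d u‖ ≤ 16 * (fdA b + fdA d) := by
  set B2 : ℝ → ℂ := fun v => ∫ z, fdE (d * fdc (z + v) + c * fdc z) ∂fdm with hB2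
  set B1 : ℝ → ℂ := fun s => ∫ x, fdE (b * fdc (x + -s) + a * fdc x) ∂fdm with hB1
  have hB2c : Continuous B2 := by
    refine fd_cont ?_ 1 (fun x y => (fdE_norm _).le)
    unfold Function.uncurry; fun_prop
  have hB2n : ∀ v, ‖B2 v‖ ≤ 1 := fun v => fd_norm_le fun x => (fdE_norm _).le
  have hB2p : ∀ v, B2 (v + 1) = B2 v := by
    intro v
    simp only [hB2, ← add_assoc, fdc_add_one]
  have e1 : fdM a b c d u = ∫ s, B1 s * B2 (s + u) ∂fdm := by
    have h1 : fdM a b c d u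
        = ∫ x, ∫ s, fdE (b * fdc (x + -s) + a * fdc x) * B2 (s + u) ∂fdm ∂fdm := by
      unfold fdM
      congr 1; ext x
      rw [← fdm_refl _ _ x]
      · congr 1; ext s
        simp only [hB2]
        rw [← integral_const_mul]
        congr 1; ext z
        rw [← fdE_add]
        unfold fdG
        congr 1
        rw [show x - (x - s) + z + u = z + (s + u) by ring, ← sub_eq_add_neg]
        ring
      · intro y
        congr 1; ext z
        unfold fdG
        rw [fdc_add_one, show x - (y + 1) + z + u = (x - y + z + u) - 1 by ring]
        have := fdc_add_one (x - y + z + u - 1)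
        rw [sub_add_cancel] at this
        rw [this]
    rw [h1, integral_integral_swap]
    · congr 1; ext s
      rw [integral_mul_const]
    · refine fd_int ?_ 1 (fun q => ?_)
      · unfold Function.uncurry; fun_prop
      · unfold Function.uncurry
        rw [norm_mul, fdE_norm, one_mul]; exact hB2n _
  have hi : ∀ t u, Integrable (fun s => 1 / (1 + |t| * |Real.sin (2 * Real.pi * (s + u))|)) fdm :=
    fun t u => fd_int (fdA_aux_cont t u) 1 (fun s => fdA_aux_le t (s + u))
  have hi0 : ∀ t, Integrable (fun s => 1 / (1 + |t| * |Real.sin (2 * Real.pi * s)|)) fdm := by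
    intro t; simpa using hi t 0
  rw [e1]
  calc ‖∫ s, B1 s * B2 (s + u) ∂fdm‖
      ≤ ∫ s, (16 * (1 / (1 + |b| * |Real.sin (2 * Real.pi * s)|))
          + 16 * (1 / (1 + |d| * |Real.sin (2 * Real.pi * (s + u))|))) ∂fdm := by
        refine norm_integral_le_of_norm_le (((hi0 b).const_mul _).add ((hi d u).const_mul _)) ?_
        refine Eventually.of_forall fun s => ?_
        have h1 := fd_B b a (-s)
        have h2 := fd_B d c (s + u)
        rw [mul_neg, Real.sin_neg, abs_neg] at h1
        change ‖B1 s‖ ^ 2 ≤ _ at h1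
        change ‖B2 (s + u)‖ ^ 2 ≤ _ at h2
        rw [norm_mul]
        rw [div_eq_mul_one_div] at h1 h2
        nlinarith [two_mul_le_add_sq ‖B1 s‖ ‖B2 (s + u)‖]
    _ = 16 * (fdA b + fdA d) := by
        rw [integral_add ((hi0 b).const_mul _) ((hi d u).const_mul _), integral_const_mul,
          integral_const_mul, fdA_shift, mul_add]
        rfl

lemma fd_L2 {T Ω : Type*} [TopologicalSpace T] [MeasurableSpace T] [OpensMeasurableSpace T]
    [TopologicalSpace Ω] [MeasurableSpace Ω] [OpensMeasurableSpace Ω]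
    [SecondCountableTopology T] [SecondCountableTopology Ω]
    (μ : Measure T) (m : Measure Ω) [IsFiniteMeasure μ] [IsProbabilityMeasure m]
    (K : T → Ω → ℂ) (hK : Continuous (Function.uncurry K)) (hK1 : ∀ t ω, ‖K t ω‖ ≤ 1) :
    ∫ t, ‖∫ ω, K t ω ∂m‖ ^ 2 ∂μ
      ≤ ∫ z, ‖∫ t, K t z.1 * (starRingEnd ℂ) (K t z.2) ∂μ‖ ∂(m.prod m) := by
  have h1 : ((∫ t, ‖∫ ω, K t ω ∂m‖ ^ 2 ∂μ : ℝ) : ℂ)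
      = ∫ z, ∫ t, K t z.1 * (starRingEnd ℂ) (K t z.2) ∂μ ∂(m.prod m) := by
    rw [← integral_complex_ofReal, integral_integral_swap]
    · congr 1; ext t
      rw [integral_prod_mul (fun ω => K t ω) (fun ω => (starRingEnd ℂ) (K t ω)), integral_conj,
        Complex.mul_conj, Complex.normSq_eq_norm_sq]
    · refine fd_int ?_ 1 (fun q => ?_)
      · unfold Function.uncurry
        have e1 : Continuous fun q : (Ω × Ω) × T => K q.2 q.1.1 :=
          hK.comp (by fun_prop : Continuous fun q : (Ω × Ω) × T => (q.2, q.1.1))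
        have e2 : Continuous fun q : (Ω × Ω) × T => K q.2 q.1.2 :=
          hK.comp (by fun_prop : Continuous fun q : (Ω × Ω) × T => (q.2, q.1.2))
        exact e1.mul (Complex.continuous_conj.comp e2)
      · unfold Function.uncurry
        rw [norm_mul, RCLike.norm_conj]
        exact mul_le_one₀ (hK1 _ _) (norm_nonneg _) (hK1 _ _)
  have h2 : ∫ t, ‖∫ ω, K t ω ∂m‖ ^ 2 ∂μ ≤ ‖((∫ t, ‖∫ ω, K t ω ∂m‖ ^ 2 ∂μ : ℝ) : ℂ)‖ := by
    rw [Complex.norm_real]; exact le_abs_self _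
  refine h2.trans ?_
  rw [h1]
  exact norm_integral_le_integral_norm _

def fdphi (κ : Measure ℝ) (y : ℝ) : ℂ := ∫ t, fdE (t * y) ∂κ

@[fun_prop]
lemma fdphi_cont (κ : Measure ℝ) [IsFiniteMeasure κ] : Continuous (fdphi κ) := by
  refine fd_cont ?_ 1 (fun x y => (fdE_norm _).le)
  unfold Function.uncurry; fun_prop

lemma fdphi_norm (κ : Measure ℝ) [IsFiniteMeasure κ] (y : ℝ) : ‖fdphi κ y‖ ≤ κ.real Set.univ := by
  have := norm_integral_le_of_norm_le_const (μ := κ) (f := fun t => fdE (t * y)) (C := 1)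
    (Eventually.of_forall fun x => (fdE_norm _).le)
  unfold fdphi
  simpa using this

def fdZ (κ : Measure ℝ) : ℝ := ∫ x, ∫ x', ‖fdphi κ (fdc x - fdc x')‖ ∂fdm ∂fdm

lemma fdM_prod (a b c d u : ℝ) : fdM a b c d u
    = ∫ ω : ℝ × ℝ × ℝ, fdG a b c d u ω.1 ω.2.1 ω.2.2 ∂(fdm.prod (fdm.prod fdm)) := by
  unfold fdM
  rw [integral_prod]
  · congr 1; ext x
    rw [integral_prod]
    refine fd_int ?_ 1 (fun q => (fdG_norm _ _ _ _ _ _ _ _).le)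
    unfold fdG; fun_prop
  · refine fd_int ?_ 1 (fun q => (fdG_norm _ _ _ _ _ _ _ _).le)
    unfold fdG; fun_prop

lemma fdM_L2 (κ : Measure ℝ) [IsFiniteMeasure κ] (d u : ℝ) :
    ∫ t : ℝ × ℝ × ℝ, ‖fdM t.2.1 t.1 t.2.2 d u‖ ^ 2 ∂(κ.prod (κ.prod κ)) ≤ fdZ κ ^ 3 := by
  simp_rw [fdM_prod]
  refine (fd_L2 (κ.prod (κ.prod κ)) (fdm.prod (fdm.prod fdm))
    (fun t ω => fdG t.2.1 t.1 t.2.2 d u ω.1 ω.2.1 ω.2.2) ?_ ?_).trans (le_of_eq ?_)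
  · unfold Function.uncurry fdG; fun_prop
  · intro t ω; exact (fdG_norm _ _ _ _ _ _ _ _).le
  have h1 : ∀ z : (ℝ × ℝ × ℝ) × (ℝ × ℝ × ℝ),
      ‖∫ t : ℝ × ℝ × ℝ, fdG t.2.1 t.1 t.2.2 d u z.1.1 z.1.2.1 z.1.2.2 *
        (starRingEnd ℂ) (fdG t.2.1 t.1 t.2.2 d u z.2.1 z.2.2.1 z.2.2.2) ∂(κ.prod (κ.prod κ))‖
      = ‖fdphi κ (fdc z.1.1 - fdc z.2.1)‖ * (‖fdphi κ (fdc z.1.2.1 - fdc z.2.2.1)‖ *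
        ‖fdphi κ (fdc z.1.2.2 - fdc z.2.2.2)‖) := by
    intro z
    have e : ∀ t : ℝ × ℝ × ℝ, fdG t.2.1 t.1 t.2.2 d u z.1.1 z.1.2.1 z.1.2.2 *
        (starRingEnd ℂ) (fdG t.2.1 t.1 t.2.2 d u z.2.1 z.2.2.1 z.2.2.2)
        = fdE (d * fdc (z.1.1 - z.1.2.1 + z.1.2.2 + u) - d * fdc (z.2.1 - z.2.2.1 + z.2.2.2 + u))
          * (fdE (t.1 * (fdc z.1.2.1 - fdc z.2.2.1)) * (fdE (t.2.1 * (fdc z.1.1 - fdc z.2.1))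
          * fdE (t.2.2 * (fdc z.1.2.2 - fdc z.2.2.2)))) := by
      intro t
      unfold fdG
      rw [← fdE_neg]
      simp only [← fdE_add]
      congr 1; ring
    simp_rw [e]
    rw [integral_const_mul, norm_mul, fdE_norm, one_mul,
      integral_prod_mul (fun b => fdE (b * (fdc z.1.2.1 - fdc z.2.2.1)))
        (fun q : ℝ × ℝ => fdE (q.1 * (fdc z.1.1 - fdc z.2.1)) * fdE (q.2 * (fdc z.1.2.2 - fdc z.2.2.2))),
      integral_prod_mul (fun b => fdE (b * (fdc z.1.1 - fdc z.2.1)))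
        (fun b => fdE (b * (fdc z.1.2.2 - fdc z.2.2.2))), norm_mul, norm_mul]
    unfold fdphi
    ring
  simp_rw [h1]
  rw [integral_prod]
  · have h2 : ∀ ω : ℝ × ℝ × ℝ, ∫ y : ℝ × ℝ × ℝ, ‖fdphi κ (fdc ω.1 - fdc y.1)‖ *
        (‖fdphi κ (fdc ω.2.1 - fdc y.2.1)‖ * ‖fdphi κ (fdc ω.2.2 - fdc y.2.2)‖)
        ∂(fdm.prod (fdm.prod fdm))
        = (∫ x, ‖fdphi κ (fdc ω.1 - fdc x)‖ ∂fdm) * ((∫ x, ‖fdphi κ (fdc ω.2.1 - fdc x)‖ ∂fdm)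
          * (∫ x, ‖fdphi κ (fdc ω.2.2 - fdc x)‖ ∂fdm)) := by
      intro ω
      rw [integral_prod_mul (fun x => ‖fdphi κ (fdc ω.1 - fdc x)‖)
        (fun q : ℝ × ℝ => ‖fdphi κ (fdc ω.2.1 - fdc q.1)‖ * ‖fdphi κ (fdc ω.2.2 - fdc q.2)‖),
        integral_prod_mul (fun x => ‖fdphi κ (fdc ω.2.1 - fdc x)‖)
        (fun x => ‖fdphi κ (fdc ω.2.2 - fdc x)‖)]
    simp only [h2]
    rw [integral_prod_mul (fun w => ∫ x, ‖fdphi κ (fdc w - fdc x)‖ ∂fdm)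
      (fun q : ℝ × ℝ => (∫ x, ‖fdphi κ (fdc q.1 - fdc x)‖ ∂fdm)
          * (∫ x, ‖fdphi κ (fdc q.2 - fdc x)‖ ∂fdm)),
      integral_prod_mul (fun w => ∫ x, ‖fdphi κ (fdc w - fdc x)‖ ∂fdm)
      (fun w => ∫ x, ‖fdphi κ (fdc w - fdc x)‖ ∂fdm)]
    unfold fdZ; ring
  · refine fd_int ?_ (κ.real Set.univ * (κ.real Set.univ * κ.real Set.univ)) (fun q => ?_)
    · fun_prop
    · simp only [norm_mul, norm_norm]
      gcongr <;> exact fdphi_norm κ _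

lemma fdA_cont : Continuous fdA := by
  refine fd_cont ?_ 1 (fun t s => fdA_aux_le t s)
  unfold Function.uncurry
  refine Continuous.div (by fun_prop) (by fun_prop) (fun s => ?_)
  positivity

lemma fdA_nonneg (t : ℝ) : 0 ≤ fdA t := integral_nonneg fun s => by positivity

lemma fdA_le_one (t : ℝ) : ‖fdA t‖ ≤ 1 := by
  have := norm_integral_le_of_norm_le_const (μ := fdm)
    (f := fun s => 1 / (1 + |t| * |Real.sin (2 * Real.pi * s)|)) (C := 1)
    (Eventually.of_forall fun x => fdA_aux_le t x)
  unfold fdA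
  simpa using this

lemma fdM_cont (u : ℝ) : Continuous fun q : ℝ × ℝ × ℝ × ℝ => fdM q.1 q.2.1 q.2.2.1 q.2.2.2 u := by
  simp_rw [fdM_prod]
  refine fd_cont ?_ 1 (fun t ω => (fdG_norm _ _ _ _ _ _ _ _).le)
  unfold Function.uncurry fdG; fun_prop

lemma fdM_cont' {X : Type*} [TopologicalSpace X] (u : ℝ) {a b c d : X → ℝ} (ha : Continuous a)
    (hb : Continuous b) (hc : Continuous c) (hd : Continuous d) :
    Continuous fun x => fdM (a x) (b x) (c x) (d x) u :=
  (fdM_cont u).comp (ha.prodMk (hb.prodMk (hc.prodMk hd)))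

lemma fdM_norm (a b c d u : ℝ) : ‖fdM a b c d u‖ ≤ 1 := by
  rw [fdM_prod]
  exact fd_norm_le fun ω => (fdG_norm _ _ _ _ _ _ _ _).le

lemma fdM_sq_norm (a b c d u : ℝ) : ‖‖fdM a b c d u‖ ^ 2‖ ≤ 1 := by
  rw [norm_pow, norm_norm]
  exact pow_le_one₀ (norm_nonneg _) (fdM_norm _ _ _ _ _)

def fdW (κ : Measure ℝ) (u b d : ℝ) : ℝ :=
  ∫ q : ℝ × ℝ, ‖fdM q.1 b q.2 d u‖ ^ 2 ∂(κ.prod κ)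

lemma fdW_symm (κ : Measure ℝ) (u b d : ℝ) : fdW κ u b d = fdW κ u d b := by
  unfold fdW
  congr 1; ext q
  rw [fdM_symm]

lemma fdW_int (κ : Measure ℝ) [IsFiniteMeasure κ] (u d : ℝ) :
    ∫ b, fdW κ u b d ∂κ ≤ fdZ κ ^ 3 := by
  refine le_trans (le_of_eq ?_) (fdM_L2 κ d u)
  rw [integral_prod]
  · rfl
  · refine fd_int ?_ 1 (fun q => fdM_sq_norm _ _ _ _ _)
    exact (fdM_cont' u (by fun_prop) (by fun_prop) (by fun_prop) (by fun_prop)).norm.pow 2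

lemma fdW_cont (κ : Measure ℝ) [IsFiniteMeasure κ] (u : ℝ) :
    Continuous fun q : ℝ × ℝ => fdW κ u q.1 q.2 := by
  refine fd_cont (f := fun (q : ℝ × ℝ) (r : ℝ × ℝ) => ‖fdM r.1 q.1 r.2 q.2 u‖ ^ 2) ?_ 1
    (fun t ω => fdM_sq_norm _ _ _ _ _)
  unfold Function.uncurry
  exact (fdM_cont' u (by fun_prop) (by fun_prop) (by fun_prop) (by fun_prop)).norm.pow 2

lemma fdW_le (κ : Measure ℝ) [IsFiniteMeasure κ] (u b d : ℝ) :
    ‖fdW κ u b d‖ ≤ (κ.prod κ).real Set.univ := by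
  have := norm_integral_le_of_norm_le_const (μ := κ.prod κ)
    (f := fun q : ℝ × ℝ => ‖fdM q.1 b q.2 d u‖ ^ 2) (C := 1)
    (Eventually.of_forall fun q => fdM_sq_norm _ _ _ _ _)
  unfold fdW
  simpa using this

lemma fd_AW_int (κ : Measure ℝ) [IsFiniteMeasure κ] (u : ℝ) {h : ℝ × ℝ → ℝ} (hh : Continuous h) :
    Integrable (fun q : ℝ × ℝ => fdA (h q) * fdW κ u q.1 q.2) (κ.prod κ) := by
  refine fd_int ((fdA_cont.comp hh).mul (fdW_cont κ u)) (1 * (κ.prod κ).real Set.univ) (fun q => ?_)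
  rw [norm_mul]
  exact mul_le_mul (fdA_le_one _) (fdW_le _ _ _ _) (norm_nonneg _) (by norm_num)

lemma fdA_int (κ : Measure ℝ) [IsFiniteMeasure κ] : Integrable fdA κ :=
  fd_int fdA_cont 1 fdA_le_one

lemma fd_AW1 (κ : Measure ℝ) [IsFiniteMeasure κ] (u : ℝ) :
    ∫ q : ℝ × ℝ, fdA q.1 * fdW κ u q.1 q.2 ∂(κ.prod κ) ≤ (∫ t, fdA t ∂κ) * fdZ κ ^ 3 := by
  have hi := fd_AW_int κ u (h := fun q => q.1) continuous_fst
  rw [integral_prod _ hi, ← integral_mul_const]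
  refine integral_mono hi.integral_prod_left ((fdA_int κ).mul_const _) (fun b => ?_)
  simp only
  rw [integral_const_mul]
  refine mul_le_mul_of_nonneg_left ?_ (fdA_nonneg b)
  simp_rw [fdW_symm κ u b]
  exact fdW_int κ u b

lemma fd_AW2 (κ : Measure ℝ) [IsFiniteMeasure κ] (u : ℝ) :
    ∫ q : ℝ × ℝ, fdA q.2 * fdW κ u q.1 q.2 ∂(κ.prod κ) ≤ (∫ t, fdA t ∂κ) * fdZ κ ^ 3 := by
  have hi := fd_AW_int κ u (h := fun q => q.2) continuous_snd
  rw [integral_prod_symm _ hi, ← integral_mul_const]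
  refine integral_mono hi.integral_prod_right ((fdA_int κ).mul_const _) (fun b => ?_)
  simp only
  rw [integral_const_mul]
  refine mul_le_mul_of_nonneg_left ?_ (fdA_nonneg b)
  exact fdW_int κ u b

lemma fd_tau_int (κ : Measure ℝ) [IsFiniteMeasure κ] (u : ℝ) :
    Integrable (fun t : (ℝ × ℝ) × (ℝ × ℝ) => (fdA t.1.1 + fdA t.1.2) *
      ‖fdM t.2.1 t.1.1 t.2.2 t.1.2 u‖ ^ 2) ((κ.prod κ).prod (κ.prod κ)) := by
  refine fd_int (Continuous.mul ?_ ?_) ((1 + 1) * 1) (fun q => ?_)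
  · exact (fdA_cont.comp (by fun_prop)).add (fdA_cont.comp (by fun_prop))
  · exact (fdM_cont' u (by fun_prop) (by fun_prop) (by fun_prop) (by fun_prop)).norm.pow 2
  · rw [norm_mul]
    exact mul_le_mul ((norm_add_le _ _).trans (add_le_add (fdA_le_one _) (fdA_le_one _)))
      (fdM_sq_norm _ _ _ _ _) (norm_nonneg _) (by norm_num)

lemma fd_tau (κ : Measure ℝ) [IsFiniteMeasure κ] (u : ℝ) :
    ∫ t : (ℝ × ℝ) × (ℝ × ℝ), (fdA t.1.1 + fdA t.1.2) * ‖fdM t.2.1 t.1.1 t.2.2 t.1.2 u‖ ^ 2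
      ∂((κ.prod κ).prod (κ.prod κ)) ≤ 2 * ((∫ t, fdA t ∂κ) * fdZ κ ^ 3) := by
  rw [integral_prod _ (fd_tau_int κ u)]
  simp only
  simp_rw [integral_const_mul, add_mul]
  have h1 := fd_AW_int κ u (h := fun q => q.1) continuous_fst
  have h2 := fd_AW_int κ u (h := fun q => q.2) continuous_snd
  have := integral_add h1 h2
  unfold fdW at this
  rw [this]
  have := fd_AW1 κ u
  have := fd_AW2 κ u
  unfold fdW at *
  linarith

lemma fd_core1 (κ : Measure ℝ) [IsFiniteMeasure κ] (β : ℝ) (u : Fin 3 → ℝ) :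
    ‖∫ t : (ℝ × ℝ) × (ℝ × ℝ), fdE (-β * (t.2.1 + t.1.1 + t.2.2 + t.1.2)) *
      ∏ j, fdM t.2.1 t.1.1 t.2.2 t.1.2 (u j) ∂((κ.prod κ).prod (κ.prod κ))‖
      ≤ 32 * ((∫ t, fdA t ∂κ) * fdZ κ ^ 3) := by
  have hb : Integrable (fun t : (ℝ × ℝ) × (ℝ × ℝ) => 8 * ((fdA t.1.1 + fdA t.1.2) *
      ‖fdM t.2.1 t.1.1 t.2.2 t.1.2 (u 1)‖ ^ 2) + 8 * ((fdA t.1.1 + fdA t.1.2) *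
      ‖fdM t.2.1 t.1.1 t.2.2 t.1.2 (u 2)‖ ^ 2)) ((κ.prod κ).prod (κ.prod κ)) :=
    ((fd_tau_int κ (u 1)).const_mul 8).add ((fd_tau_int κ (u 2)).const_mul 8)
  refine (norm_integral_le_of_norm_le hb (Eventually.of_forall fun t => ?_)).trans ?_
  · rw [norm_mul, fdE_norm, one_mul, Fin.prod_univ_three, norm_mul, norm_mul]
    have h0 := fdM_sup t.2.1 t.1.1 t.2.2 t.1.2 (u 0)
    set x := ‖fdM t.2.1 t.1.1 t.2.2 t.1.2 (u 0)‖
    set y := ‖fdM t.2.1 t.1.1 t.2.2 t.1.2 (u 1)‖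
    set z := ‖fdM t.2.1 t.1.1 t.2.2 t.1.2 (u 2)‖
    have hx : 0 ≤ x := norm_nonneg _
    have hy : 0 ≤ y := norm_nonneg _
    have hz : 0 ≤ z := norm_nonneg _
    have hs : 0 ≤ fdA t.1.1 + fdA t.1.2 := add_nonneg (fdA_nonneg _) (fdA_nonneg _)
    have h1 := mul_le_mul_of_nonneg_right h0 (mul_nonneg hy hz)
    have h2 := mul_le_mul_of_nonneg_left (two_mul_le_add_sq y z) hs
    nlinarith
  · rw [integral_add ((fd_tau_int κ (u 1)).const_mul 8) ((fd_tau_int κ (u 2)).const_mul 8),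
      integral_const_mul, integral_const_mul]
    have := fd_tau κ (u 1)
    have := fd_tau κ (u 2)
    linarith

def fdpi : Measure (Fin 3 → ℝ) := Measure.pi (fun _ => fdm)

instance fdpi_prob : IsProbabilityMeasure fdpi := by unfold fdpi; infer_instance

def fdX (β : ℝ) (p : Fin 3 → ℝ) : ℝ := (∑ j, fdc (p j)) - β

@[fun_prop]
lemma fdX_cont (β : ℝ) : Continuous (fdX β) := by unfold fdX; fun_prop

def fdS (β : ℝ) (u : Fin 3 → ℝ) (t : (ℝ × ℝ) × (ℝ × ℝ))
    (w : (Fin 3 → ℝ) × (Fin 3 → ℝ) × (Fin 3 → ℝ)) : ℝ :=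
  t.2.1 * fdX β w.1 + t.1.1 * fdX β w.2.1 + t.2.2 * fdX β w.2.2
    + t.1.2 * fdX β (w.1 - w.2.1 + w.2.2 + u)

lemma fdE_sum3 (f : Fin 3 → ℝ) : fdE (∑ j, f j) = ∏ j, fdE (f j) := by
  simp only [Fin.sum_univ_three, Fin.prod_univ_three, fdE_add]

lemma fdS_E (β : ℝ) (u : Fin 3 → ℝ) (t : (ℝ × ℝ) × (ℝ × ℝ)) (p q r : Fin 3 → ℝ) :
    fdE (fdS β u t (p, q, r)) = fdE (-β * (t.2.1 + t.1.1 + t.2.2 + t.1.2)) *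
      ∏ j, fdG t.2.1 t.1.1 t.2.2 t.1.2 (u j) (p j) (q j) (r j) := by
  unfold fdG
  rw [← fdE_sum3, ← fdE_add]
  congr 1
  unfold fdS fdX
  simp only [Fin.sum_univ_three, Pi.add_apply, Pi.sub_apply]
  ring

lemma fd_inner (β : ℝ) (u : Fin 3 → ℝ) (t : (ℝ × ℝ) × (ℝ × ℝ)) :
    ∫ w, fdE (fdS β u t w) ∂(fdpi.prod (fdpi.prod fdpi))
      = fdE (-β * (t.2.1 + t.1.1 + t.2.2 + t.1.2)) *
      ∏ j, fdM t.2.1 t.1.1 t.2.2 t.1.2 (u j) := by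
  have hc : Continuous (fdS β u t) := by unfold fdS; fun_prop
  rw [integral_prod _ (fd_int (by fun_prop) 1 (fun w => (fdE_norm _).le))]
  have h1 : ∀ p, ∫ y : (Fin 3 → ℝ) × (Fin 3 → ℝ), fdE (fdS β u t (p, y)) ∂(fdpi.prod fdpi)
      = ∫ q, ∫ r, fdE (fdS β u t (p, q, r)) ∂fdpi ∂fdpi := by
    intro p
    rw [integral_prod _ (fd_int (by fun_prop) 1 (fun w => (fdE_norm _).le))]
  simp_rw [h1, fdS_E, integral_const_mul]
  congr 1
  unfold fdM
  have e1 : ∀ p q : Fin 3 → ℝ,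
      ∫ r, ∏ j, fdG t.2.1 t.1.1 t.2.2 t.1.2 (u j) (p j) (q j) (r j) ∂fdpi
      = ∏ j, ∫ z, fdG t.2.1 t.1.1 t.2.2 t.1.2 (u j) (p j) (q j) z ∂fdm := fun p q =>
    integral_fintype_prod_eq_prod (μ := fun _ => fdm)
      (fun j z => fdG t.2.1 t.1.1 t.2.2 t.1.2 (u j) (p j) (q j) z)
  have e2 : ∀ p : Fin 3 → ℝ,
      ∫ q, ∏ j, ∫ z, fdG t.2.1 t.1.1 t.2.2 t.1.2 (u j) (p j) (q j) z ∂fdm ∂fdpi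
      = ∏ j, ∫ y, ∫ z, fdG t.2.1 t.1.1 t.2.2 t.1.2 (u j) (p j) y z ∂fdm ∂fdm := fun p =>
    integral_fintype_prod_eq_prod (μ := fun _ => fdm)
      (fun j y => ∫ z, fdG t.2.1 t.1.1 t.2.2 t.1.2 (u j) (p j) y z ∂fdm)
  simp_rw [e1, e2]
  exact integral_fintype_prod_eq_prod (μ := fun _ => fdm)
      (fun j x => ∫ y, ∫ z, fdG t.2.1 t.1.1 t.2.2 t.1.2 (u j) x y z ∂fdm ∂fdm)

lemma fd_core (κ : Measure ℝ) [IsFiniteMeasure κ] (β : ℝ) (u : Fin 3 → ℝ) :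
    ‖∫ w : (Fin 3 → ℝ) × (Fin 3 → ℝ) × (Fin 3 → ℝ), fdphi κ (fdX β w.1) * fdphi κ (fdX β w.2.1) *
      fdphi κ (fdX β w.2.2) * fdphi κ (fdX β (w.1 - w.2.1 + w.2.2 + u))
      ∂(fdpi.prod (fdpi.prod fdpi))‖
      ≤ 32 * ((∫ t, fdA t ∂κ) * fdZ κ ^ 3) := by
  refine le_trans (le_of_eq ?_) (fd_core1 κ β u)
  simp_rw [← fd_inner]
  rw [integral_integral_swap]
  · congr 2; ext w
    have e : ∀ t : (ℝ × ℝ) × (ℝ × ℝ), fdE (fdS β u t w)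
        = (fdE (t.1.1 * fdX β w.2.1) * fdE (t.1.2 * fdX β (w.1 - w.2.1 + w.2.2 + u)))
          * (fdE (t.2.1 * fdX β w.1) * fdE (t.2.2 * fdX β w.2.2)) := by
      intro t
      simp only [← fdE_add]
      congr 1
      unfold fdS; ring
    simp_rw [e]
    rw [integral_prod_mul (fun q : ℝ × ℝ => (fdE (q.1 * fdX β w.2.1) *
        fdE (q.2 * fdX β (w.1 - w.2.1 + w.2.2 + u))))
        (fun q : ℝ × ℝ => (fdE (q.1 * fdX β w.1) * fdE (q.2 * fdX β w.2.2))),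
      integral_prod_mul (fun q : ℝ => fdE (q * fdX β w.2.1))
        (fun q => fdE (q * fdX β (w.1 - w.2.1 + w.2.2 + u))),
      integral_prod_mul (fun q : ℝ => fdE (q * fdX β w.1)) (fun q => fdE (q * fdX β w.2.2))]
    unfold fdphi
    ring
  · refine fd_int ?_ 1 (fun q => (fdE_norm _).le)
    unfold Function.uncurry fdS; fun_prop

def fdk (a : ℝ) : Measure ℝ := volume.withDensity (fun t => ENNReal.ofReal (Real.exp (-a * |t|)))

lemma fd_exp_integrable {a : ℝ} (ha : 0 < a) : Integrable fun t : ℝ => Real.exp (-a * |t|) := by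
  rw [← integrableOn_univ, ← Set.Iic_union_Ioi (a := (0:ℝ))]
  refine IntegrableOn.union ?_ ?_
  · refine (integrableOn_exp_mul_Iic (a := a) ha 0).congr_fun (fun t ht => ?_) measurableSet_Iic
    simp only [Set.mem_Iic] at ht
    simp [abs_of_nonpos ht]
  · refine (integrableOn_exp_mul_Ioi (a := -a) (by linarith) 0).congr_fun (fun t ht => ?_) measurableSet_Ioi
    simp only [Set.mem_Ioi] at ht
    simp [abs_of_pos ht]

lemma fdk_finite {a : ℝ} (ha : 0 < a) : IsFiniteMeasure (fdk a) :=
  isFiniteMeasure_withDensity_ofReal (fd_exp_integrable ha).2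

lemma fdk_integral {F : Type*} [NormedAddCommGroup F] [NormedSpace ℝ F] (a : ℝ) (f : ℝ → F) :
    ∫ t, f t ∂(fdk a) = ∫ t, Real.exp (-a * |t|) • f t := by
  unfold fdk
  rw [integral_withDensity_eq_integral_toReal_smul (by fun_prop) (by simp)]
  congr 1; ext t
  rw [ENNReal.toReal_ofReal (Real.exp_pos _).le]

lemma fdk_phi {a : ℝ} (ha : 0 < a) (x : ℝ) :
    fdphi (fdk a) x = ((2 * a / (a ^ 2 + x ^ 2) : ℝ) : ℂ) := by
  unfold fdphi
  rw [fdk_integral]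
  have hc : Continuous fun t : ℝ => Real.exp (-a * |t|) • fdE (t * x) := by fun_prop
  have hi : Integrable fun t : ℝ => Real.exp (-a * |t|) • fdE (t * x) := by
    refine (fd_exp_integrable ha).mono' hc.aestronglyMeasurable (Eventually.of_forall fun t => ?_)
    rw [norm_smul, fdE_norm, mul_one, Real.norm_of_nonneg (Real.exp_pos _).le]
  rw [← intervalIntegral.integral_Iic_add_Ioi (b := 0) hi.integrableOn hi.integrableOn]
  have h1 : ∫ t in Set.Iic (0:ℝ), Real.exp (-a * |t|) • fdE (t * x) =
      ∫ t in Set.Iic (0:ℝ), Complex.exp ((a + x * Complex.I) * t) := by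
    refine setIntegral_congr_fun measurableSet_Iic fun t ht => ?_
    simp only [Set.mem_Iic] at ht
    simp only [abs_of_nonpos ht, fdE, Complex.real_smul, Complex.ofReal_exp, ← Complex.exp_add]
    congr 1; push_cast; ring
  have h2 : ∫ t in Set.Ioi (0:ℝ), Real.exp (-a * |t|) • fdE (t * x) =
      ∫ t in Set.Ioi (0:ℝ), Complex.exp ((-a + x * Complex.I) * t) := by
    refine setIntegral_congr_fun measurableSet_Ioi fun t ht => ?_
    simp only [Set.mem_Ioi] at ht
    simp only [abs_of_pos ht, fdE, Complex.real_smul, Complex.ofReal_exp, ← Complex.exp_add]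
    congr 1; push_cast; ring
  rw [h1, h2, integral_exp_mul_complex_Iic (by simpa using ha), integral_exp_mul_complex_Ioi (by simpa using ha)]
  have e1 : (a + x * Complex.I : ℂ) ≠ 0 := fun h => by
    have := congrArg Complex.re h; simp at this; exact ha.ne' this
  have e2 : (-a + x * Complex.I : ℂ) ≠ 0 := fun h => by
    have := congrArg Complex.re h; simp at this; exact ha.ne' this
  have e3 : (a ^ 2 + x ^ 2 : ℂ) ≠ 0 := by
    have : (a^2+x^2 : ℝ) ≠ 0 := by positivity
    exact_mod_cast this
  push_cast
  simp only [mul_zero, Complex.exp_zero]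
  rw [div_add_div _ _ e1 e2, div_eq_div_iff (mul_ne_zero e1 e2) e3]
  linear_combination (-2 * a * x ^ 2 : ℂ) * Complex.I_sq

lemma fd_sin_period (f : ℝ → ℝ) (x : ℝ) :
    f |Real.sin (Real.pi * (x + 1))| = f |Real.sin (Real.pi * x)| := by
  rw [mul_add, mul_one, Real.sin_add_pi, abs_neg]

lemma fd_sin_lb {x : ℝ} (hx : |x| ≤ 1/2) : 2 * |x| ≤ |Real.sin (Real.pi * x)| := by
  have hp := Real.pi_pos
  have h := Real.mul_abs_le_abs_sin (x := Real.pi * x) (by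
    rw [abs_mul, abs_of_pos hp]; nlinarith)
  rw [abs_mul, abs_of_pos hp] at h
  calc 2 * |x| = 2 / Real.pi * (Real.pi * |x|) := by field_simp
    _ ≤ _ := h

lemma fd_log_int {a : ℝ} (ha : 0 < a) :
    ∫ x in (0:ℝ)..(1/2), 2 / (a + 2 * x) = Real.log (1 + 1 / a) := by
  have h : ∀ x ∈ Set.uIcc (0:ℝ) (1/2), HasDerivAt (fun x => Real.log (a + 2 * x)) (2 / (a + 2 * x)) x := by
    intro x hx
    rw [Set.uIcc_of_le (by norm_num)] at hx
    have h1 : HasDerivAt (fun x => a + 2 * x) 2 x := by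
      simpa using ((hasDerivAt_id x).const_mul 2).const_add a
    exact h1.log (by have := hx.1; positivity)
  rw [intervalIntegral.integral_eq_sub_of_hasDerivAt h]
  · rw [← Real.log_div (by positivity) (by positivity)]
    congr 1; field_simp; ring
  · refine ContinuousOn.intervalIntegrable ?_
    refine ContinuousOn.div (by fun_prop) (by fun_prop) (fun x hx => ?_)
    rw [Set.uIcc_of_le (by norm_num)] at hx
    have := hx.1; positivity

lemma fd_even (f : ℝ → ℝ) (hc : Continuous f) (he : ∀ x, f (-x) = f x) :
    ∫ x, f x ∂fdm = 2 * ∫ x in (0:ℝ)..(1/2), f x := by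
  rw [fdm_integral, ← intervalIntegral.integral_add_adjacent_intervals (b := 0)
    (hc.intervalIntegrable _ _) (hc.intervalIntegrable _ _)]
  have : ∫ x in (-(1/2):ℝ)..0, f x = ∫ x in (0:ℝ)..(1/2), f x := by
    have := intervalIntegral.integral_comp_neg (a := 0) (b := 1/2) f
    simp only [he, neg_zero] at this
    exact this.symm
  rw [this]; ring

/-- mean of `1/(a+|sin πx|)`. -/
lemma fd_psi1 {a : ℝ} (ha : 0 < a) :
    ∫ x, 1 / (a + |Real.sin (Real.pi * x)|) ∂fdm ≤ Real.log (1 + 1 / a) := by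
  have hc : Continuous fun x : ℝ => 1 / (a + |Real.sin (Real.pi * x)|) :=
    Continuous.div (by fun_prop) (by fun_prop) (fun x => by positivity)
  rw [fd_even _ hc (fun x => by simp), ← fd_log_int ha, ← intervalIntegral.integral_const_mul]
  refine intervalIntegral.integral_mono_on (by norm_num) ?_ ?_ fun x hx => ?_
  · exact (hc.const_mul 2 |>.intervalIntegrable _ _)
  · refine ContinuousOn.intervalIntegrable ?_
    refine ContinuousOn.div (by fun_prop) (by fun_prop) (fun x hx => ?_)
    rw [Set.uIcc_of_le (by norm_num)] at hx
    have := hx.1; positivity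
  · have h := fd_sin_lb (x := x) (by rw [abs_of_nonneg hx.1]; exact hx.2)
    rw [abs_of_nonneg hx.1] at h
    have := hx.1
    rw [mul_one_div]
    gcongr

lemma fd_psi {a : ℝ} (ha : 0 < a) :
    ∫ x, 1 / (a + |Real.sin (2 * Real.pi * x)|) ∂fdm ≤ Real.log (1 + 1 / a) := by
  have hc : Continuous fun x : ℝ => 1 / (a + |Real.sin (Real.pi * x)|) :=
    Continuous.div (by fun_prop) (by fun_prop) (fun x => by positivity)
  refine le_of_eq_of_le ?_ (fd_psi1 ha)
  rw [fdm_integral]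
  have h := intervalIntegral.integral_comp_mul_left (a := -(1/2)) (b := 1/2)
    (fun x => 1 / (a + |Real.sin (Real.pi * x)|)) (c := 2) (by norm_num)
  have e : ∀ x : ℝ, Real.pi * (2 * x) = 2 * Real.pi * x := fun x => by ring
  simp only [e] at h
  rw [h]
  rw [show (2:ℝ) * -(1/2) = -(1/2) + -(1/2) by ring, show (2:ℝ) * (1/2) = 1/2 + 1/2 by ring,
    ← intervalIntegral.integral_add_adjacent_intervals (b := 0)
    (hc.intervalIntegrable _ _) (hc.intervalIntegrable _ _)]
  have hp : Function.Periodic (fun x : ℝ => 1 / (a + |Real.sin (Real.pi * x)|)) 1 :=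
    fun x => fd_sin_period (fun y => 1 / (a + y)) x
  have h1 := hp.intervalIntegral_add_eq (-1) (-(1/2))
  have h2 := hp.intervalIntegral_add_eq 0 (-(1/2))
  norm_num at h1 h2 ⊢
  rw [h1, h2, fdm_integral]
  norm_num
  ring

lemma fd_log_le {t ε : ℝ} (ht : 0 < t) (hε : 0 < ε) (hε1 : ε ≤ 1) :
    Real.log (1 + t) ≤ t ^ ε / ε := by
  have h1 : (1 + t) ^ ε ≤ 1 + t ^ ε := by
    have := NNReal.rpow_add_le_add_rpow 1 t.toNNReal hε.le hε1
    have h := NNReal.coe_le_coe.mpr this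
    simpa [Real.coe_toNNReal t ht.le] using h
  have h2 : ε * Real.log (1 + t) ≤ t ^ ε := by
    rw [← Real.log_rpow (by positivity)]
    have := Real.log_le_sub_one_of_pos (x := (1 + t) ^ ε) (by positivity)
    linarith
  rw [le_div_iff₀ hε]; linarith

lemma fdA_abs (t : ℝ) : fdA |t| = fdA t := by simp [fdA]

lemma fdA_le {t ε : ℝ} (ht : 0 < t) (hε : 0 < ε) (hε1 : ε ≤ 1) :
    fdA t ≤ t ^ (ε - 1) / ε := by
  have h1 : fdA t = (1 / t) * ∫ x, 1 / (1 / t + |Real.sin (2 * Real.pi * x)|) ∂fdm := by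
    unfold fdA
    rw [← integral_const_mul]
    congr 1; ext x
    rw [abs_of_pos ht]
    have : 0 ≤ |Real.sin (2 * Real.pi * x)| := abs_nonneg _
    field_simp
  have h2 := fd_psi (a := 1 / t) (by positivity)
  rw [one_div_one_div] at h2
  rw [h1, Real.rpow_sub ht, Real.rpow_one]
  calc _ ≤ 1 / t * (t ^ ε / ε) := by
        gcongr; exact h2.trans (fd_log_le ht hε hε1)
    _ = _ := by field_simp

lemma fd_Gamma_le {ε : ℝ} (hε : 0 < ε) (hε1 : ε ≤ 1) : Real.Gamma ε ≤ 1 / ε := by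
  have h := Real.convexOn_Gamma.2 (show (1:ℝ) ∈ Set.Ioi 0 by simp) (show (2:ℝ) ∈ Set.Ioi 0 by simp)
    (show 0 ≤ 1 - ε by linarith) hε.le (by ring)
  simp only [smul_eq_mul, Real.Gamma_one, Real.Gamma_two] at h
  rw [show (1 - ε) * 1 + ε * 2 = ε + 1 by ring, Real.Gamma_add_one hε.ne'] at h
  rw [le_div_iff₀ hε]; linarith

lemma fdk_A {a ε : ℝ} (ha : 0 < a) (hε : 0 < ε) (hε1 : ε ≤ 1) :
    ∫ t, fdA t ∂(fdk a) ≤ 2 / ε ^ 2 * (1 / a) ^ ε := by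
  rw [fdk_integral]
  have h1 : ∫ t, Real.exp (-a * |t|) • fdA t = 2 * ∫ t in Set.Ioi (0:ℝ), Real.exp (-a * t) * fdA t := by
    rw [← integral_comp_abs]
    congr 1; ext t
    rw [fdA_abs, smul_eq_mul]
  have hI := Real.integral_rpow_mul_exp_neg_mul_Ioi hε ha
  have hInt : IntegrableOn (fun t : ℝ => t ^ (ε - 1) * Real.exp (-(a * t))) (Set.Ioi 0) := by
    by_contra hn
    rw [integral_undef hn] at hI
    have := Real.Gamma_pos_of_pos hε
    have : 0 < (1 / a) ^ ε * Real.Gamma ε := by positivity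
    linarith
  have h2 : ∫ t in Set.Ioi (0:ℝ), Real.exp (-a * t) * fdA t
      ≤ ∫ t in Set.Ioi (0:ℝ), (1 / ε) * (t ^ (ε - 1) * Real.exp (-(a * t))) := by
    refine integral_mono_of_nonneg ?_ (hInt.const_mul _) ?_
    · exact Eventually.of_forall fun t => mul_nonneg (Real.exp_pos _).le (fdA_nonneg _)
    · refine (ae_restrict_iff' measurableSet_Ioi).mpr (Eventually.of_forall fun t ht => ?_)
      have := fdA_le (t := t) ht hε hε1
      calc Real.exp (-a * t) * fdA t ≤ Real.exp (-a * t) * (t ^ (ε - 1) / ε) := by gcongr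
        _ = _ := by rw [neg_mul]; ring
  rw [h1]
  rw [integral_const_mul, hI] at h2
  have hG := fd_Gamma_le hε hε1
  calc _ ≤ 2 * (1 / ε * ((1 / a) ^ ε * Real.Gamma ε)) := by gcongr
    _ ≤ 2 * (1 / ε * ((1 / a) ^ ε * (1 / ε))) := by gcongr
    _ = _ := by field_simp

lemma fd_J {a σ : ℝ} (ha : 0 < a) (hσ : 0 ≤ σ) :
    ∫ x, 2 * a / (a ^ 2 + σ ^ 2 * |Real.sin (Real.pi * x)| ^ 2) ∂fdm ≤ 4 / (a + σ) := by
  have hc : Continuous fun x : ℝ => 2 * a / (a ^ 2 + σ ^ 2 * |Real.sin (Real.pi * x)| ^ 2) :=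
    Continuous.div (by fun_prop) (by fun_prop) (fun x => by positivity)
  have hd : ContinuousOn (fun x : ℝ => 4 * a / (a + 2 * σ * x) ^ 2) (Set.uIcc (0:ℝ) (1/2)) := by
    refine ContinuousOn.div (by fun_prop) (by fun_prop) (fun x hx => ?_)
    rw [Set.uIcc_of_le (by norm_num)] at hx
    have := hx.1; positivity
  have hv : ∫ x in (0:ℝ)..(1/2), 4 * a / (a + 2 * σ * x) ^ 2 = 2 / (a + σ) := by
    have h : ∀ x ∈ Set.uIcc (0:ℝ) (1/2), HasDerivAt (fun x => 4 * x / (a + 2 * σ * x))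
        (4 * a / (a + 2 * σ * x) ^ 2) x := by
      intro x hx
      rw [Set.uIcc_of_le (by norm_num)] at hx
      have h1 : HasDerivAt (fun x => a + 2 * σ * x) (2 * σ) x := by
        simpa using ((hasDerivAt_id x).const_mul (2 * σ)).const_add a
      have h2 : HasDerivAt (fun x : ℝ => 4 * x) 4 x := by
        simpa using (hasDerivAt_id x).const_mul 4
      refine (h2.div h1 (by have := hx.1; positivity)).congr_deriv ?_
      congr 1; ring
    rw [intervalIntegral.integral_eq_sub_of_hasDerivAt h hd.intervalIntegrable]
    have : a + σ ≠ 0 := by positivity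
    have : a + 2 * σ * (1/2) ≠ 0 := by positivity
    field_simp; ring
  rw [fd_even _ hc (fun x => by simp)]
  have : ∫ x in (0:ℝ)..(1/2), 2 * a / (a ^ 2 + σ ^ 2 * |Real.sin (Real.pi * x)| ^ 2)
      ≤ ∫ x in (0:ℝ)..(1/2), 4 * a / (a + 2 * σ * x) ^ 2 := by
    refine intervalIntegral.integral_mono_on (by norm_num) (hc.intervalIntegrable _ _)
      hd.intervalIntegrable fun x hx => ?_
    have h := fd_sin_lb (x := x) (by rw [abs_of_nonneg hx.1]; exact hx.2)
    rw [abs_of_nonneg hx.1] at h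
    have h0 := hx.1
    have h3 : (2 * x) ^ 2 ≤ |Real.sin (Real.pi * x)| ^ 2 := by gcongr
    have h4 : σ ^ 2 * (2 * x) ^ 2 ≤ σ ^ 2 * |Real.sin (Real.pi * x)| ^ 2 := by gcongr
    rw [div_le_div_iff₀ (by positivity) (by positivity)]
    have h5 : (a + 2 * σ * x) ^ 2 ≤ 2 * (a ^ 2 + σ ^ 2 * |Real.sin (Real.pi * x)| ^ 2) := by
      nlinarith [sq_nonneg (a - 2 * σ * x)]
    nlinarith
  rw [hv] at this
  calc _ ≤ 2 * (2 / (a + σ)) := by gcongr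
    _ = _ := by ring

lemma fd_ker {a : ℝ} (ha : 0 < a) (x y : ℝ) :
    2 * a / (a ^ 2 + (fdc x - fdc y) ^ 2) ≤
      2 * a / (a ^ 2 + |Real.sin (2 * Real.pi * x)| ^ 2 * |Real.sin (Real.pi * (y + x))| ^ 2)
      + 2 * a / (a ^ 2 + |Real.sin (2 * Real.pi * x)| ^ 2 * |Real.sin (Real.pi * (y + -x))| ^ 2) := by
  set A := |Real.sin (Real.pi * (y + x))| with hA
  set B := |Real.sin (Real.pi * (y + -x))| with hB
  set σ := |Real.sin (2 * Real.pi * x)| with hσ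
  have hA0 : 0 ≤ A := abs_nonneg _
  have hB0 : 0 ≤ B := abs_nonneg _
  have hσ0 : 0 ≤ σ := abs_nonneg _
  have h1 : (fdc x - fdc y) ^ 2 = 4 * A ^ 2 * B ^ 2 := by
    rw [hA, hB, sq_abs, sq_abs]
    unfold fdc
    rw [Real.cos_sub_cos]
    rw [show (2 * Real.pi * x + 2 * Real.pi * y) / 2 = Real.pi * (y + x) by ring,
      show (2 * Real.pi * x - 2 * Real.pi * y) / 2 = -(Real.pi * (y + -x)) by ring, Real.sin_neg]
    ring
  have h2 : σ ≤ A + B := by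
    rw [hσ, show 2 * Real.pi * x = Real.pi * (y + x) - Real.pi * (y + -x) by ring, Real.sin_sub]
    refine (abs_sub _ _).trans ?_
    rw [abs_mul, abs_mul]
    have := Real.abs_cos_le_one (Real.pi * (y + -x))
    have := Real.abs_cos_le_one (Real.pi * (y + x))
    nlinarith
  rw [h1]
  have n1 : 0 ≤ 2 * a / (a ^ 2 + σ ^ 2 * A ^ 2) := by positivity
  have n2 : 0 ≤ 2 * a / (a ^ 2 + σ ^ 2 * B ^ 2) := by positivity
  rcases le_total A B with h | h
  · have : σ ^ 2 * A ^ 2 ≤ 4 * A ^ 2 * B ^ 2 := by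
      have : σ ^ 2 ≤ (2 * B) ^ 2 := by gcongr; linarith
      nlinarith [sq_nonneg A]
    have : 2 * a / (a ^ 2 + 4 * A ^ 2 * B ^ 2) ≤ 2 * a / (a ^ 2 + σ ^ 2 * A ^ 2) := by gcongr
    linarith
  · have : σ ^ 2 * B ^ 2 ≤ 4 * A ^ 2 * B ^ 2 := by
      have : σ ^ 2 ≤ (2 * A) ^ 2 := by gcongr; linarith
      nlinarith [sq_nonneg B]
    have : 2 * a / (a ^ 2 + 4 * A ^ 2 * B ^ 2) ≤ 2 * a / (a ^ 2 + σ ^ 2 * B ^ 2) := by gcongr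
    linarith

lemma fd_ker_le {a : ℝ} (ha : 0 < a) {y : ℝ} (hy : 0 ≤ y) : ‖2 * a / (a ^ 2 + y)‖ ≤ 2 / a := by
  rw [Real.norm_of_nonneg (by positivity), div_le_div_iff₀ (by positivity) ha]
  nlinarith

lemma fd_inner1 {a : ℝ} (ha : 0 < a) (x : ℝ) :
    ∫ y, 2 * a / (a ^ 2 + (fdc x - fdc y) ^ 2) ∂fdm ≤ 8 / (a + |Real.sin (2 * Real.pi * x)|) := by
  set σ := |Real.sin (2 * Real.pi * x)| with hσ
  have hσ0 : 0 ≤ σ := abs_nonneg _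
  have hi : ∀ c : ℝ, Integrable (fun y => 2 * a / (a ^ 2 + σ ^ 2 * |Real.sin (Real.pi * (y + c))| ^ 2)) fdm := by
    intro c
    refine fd_int ?_ (2 / a) fun y => fd_ker_le ha (by positivity)
    exact Continuous.div (by fun_prop) (by fun_prop) (fun x => by positivity)
  have hJ : ∀ c : ℝ, ∫ y, 2 * a / (a ^ 2 + σ ^ 2 * |Real.sin (Real.pi * (y + c))| ^ 2) ∂fdm ≤ 4 / (a + σ) := by
    intro c
    rw [fdm_shift (fun y => 2 * a / (a ^ 2 + σ ^ 2 * |Real.sin (Real.pi * y)| ^ 2))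
      (fun y => fd_sin_period (fun z => 2 * a / (a ^ 2 + σ ^ 2 * z ^ 2)) y)]
    exact fd_J ha hσ0
  calc _ ≤ ∫ y, (2 * a / (a ^ 2 + σ ^ 2 * |Real.sin (Real.pi * (y + x))| ^ 2)
      + 2 * a / (a ^ 2 + σ ^ 2 * |Real.sin (Real.pi * (y + -x))| ^ 2)) ∂fdm := by
        refine integral_mono ?_ ((hi x).add (hi (-x))) fun y => fd_ker ha x y
        refine fd_int ?_ (2 / a) fun y => fd_ker_le ha (by positivity)
        exact Continuous.div (by fun_prop) (by fun_prop) (fun x => by positivity)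
    _ ≤ 4 / (a + σ) + 4 / (a + σ) := by
        rw [integral_add (hi x) (hi (-x))]
        exact add_le_add (hJ x) (hJ (-x))
    _ = _ := by ring

lemma fd_Za {a : ℝ} (ha : 0 < a) :
    ∫ x, ∫ y, 2 * a / (a ^ 2 + (fdc x - fdc y) ^ 2) ∂fdm ∂fdm ≤ 8 * Real.log (1 + 1 / a) := by
  have h1 : Integrable (fun x => 8 * (1 / (a + |Real.sin (2 * Real.pi * x)|))) fdm := by
    refine Integrable.const_mul (fd_int ?_ (1 / a) fun x => ?_) 8
    · exact Continuous.div (by fun_prop) (by fun_prop) (fun x => by positivity)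
    · rw [Real.norm_of_nonneg (by positivity)]
      gcongr
      linarith [abs_nonneg (Real.sin (2 * Real.pi * x))]
  calc _ ≤ ∫ x, 8 * (1 / (a + |Real.sin (2 * Real.pi * x)|)) ∂fdm := by
        refine integral_mono_of_nonneg (Eventually.of_forall fun x => integral_nonneg fun y => by positivity) h1
          (Eventually.of_forall fun x => ?_)
        refine (fd_inner1 ha x).trans_eq (by ring)
    _ ≤ _ := by
        rw [integral_const_mul]
        have := fd_psi ha
        gcongr

/-- the measure kappa. -/
def fdK (η : ℝ) (N : ℕ) : Measure ℝ := ∑ k ∈ Finset.range (N + 1), fdk (η * 2 ^ k)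

def fdPhi (η : ℝ) (N : ℕ) (x : ℝ) : ℝ :=
  ∑ k ∈ Finset.range (N + 1), 2 * (η * 2 ^ k) / ((η * 2 ^ k) ^ 2 + x ^ 2)

lemma fdK_finite {η : ℝ} (hη : 0 < η) (N : ℕ) : IsFiniteMeasure (fdK η N) := by
  have : ∀ k : ℕ, IsFiniteMeasure (fdk (η * 2 ^ k)) := fun k => fdk_finite (by positivity)
  unfold fdK; infer_instance

lemma fdK_phi {η : ℝ} (hη : 0 < η) (N : ℕ) (x : ℝ) : fdphi (fdK η N) x = (fdPhi η N x : ℂ) := by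
  have : ∀ k : ℕ, IsFiniteMeasure (fdk (η * 2 ^ k)) := fun k => fdk_finite (by positivity)
  have h : fdphi (fdK η N) x = ∑ k ∈ Finset.range (N + 1), fdphi (fdk (η * 2 ^ k)) x := by
    unfold fdphi fdK
    refine integral_finsetSum_measure fun k _ => ?_
    exact fd_int (by fun_prop) 1 fun t => (fdE_norm _).le
  rw [h, fdPhi, Complex.ofReal_sum]
  exact Finset.sum_congr rfl fun k _ => fdk_phi (by positivity) x

lemma fdPhi_nonneg {η : ℝ} (hη : 0 < η) (N : ℕ) (x : ℝ) : 0 ≤ fdPhi η N x :=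
  Finset.sum_nonneg fun k _ => by positivity

lemma fdK_A {η ε : ℝ} (hη : 0 < η) (hε : 0 < ε) (hε1 : ε ≤ 1) (N : ℕ) :
    ∫ t, fdA t ∂(fdK η N) ≤ (N + 1) * (2 / ε ^ 2 * (1 / η) ^ ε) := by
  have : ∀ k : ℕ, IsFiniteMeasure (fdk (η * 2 ^ k)) := fun k => fdk_finite (by positivity)
  unfold fdK
  rw [integral_finsetSum_measure fun k _ => fdA_int _]
  calc _ ≤ ∑ k ∈ Finset.range (N + 1), (2 / ε ^ 2 * (1 / η) ^ ε) := by
        refine Finset.sum_le_sum fun k _ => (fdk_A (by positivity) hε hε1).trans ?_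
        gcongr
        exact le_mul_of_one_le_right hη.le (one_le_pow₀ (by norm_num))
    _ = _ := by simp

lemma fdK_Z {η : ℝ} (hη : 0 < η) (N : ℕ) :
    fdZ (fdK η N) ≤ (N + 1) * (8 * Real.log (1 + 1 / η)) := by
  unfold fdZ
  have hker : ∀ k : ℕ, Continuous fun q : ℝ × ℝ => 2 * (η * 2 ^ k) / ((η * 2 ^ k) ^ 2 + (fdc q.1 - fdc q.2) ^ 2) :=
    fun k => Continuous.div (by fun_prop) (by fun_prop) (fun x => by positivity)
  have e1 : ∀ x y : ℝ, ‖fdphi (fdK η N) (fdc x - fdc y)‖ = fdPhi η N (fdc x - fdc y) := fun x y => by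
    rw [fdK_phi hη, Complex.norm_real, Real.norm_of_nonneg (fdPhi_nonneg hη _ _)]
  simp_rw [e1, fdPhi]
  have e2 : ∀ x : ℝ, ∫ y, ∑ k ∈ Finset.range (N + 1),
      2 * (η * 2 ^ k) / ((η * 2 ^ k) ^ 2 + (fdc x - fdc y) ^ 2) ∂fdm
      = ∑ k ∈ Finset.range (N + 1), ∫ y, 2 * (η * 2 ^ k) / ((η * 2 ^ k) ^ 2 + (fdc x - fdc y) ^ 2) ∂fdm := by
    intro x
    refine integral_finsetSum _ fun k _ => ?_
    have hcy : Continuous fun y : ℝ => 2 * (η * 2 ^ k) / ((η * 2 ^ k) ^ 2 + (fdc x - fdc y) ^ 2) :=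
      Continuous.div (by fun_prop) (by fun_prop) (fun x => by positivity)
    exact fd_int hcy (2 / (η * 2 ^ k)) fun y => fd_ker_le (by positivity) (by positivity)
  simp_rw [e2]
  rw [integral_finsetSum]
  · calc _ ≤ ∑ k ∈ Finset.range (N + 1), (8 * Real.log (1 + 1 / η)) := by
          refine Finset.sum_le_sum fun k _ => (fd_Za (by positivity)).trans ?_
          gcongr
          exact le_mul_of_one_le_right hη.le (one_le_pow₀ (by norm_num))
      _ = _ := by simp
  · intro k _
    refine fd_int (fd_cont (by exact hker k) (2 / (η * 2 ^ k)) fun x y => fd_ker_le (by positivity) (by positivity))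
      (2 / (η * 2 ^ k)) fun x => ?_
    have := norm_integral_le_of_norm_le_const (μ := fdm) (C := 2 / (η * 2 ^ k))
      (f := fun y => 2 * (η * 2 ^ k) / ((η * 2 ^ k) ^ 2 + (fdc x - fdc y) ^ 2))
      (Eventually.of_forall fun y => fd_ker_le (by positivity) (by positivity))
    simpa using this

lemma fdPhi_lb {η : ℝ} (hη : 0 < η) (N : ℕ) (hN : 6 < η * 2 ^ N) {x : ℝ} (hx : |x| ≤ 6) :
    1 / Real.sqrt (x ^ 2 + η ^ 2) ≤ 5 / 2 * fdPhi η N x := by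
  have hterm : ∀ k ∈ Finset.range (N + 1),
      2 * (η * 2 ^ k) / ((η * 2 ^ k) ^ 2 + x ^ 2) ≤ fdPhi η N x := fun k hk =>
    Finset.single_le_sum (f := fun k => 2 * (η * 2 ^ k) / ((η * 2 ^ k) ^ 2 + x ^ 2))
      (fun k _ => by positivity) hk
  have hxs : |x| ^ 2 = x ^ 2 := sq_abs x
  rcases le_total |x| η with h | h
  · have h1 := hterm 0 (by simp)
    have h2 : 1 / Real.sqrt (x ^ 2 + η ^ 2) ≤ 1 / η := by
      gcongr
      refine Real.le_sqrt_of_sq_le ?_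
      nlinarith [sq_nonneg x]
    refine h2.trans ?_
    have h3 : 1 / η ≤ 2 * (η * 2 ^ 0) / ((η * 2 ^ 0) ^ 2 + x ^ 2) := by
      rw [div_le_div_iff₀ hη (by positivity)]
      nlinarith [abs_nonneg x]
    nlinarith [fdPhi_nonneg hη N x]
  · have hx0 : 0 < |x| := hη.trans_le h
    obtain ⟨k, hk1, hk2⟩ := exists_nat_pow_near (x := |x| / η) (y := 2) (by rwa [le_div_iff₀ hη, one_mul]) (by norm_num)
    rw [le_div_iff₀ hη] at hk1
    rw [div_lt_iff₀ hη] at hk2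
    have hkN : k < N + 1 := by
      by_contra hcon
      have : (2:ℝ) ^ N ≤ 2 ^ k := pow_le_pow_right₀ (by norm_num) (by omega)
      nlinarith
    have h1 := hterm k (by simpa using hkN)
    have h2 : 1 / Real.sqrt (x ^ 2 + η ^ 2) ≤ 1 / |x| := by
      gcongr
      refine Real.le_sqrt_of_sq_le ?_
      nlinarith [sq_nonneg η]
    refine h2.trans ?_
    set a := η * 2 ^ k with ha
    have ha0 : 0 < a := by positivity
    have hk1' : a ≤ |x| := by linarith
    have hk2' : |x| < 2 * a := by rw [pow_succ] at hk2; linarith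
    have h3 : 2 / 5 * (1 / |x|) ≤ 2 * a / (a ^ 2 + x ^ 2) := by
      rw [mul_one_div, div_le_div_iff₀ hx0 (by positivity), ← hxs]
      nlinarith
    linarith

lemma fdpi_eq : (volume : Measure (Fin 3 → ℝ)).restrict T3 = fdpi := by
  unfold T3 fdpi fdm
  rw [volume_pi, Measure.restrict_pi_pi]
  congr 1; ext1 j
  exact (Measure.restrict_congr_set Ioc_ae_eq_Icc).symm

lemma fd_edisp (α : ℝ) (p : Fin 3 → ℝ) : α - edisp p = fdX (3 - α) p := by
  simp only [edisp, fdX, fdc, Fin.sum_univ_three]; ring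

lemma fd_nrm (α η : ℝ) (p : Fin 3 → ℝ) :
    ‖(α : ℂ) - (edisp p : ℂ) + (η : ℂ) * Complex.I‖ = Real.sqrt (fdX (3 - α) p ^ 2 + η ^ 2) := by
  rw [← fd_edisp, ← Complex.ofReal_sub, Complex.norm_add_mul_I]

lemma fdX_le {α : ℝ} (hα : α ∈ Set.Icc (0:ℝ) 6) (p : Fin 3 → ℝ) : |fdX (3 - α) p| ≤ 6 := by
  simp only [fdX, fdc, Fin.sum_univ_three]
  have h0 := Real.cos_le_one (2 * Real.pi * p 0)
  have h1 := Real.cos_le_one (2 * Real.pi * p 1)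
  have h2 := Real.cos_le_one (2 * Real.pi * p 2)
  have h0' := Real.neg_one_le_cos (2 * Real.pi * p 0)
  have h1' := Real.neg_one_le_cos (2 * Real.pi * p 1)
  have h2' := Real.neg_one_le_cos (2 * Real.pi * p 2)
  rw [abs_le]
  constructor <;> linarith [hα.1, hα.2]

/-- the reciprocal of the denominator. -/
def fdR (η α : ℝ) (p : Fin 3 → ℝ) : ℝ := 1 / Real.sqrt (fdX (3 - α) p ^ 2 + η ^ 2)

lemma fdR_cont {η : ℝ} (hη : 0 < η) (α : ℝ) : Continuous (fdR η α) :=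
  Continuous.div (by fun_prop) (by fun_prop) (fun x => by positivity)

lemma fdR_nonneg (η α : ℝ) (p : Fin 3 → ℝ) : 0 ≤ fdR η α p := by unfold fdR; positivity

lemma fdR_le {η : ℝ} (hη : 0 < η) (α : ℝ) (p : Fin 3 → ℝ) : fdR η α p ≤ 1 / η := by
  unfold fdR
  gcongr
  refine Real.le_sqrt_of_sq_le ?_
  nlinarith [sq_nonneg (fdX (3 - α) p)]

lemma fdPhi_cont {η : ℝ} (hη : 0 < η) (N : ℕ) : Continuous (fdPhi η N) := by
  unfold fdPhi
  refine continuous_finsetSum _ fun k _ => ?_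
  exact Continuous.div (by fun_prop) (by fun_prop) (fun x => by positivity)

lemma fdPhi_le {η : ℝ} (hη : 0 < η) (N : ℕ) (x : ℝ) : fdPhi η N x ≤ (fdK η N).real Set.univ := by
  have := fdK_finite hη N
  have h := fdphi_norm (fdK η N) x
  rwa [fdK_phi hη, Complex.norm_real, Real.norm_of_nonneg (fdPhi_nonneg hη _ _)] at h

lemma fd_prod4_le {a b c d M : ℝ} (ha : 0 ≤ a) (hb : 0 ≤ b) (hc : 0 ≤ c) (hd : 0 ≤ d)
    (ha' : a ≤ M) (hb' : b ≤ M) (hc' : c ≤ M) (hd' : d ≤ M) : ‖a * b * c * d‖ ≤ M * M * M * M := by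
  have hM : 0 ≤ M := ha.trans ha'
  rw [Real.norm_of_nonneg (by positivity)]
  gcongr

lemma fd_main {η : ℝ} (hη : 0 < η) (N : ℕ) (hN : 6 < η * 2 ^ N) {α : ℝ} (hα : α ∈ Set.Icc (0:ℝ) 6)
    (u : Fin 3 → ℝ) :
    (∫ p in T3, ∫ q in T3, ∫ r in T3,
                1 /
                  (‖(α : ℂ) - (edisp p : ℂ) + (η : ℂ) * Complex.I‖ *
                    ‖(α : ℂ) - (edisp q : ℂ) + (η : ℂ) * Complex.I‖ *
                    ‖(α : ℂ) - (edisp r : ℂ) + (η : ℂ) * Complex.I‖ *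
                    ‖(α : ℂ) - (edisp (p - q + r + u) : ℂ) + (η : ℂ) * Complex.I‖))
      ≤ (5 / 2) ^ 4 * (32 * ((∫ t, fdA t ∂(fdK η N)) * fdZ (fdK η N) ^ 3)) := by
  have := fdK_finite hη N
  have hR := fdR_cont hη α
  have hP : Continuous fun p => fdPhi η N (fdX (3 - α) p) := (fdPhi_cont hη N).comp (fdX_cont _)
  rw [fdpi_eq]
  have e0 : ∀ p q r : Fin 3 → ℝ, 1 /
                  (‖(α : ℂ) - (edisp p : ℂ) + (η : ℂ) * Complex.I‖ *
                    ‖(α : ℂ) - (edisp q : ℂ) + (η : ℂ) * Complex.I‖ *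
                    ‖(α : ℂ) - (edisp r : ℂ) + (η : ℂ) * Complex.I‖ *
                    ‖(α : ℂ) - (edisp (p - q + r + u) : ℂ) + (η : ℂ) * Complex.I‖)
      = fdR η α p * fdR η α q * fdR η α r * fdR η α (p - q + r + u) := by
    intro p q r
    simp only [fd_nrm, fdR, one_div, mul_inv]
  simp_rw [e0]
  have hintg : Integrable (fun w : (Fin 3 → ℝ) × (Fin 3 → ℝ) × (Fin 3 → ℝ) =>
      fdR η α w.1 * fdR η α w.2.1 * fdR η α w.2.2 * fdR η α (w.1 - w.2.1 + w.2.2 + u))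
      (fdpi.prod (fdpi.prod fdpi)) := by
    refine fd_int (by fun_prop) (1 / η * (1 / η) * (1 / η) * (1 / η)) fun w => ?_
    apply fd_prod4_le <;> first | exact fdR_nonneg _ _ _ | exact fdR_le hη _ _
  have hintP : Integrable (fun w : (Fin 3 → ℝ) × (Fin 3 → ℝ) × (Fin 3 → ℝ) =>
      fdPhi η N (fdX (3 - α) w.1) * fdPhi η N (fdX (3 - α) w.2.1) * fdPhi η N (fdX (3 - α) w.2.2)
        * fdPhi η N (fdX (3 - α) (w.1 - w.2.1 + w.2.2 + u)))
      (fdpi.prod (fdpi.prod fdpi)) := by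
    have h1 := hP.comp (by fun_prop : Continuous fun w : (Fin 3 → ℝ) × (Fin 3 → ℝ) × (Fin 3 → ℝ) => w.1)
    have h2 := hP.comp (by fun_prop : Continuous fun w : (Fin 3 → ℝ) × (Fin 3 → ℝ) × (Fin 3 → ℝ) => w.2.1)
    have h3 := hP.comp (by fun_prop : Continuous fun w : (Fin 3 → ℝ) × (Fin 3 → ℝ) × (Fin 3 → ℝ) => w.2.2)
    have h4 := hP.comp (by fun_prop : Continuous fun w : (Fin 3 → ℝ) × (Fin 3 → ℝ) × (Fin 3 → ℝ) =>
      w.1 - w.2.1 + w.2.2 + u)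
    set M := (fdK η N).real Set.univ with hM
    refine fd_int (((h1.mul h2).mul h3).mul h4) (M * M * M * M) fun w => ?_
    apply fd_prod4_le <;> first | exact fdPhi_nonneg hη _ _ | exact fdPhi_le hη _ _
  have e1 : ∫ p, ∫ q, ∫ r, fdR η α p * fdR η α q * fdR η α r * fdR η α (p - q + r + u) ∂fdpi ∂fdpi ∂fdpi
      = ∫ w : (Fin 3 → ℝ) × (Fin 3 → ℝ) × (Fin 3 → ℝ),
      fdR η α w.1 * fdR η α w.2.1 * fdR η α w.2.2 * fdR η α (w.1 - w.2.1 + w.2.2 + u)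
      ∂(fdpi.prod (fdpi.prod fdpi)) := by
    rw [integral_prod _ hintg]
    congr 1; ext p
    rw [integral_prod]
    refine fd_int (by fun_prop) (1 / η * (1 / η) * (1 / η) * (1 / η)) fun w => ?_
    apply fd_prod4_le <;> first | exact fdR_nonneg _ _ _ | exact fdR_le hη _ _
  rw [e1]
  have hcore := fd_core (fdK η N) (3 - α) u
  simp_rw [fdK_phi hη, ← Complex.ofReal_mul] at hcore
  rw [integral_complex_ofReal, Complex.norm_real] at hcore
  have hle := (le_abs_self _).trans hcore
  have hlb : ∀ p, fdR η α p ≤ 5 / 2 * fdPhi η N (fdX (3 - α) p) := fun p =>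
    fdPhi_lb hη N hN (fdX_le hα p)
  calc _ ≤ ∫ w : (Fin 3 → ℝ) × (Fin 3 → ℝ) × (Fin 3 → ℝ), (5 / 2) ^ 4 * (
      fdPhi η N (fdX (3 - α) w.1) * fdPhi η N (fdX (3 - α) w.2.1) * fdPhi η N (fdX (3 - α) w.2.2)
        * fdPhi η N (fdX (3 - α) (w.1 - w.2.1 + w.2.2 + u)))
      ∂(fdpi.prod (fdpi.prod fdpi)) := by
        refine integral_mono hintg (hintP.const_mul _) fun w => ?_
        have n1 := fdPhi_nonneg hη N (fdX (3 - α) w.1)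
        have n2 := fdPhi_nonneg hη N (fdX (3 - α) w.2.1)
        have n3 := fdPhi_nonneg hη N (fdX (3 - α) w.2.2)
        have m2 := fdR_nonneg η α w.2.1
        have m3 := fdR_nonneg η α w.2.2
        have m4 := fdR_nonneg η α (w.1 - w.2.1 + w.2.2 + u)
        calc _ ≤ (5 / 2 * fdPhi η N (fdX (3 - α) w.1)) * (5 / 2 * fdPhi η N (fdX (3 - α) w.2.1))
              * (5 / 2 * fdPhi η N (fdX (3 - α) w.2.2))
              * (5 / 2 * fdPhi η N (fdX (3 - α) (w.1 - w.2.1 + w.2.2 + u))) := by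
              gcongr
              · exact hlb _
              · exact hlb _
              · exact hlb _
              · exact hlb _
          _ = _ := by ring
    _ ≤ _ := by
        rw [integral_const_mul]
        gcongr

lemma fd_num {η : ℝ} (hη : 0 < η) (hη2 : η ≤ 1 / 2) :
    ∃ N : ℕ, 6 < η * 2 ^ N ∧ (∫ t, fdA t ∂(fdK η N)) ≤ 486 * |Real.log η| ^ 3 ∧
      fdZ (fdK η N) ≤ 144 * |Real.log η| ^ 2 ∧ 1 / 2 ≤ |Real.log η| := by
  have hlog : Real.log η ≤ - Real.log 2 := by
    rw [← Real.log_inv]; exact Real.log_le_log hη (by linarith)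
  have hl2 := Real.log_two_gt_d9
  have hL : |Real.log η| = - Real.log η := abs_of_neg (by linarith)
  set L := |Real.log η| with hLdef
  have hLl : Real.log 2 ≤ L := by linarith
  obtain ⟨n, hn1, hn2⟩ := exists_nat_pow_near (x := 8 / η) (y := 2)
    (by rw [le_div_iff₀ hη]; linarith) (by norm_num)
  have hnL : (n : ℝ) * Real.log 2 ≤ 3 * Real.log 2 + L := by
    have h := Real.log_le_log (by positivity) hn1
    rw [Real.log_pow, Real.log_div (by norm_num) hη.ne', show (8:ℝ) = 2 ^ 3 by norm_num, Real.log_pow] at h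
    push_cast at h
    linarith
  have hN9 : ((n + 1 : ℕ) : ℝ) + 1 ≤ 9 * L := by
    push_cast
    by_contra hcon
    push Not at hcon
    nlinarith
  have hN0 : (0:ℝ) ≤ ((n + 1 : ℕ) : ℝ) + 1 := by positivity
  have hL0 : 0 < L := by linarith
  refine ⟨n + 1, ?_, ?_, ?_, by linarith⟩
  · rw [div_lt_iff₀ hη] at hn2; linarith
  · have h := fdK_A (ε := 1 / (1 + L)) hη (by positivity)
      (by rw [div_le_one (by positivity)]; linarith) (n + 1)
    have h1 : (1 / η) ^ (1 / (1 + L)) ≤ 3 := by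
      rw [Real.rpow_def_of_pos (by positivity), one_div η, Real.log_inv, ← hL]
      have : L * (1 / (1 + L)) ≤ 1 := by
        rw [mul_one_div, div_le_one (by positivity)]; linarith
      have := Real.exp_le_exp.mpr this
      linarith [Real.exp_one_lt_d9]
    have h2 : 2 / (1 / (1 + L)) ^ 2 ≤ 18 * L ^ 2 := by
      have : 2 / (1 / (1 + L)) ^ 2 = 2 * (1 + L) ^ 2 := by field_simp
      rw [this]; nlinarith
    calc _ ≤ _ := h
      _ ≤ (9 * L) * ((18 * L ^ 2) * 3) := by gcongr
      _ = _ := by ring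
  · have h := fdK_Z hη (n + 1)
    have h1 : Real.log (1 + 1 / η) ≤ 2 * L := by
      have : 1 + 1 / η ≤ (η⁻¹) ^ 2 := by
        rw [inv_pow, ← one_div, add_comm, div_add' _ _ _ hη.ne', div_le_div_iff₀ hη (by positivity)]
        nlinarith [sq_nonneg η]
      have := Real.log_le_log (by positivity) this
      rw [Real.log_pow, Real.log_inv] at this
      push_cast at this
      linarith
    have h0 : 0 ≤ Real.log (1 + 1 / η) := Real.log_nonneg (by
      have : 0 < 1 / η := by positivity
      linarith)
    calc _ ≤ _ := h
      _ ≤ (9 * L) * (8 * (2 * L)) := by gcongr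
      _ = _ := by ring

/-- Four Denominator Lemma: For every `Λ > 0` there exists `C_Λ > 0` such
that for every `0 < η ≤ min(Λ, 1/2)`, every `α ∈ [0,6]` with `|||α||| ≥ Λ`, and every
`u ∈ 𝕋³`, the four-denominator integral is at most `C_Λ |log η|^{14}`. -/
theorem statement8 (Λ : ℝ) (hΛ : 0 < Λ) :
    ∃ C : ℝ, 0 < C ∧
      ∀ η : ℝ, 0 < η → η ≤ min Λ (1/2) →
        ∀ α : ℝ, α ∈ Set.Icc (0 : ℝ) 6 → Λ ≤ anorm α →
          ∀ u : Fin 3 → ℝ,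
            (∫ p in T3, ∫ q in T3, ∫ r in T3,
                1 /
                  (‖(α : ℂ) - (edisp p : ℂ) + (η : ℂ) * Complex.I‖ *
                    ‖(α : ℂ) - (edisp q : ℂ) + (η : ℂ) * Complex.I‖ *
                    ‖(α : ℂ) - (edisp r : ℂ) + (η : ℂ) * Complex.I‖ *
                    ‖(α : ℂ) - (edisp (p - q + r + u) : ℂ) + (η : ℂ) * Complex.I‖)) ≤
              C * |Real.log η| ^ (14 : ℕ) := by
  refine ⟨(5 / 2) ^ 4 * (32 * (486 * 144 ^ 3)) * 2 ^ 5, by positivity, ?_⟩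
  intro η hη hη2 α hα _ u
  obtain ⟨N, hN, hA, hZ, hL⟩ := fd_num hη (hη2.trans (min_le_right _ _))
  refine (fd_main hη N hN hα u).trans ?_
  set L := |Real.log η|
  have hZ0 : 0 ≤ fdZ (fdK η N) := integral_nonneg fun x => integral_nonneg fun y => norm_nonneg _
  have hp : (1:ℝ) ≤ (2 * L) ^ 5 := one_le_pow₀ (by linarith)
  have hL0 : 0 ≤ L := by linarith
  calc _ ≤ (5 / 2) ^ 4 * (32 * ((486 * L ^ 3) * (144 * L ^ 2) ^ 3)) := by gcongr
    _ = (5 / 2) ^ 4 * (32 * (486 * 144 ^ 3)) * L ^ 9 * 1 := by ring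
    _ ≤ (5 / 2) ^ 4 * (32 * (486 * 144 ^ 3)) * L ^ 9 * (2 * L) ^ 5 := by gcongr
    _ = _ := by ring

end
end

section
/- Let 0 < κ ≤ 1/12. There exist C > 0 and λ₀ ∈ (0,1) (depending only on κ) such that for all 0 < λ ≤ λ₀, with η := λ^{2+κ}, for every α ∈ ℝ and every u ∈ 𝕋³: ∫_{𝕋³}∫_{𝕋³}∫_{𝕋³} dp dq dr / ( |α − ω̄(p) − iη| · |α − ω̄(q) − iη| · |α − ω̄(r) − iη| · |α − ω̄(p − q + r − u) − iη| ) ≤ C λ^{−3/4−3κ} |log η|⁴. -/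
open MeasureTheory Filter Topology

noncomputable section

/-- Normalized Lebesgue measure on `[-1/2,1/2]`. -/
def mu1 : Measure ℝ := volume.restrict (Set.Icc (-(1/2) : ℝ) (1/2))

instance mu1_prob : IsProbabilityMeasure mu1 := by
  constructor
  simp [mu1]
  norm_num

/-- `cos (2 π x)`. -/
def fc (x : ℝ) : ℝ := Real.cos (2 * Real.pi * x)

lemma fc_periodic : Function.Periodic fc 1 := by
  intro x
  unfold fc
  rw [mul_add, mul_one, Real.cos_add_two_pi]

lemma fc_cont : Continuous fc := by
  unfold fc; fun_prop

lemma integral_mu1 {E : Type*} [NormedAddCommGroup E] [NormedSpace ℝ E] (g : ℝ → E) :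
    ∫ x, g x ∂mu1 = ∫ x in (-(1/2) : ℝ)..(1/2), g x := by
  rw [intervalIntegral.integral_of_le (by norm_num), mu1, integral_Icc_eq_integral_Ioc]

lemma integral_mu1_shift {E : Type*} [NormedAddCommGroup E] [NormedSpace ℝ E] (g : ℝ → E)
    (hg : Function.Periodic g 1) (c : ℝ) : ∫ x, g (x + c) ∂mu1 = ∫ x, g x ∂mu1 := by
  rw [integral_mu1, integral_mu1, intervalIntegral.integral_comp_add_right]
  have := hg.intervalIntegral_add_eq (-(1/2) + c) (-(1/2))
  rw [show (-(1/2) : ℝ) + 1 = 1/2 by norm_num,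
    show (-(1/2) : ℝ) + c + 1 = 1/2 + c by ring] at this
  exact this

/-- the Bessel function `J_0` as an oscillatory integral -/
def Jb (t : ℝ) : ℂ := ∫ x, Complex.exp (((t * fc x : ℝ) : ℂ) * Complex.I) ∂mu1

lemma sin_lower (x : ℝ) (h1 : -(1/2) ≤ x) (h2 : x ≤ 1/2) :
    4 * |x| ≤ |Real.sin (2 * Real.pi * x)| ∨ 4 * |x - 1/2| ≤ |Real.sin (2 * Real.pi * x)| ∨
      4 * |x + 1/2| ≤ |Real.sin (2 * Real.pi * x)| := by
  have key : ∀ y : ℝ, |y| ≤ 1/4 → 4 * |y| ≤ |Real.sin (2 * Real.pi * y)| := by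
    intro y hy
    have hpi := Real.pi_pos
    have := Real.mul_abs_le_abs_sin (x := 2 * Real.pi * y) (by
      rw [abs_mul, abs_of_pos (by positivity)]; nlinarith)
    rw [abs_mul, abs_of_pos (show 0 < 2 * Real.pi by positivity)] at this
    convert this using 1
    field_simp; ring
  by_cases ha : |x| ≤ 1/4
  · exact Or.inl (key x ha)
  right
  rw [abs_le, not_and_or, not_le, not_le] at ha
  rcases ha with ha | ha
  · right
    have := key (x + 1/2) (by rw [abs_le]; constructor <;> linarith)
    rwa [show 2 * Real.pi * (x + 1/2) = 2 * Real.pi * x + Real.pi by ring, Real.sin_add_pi,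
      abs_neg] at this
  · left
    have := key (x - 1/2) (by rw [abs_le]; constructor <;> linarith)
    rwa [show 2 * Real.pi * (x - 1/2) = 2 * Real.pi * x - Real.pi by ring, Real.sin_sub_pi,
      abs_neg] at this

lemma integrable_inv_shift (c δ : ℝ) (hδ : 0 < δ) :
    Integrable (fun x : ℝ => (16 * (x - c) ^ 2 + δ ^ 2)⁻¹) ∧
    ∫ x : ℝ, (16 * (x - c) ^ 2 + δ ^ 2)⁻¹ ≤ 1 / δ := by
  have e : (fun x : ℝ => (16 * (x - c) ^ 2 + δ ^ 2)⁻¹) =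
      fun x : ℝ => (fun y : ℝ => (fun z : ℝ => (δ^2)⁻¹ * (1 + z ^ 2)⁻¹) (4 / δ * y)) (x - c) := by
    funext x
    simp only
    field_simp
    ring
  have hI := integrable_inv_one_add_sq.const_mul ((δ^2)⁻¹)
  rw [e]
  constructor
  · exact (hI.comp_mul_left' (by positivity)).comp_sub_right c
  · rw [integral_sub_right_eq_self (fun y : ℝ => (fun z : ℝ => (δ^2)⁻¹ * (1 + z ^ 2)⁻¹) (4 / δ * y)),
      Measure.integral_comp_mul_left (fun z : ℝ => (δ^2)⁻¹ * (1 + z ^ 2)⁻¹), integral_const_mul, integral_univ_inv_one_add_sq]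
    rw [abs_of_pos (by positivity), smul_eq_mul]
    have : (4 / δ)⁻¹ * ((δ ^ 2)⁻¹ * Real.pi) = (Real.pi / 4) / δ := by field_simp
    rw [this]
    gcongr
    linarith [Real.pi_le_four]

lemma integral_sin_inv (δ : ℝ) (hδ : 0 < δ) :
    ∫ x, (Real.sin (2 * Real.pi * x) ^ 2 + δ ^ 2)⁻¹ ∂mu1 ≤ 3 / δ := by
  obtain ⟨i0, b0⟩ := integrable_inv_shift 0 δ hδ
  obtain ⟨i1, b1⟩ := integrable_inv_shift (1/2) δ hδ
  obtain ⟨i2, b2⟩ := integrable_inv_shift (-(1/2)) δ hδ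
  have hsum : Integrable (fun x : ℝ => (16 * (x - 0) ^ 2 + δ ^ 2)⁻¹ +
      (16 * (x - 1/2) ^ 2 + δ ^ 2)⁻¹ + (16 * (x - -(1/2)) ^ 2 + δ ^ 2)⁻¹) := (i0.add i1).add i2
  calc ∫ x, (Real.sin (2 * Real.pi * x) ^ 2 + δ ^ 2)⁻¹ ∂mu1
      ≤ ∫ x, ((16 * (x - 0) ^ 2 + δ ^ 2)⁻¹ + (16 * (x - 1/2) ^ 2 + δ ^ 2)⁻¹
          + (16 * (x - -(1/2)) ^ 2 + δ ^ 2)⁻¹) ∂mu1 := by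
        apply integral_mono_of_nonneg
        · exact ae_of_all _ fun x => by positivity
        · exact hsum.restrict
        · refine (ae_restrict_iff' measurableSet_Icc).2 (ae_of_all _ fun x hx => ?_)
          have aux : ∀ c, 4 * |x - c| ≤ |Real.sin (2 * Real.pi * x)| →
              (Real.sin (2 * Real.pi * x) ^ 2 + δ ^ 2)⁻¹ ≤ (16 * (x - c) ^ 2 + δ ^ 2)⁻¹ := by
            intro c hc
            apply inv_anti₀ (by positivity)
            have := pow_le_pow_left₀ (by positivity) hc 2
            rw [mul_pow, sq_abs, sq_abs] at this
            linarith
          have p0 : 0 < (16 * (x - 0) ^ 2 + δ ^ 2)⁻¹ := by positivity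
          have p1 : 0 < (16 * (x - 1/2) ^ 2 + δ ^ 2)⁻¹ := by positivity
          have p2 : 0 < (16 * (x - -(1/2)) ^ 2 + δ ^ 2)⁻¹ := by positivity
          simp only
          rcases sin_lower x hx.1 hx.2 with h | h | h
          · have := aux 0 (by simpa using h); linarith
          · have := aux (1/2) h; linarith
          · have := aux (-(1/2)) (by simpa [sub_neg_eq_add] using h); linarith
    _ ≤ ∫ x : ℝ, ((16 * (x - 0) ^ 2 + δ ^ 2)⁻¹ + (16 * (x - 1/2) ^ 2 + δ ^ 2)⁻¹
          + (16 * (x - -(1/2)) ^ 2 + δ ^ 2)⁻¹) := by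
        apply setIntegral_le_integral hsum
        exact ae_of_all _ fun x => by
          show (0 : ℝ) ≤ _
          positivity
    _ = (∫ x : ℝ, (16 * (x - 0) ^ 2 + δ ^ 2)⁻¹) + (∫ x : ℝ, (16 * (x - 1/2) ^ 2 + δ ^ 2)⁻¹)
          + ∫ x : ℝ, (16 * (x - -(1/2)) ^ 2 + δ ^ 2)⁻¹ := by
        rw [← integral_add i0 i1]
        exact integral_add (i0.add i1) i2
    _ ≤ 3 / δ := by
        have h3 : 3 / δ = 1/δ + 1/δ + 1/δ := by ring
        rw [h3]
        exact add_le_add (add_le_add b0 b1) b2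

lemma ex_norm (r : ℝ) : ‖Complex.exp ((r : ℂ) * Complex.I)‖ = 1 :=
  Complex.norm_exp_ofReal_mul_I r

lemma mu1_integrable_of_cont {E : Type*} [NormedAddCommGroup E] (g : ℝ → E)
    (hg : Continuous g) : Integrable g mu1 :=
  (hg.integrableOn_Icc : IntegrableOn g (Set.Icc (-(1/2)) (1/2)) volume)

lemma Jb_norm_le_one (t : ℝ) : ‖Jb t‖ ≤ 1 := by
  have := norm_integral_le_of_norm_le_const (μ := mu1) (C := 1)
    (f := fun x => Complex.exp (((t * fc x : ℝ) : ℂ) * Complex.I))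
    (ae_of_all _ fun x => (ex_norm _).le)
  simpa [Jb] using this

lemma Jb_ibp (t δ : ℝ) (ht : t ≠ 0) (hδ : 0 < δ) : ‖Jb t‖ ≤ 3 / (|t| * δ) + 3 * δ := by
  set s : ℝ → ℝ := fun x => Real.sin (2 * Real.pi * x) with hs
  set E : ℝ → ℂ := fun x => Complex.exp (((t * fc x : ℝ) : ℂ) * Complex.I) with hE
  set g : ℝ → ℝ := fun x => s x / (s x ^ 2 + δ ^ 2) with hg
  set g' : ℝ → ℝ := fun x => 2 * Real.pi * Real.cos (2 * Real.pi * x) * (δ ^ 2 - s x ^ 2) /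
    (s x ^ 2 + δ ^ 2) ^ 2 with hg'
  have hden : ∀ x, s x ^ 2 + δ ^ 2 ≠ 0 := fun x => by positivity
  have hsc : Continuous s := by fun_prop
  have hEc : Continuous E := by
    have := fc_cont
    fun_prop
  have hg'c : Continuous g' := by
    apply Continuous.div (by fun_prop) (by fun_prop)
    intro x; exact pow_ne_zero _ (hden x)
  have hsd : ∀ x, HasDerivAt s (2 * Real.pi * Real.cos (2 * Real.pi * x)) x := by
    intro x
    have := ((hasDerivAt_id x).const_mul (2 * Real.pi)).sin
    simp only [id, mul_one] at this
    rw [mul_comm]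
    exact this
  have hfd : ∀ x, HasDerivAt fc (-(2 * Real.pi * s x)) x := by
    intro x
    have := ((hasDerivAt_id x).const_mul (2 * Real.pi)).cos
    simp only [id, mul_one] at this
    convert! this using 1
    simp only [hs]; ring
  have hgd : ∀ x, HasDerivAt g (g' x) x := by
    intro x
    have := (hsd x).div (((hsd x).pow 2).add_const (δ ^ 2)) (hden x)
    convert! this using 1
    simp only [hg', Pi.pow_apply]
    congr 1
    push_cast; ring
  have hEd : ∀ x, HasDerivAt E (E x * ((t * -(2 * Real.pi * s x) : ℝ) * Complex.I)) x := by
    intro x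
    have := ((((hfd x).const_mul t).ofReal_comp).mul_const Complex.I).cexp
    exact this
  have ibp := intervalIntegral.integral_mul_deriv_eq_deriv_mul (a := -(1/2)) (b := 1/2)
    (u := fun x => (g x : ℂ)) (v := E) (u' := fun x => (g' x : ℂ))
    (v' := fun x => E x * ((t * -(2 * Real.pi * s x) : ℝ) * Complex.I))
    (fun x _ => (hgd x).ofReal_comp) (fun x _ => hEd x)
    (Continuous.intervalIntegrable (by fun_prop) _ _)
    (Continuous.intervalIntegrable (by fun_prop) _ _)
  have s1 : g (1/2) = 0 := by
    simp only [hg, hs]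
    rw [show 2 * Real.pi * (1/2) = Real.pi by ring]; simp
  have s2 : g (-(1/2)) = 0 := by
    simp only [hg, hs]
    rw [show 2 * Real.pi * (-(1/2)) = -Real.pi by ring]; simp
  rw [s1, s2, ← integral_mu1, ← integral_mu1] at ibp
  simp only [Complex.ofReal_zero, zero_mul, sub_zero, zero_sub] at ibp
  set h1 : ℝ → ℝ := fun x => (s x ^ 2 + δ ^ 2)⁻¹ with hh1
  have hh1c : Continuous h1 := Continuous.inv₀ (by fun_prop) hden
  have i3 := integral_sin_inv δ hδ
  have e1 : (∫ x, (g x : ℂ) * (E x * ((t * -(2 * Real.pi * s x) : ℝ) * Complex.I)) ∂mu1) =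
      (-(2 * Real.pi * t) : ℝ) * Complex.I * (Jb t - (δ^2 : ℝ) * ∫ x, (h1 x : ℂ) * E x ∂mu1) := by
    have : Jb t = ∫ x, E x ∂mu1 := rfl
    rw [this, ← integral_const_mul, ← integral_sub, ← integral_const_mul]
    · congr 1; funext x
      simp only [hg, hh1]
      have hc : ((s x : ℂ) ^ 2 + (δ : ℂ) ^ 2) ≠ 0 := by exact_mod_cast hden x
      push_cast
      field_simp
      ring
    · exact mu1_integrable_of_cont _ hEc
    · exact mu1_integrable_of_cont _ (by fun_prop)
  have b1 : ‖∫ x, (h1 x : ℂ) * E x ∂mu1‖ ≤ 3 / δ := by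
    refine le_trans (norm_integral_le_of_norm_le (g := h1) ?_ ?_) i3
    · exact mu1_integrable_of_cont _ hh1c
    · refine ae_of_all _ fun x => ?_
      rw [norm_mul, ex_norm, mul_one, Complex.norm_real, Real.norm_eq_abs, abs_of_pos]
      simp only [hh1]; positivity
  have b2 : ‖∫ x, (g' x : ℂ) * E x ∂mu1‖ ≤ 2 * Real.pi * (3 / δ) := by
    refine le_trans (norm_integral_le_of_norm_le (g := fun x => 2 * Real.pi * h1 x) ?_ ?_) ?_
    · exact mu1_integrable_of_cont _ (by fun_prop)
    · refine ae_of_all _ fun x => ?_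
      rw [norm_mul, ex_norm, mul_one, Complex.norm_real, Real.norm_eq_abs]
      simp only [hg', hh1]
      rw [abs_div, abs_mul, abs_mul, abs_of_pos (show (0:ℝ) < (s x ^ 2 + δ ^ 2)^2 by positivity),
        abs_of_pos (show 0 < 2 * Real.pi by positivity), div_le_iff₀ (by positivity)]
      have c1 : |Real.cos (2 * Real.pi * x)| ≤ 1 := Real.abs_cos_le_one _
      have c2 : |δ ^ 2 - s x ^ 2| ≤ s x ^ 2 + δ ^ 2 := by
        rw [abs_le]; constructor <;> nlinarith [sq_nonneg δ, sq_nonneg (s x)]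
      have : 2 * Real.pi * (s x ^ 2 + δ ^ 2)⁻¹ * (s x ^ 2 + δ ^ 2) ^ 2
        = 2 * Real.pi * 1 * (s x ^ 2 + δ ^ 2) := by
          have := hden x
          field_simp
      rw [this]
      gcongr
    · rw [integral_const_mul]
      gcongr
  rw [e1] at ibp
  have n1 : 2 * Real.pi * |t| * ‖Jb t - (δ^2 : ℝ) * ∫ x, (h1 x : ℂ) * E x ∂mu1‖ ≤
      2 * Real.pi * (3 / δ) := by
    have := congrArg norm ibp
    rw [norm_neg, norm_mul, norm_mul, Complex.norm_I, mul_one, Complex.norm_real, norm_neg,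
      Real.norm_eq_abs, abs_mul, abs_of_pos (show 0 < 2 * Real.pi by positivity)] at this
    rw [this]; exact b2
  have n2 : ‖Jb t - (δ^2 : ℝ) * ∫ x, (h1 x : ℂ) * E x ∂mu1‖ ≤ 3 / (|t| * δ) := by
    have ht' : 0 < |t| := abs_pos.2 ht
    rw [show 2 * Real.pi * (3 / δ) = 2 * Real.pi * |t| * (3 / (|t| * δ)) by field_simp] at n1
    exact le_of_mul_le_mul_left n1 (by positivity)
  have n3 : ‖((δ^2 : ℝ) : ℂ) * ∫ x, (h1 x : ℂ) * E x ∂mu1‖ ≤ 3 * δ := by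
    rw [norm_mul, Complex.norm_real, Real.norm_eq_abs, abs_of_pos (by positivity)]
    calc δ ^ 2 * _ ≤ δ ^ 2 * (3 / δ) := by gcongr
      _ = 3 * δ := by field_simp
  calc ‖Jb t‖ = ‖(Jb t - (δ^2 : ℝ) * ∫ x, (h1 x : ℂ) * E x ∂mu1) +
        (δ^2 : ℝ) * ∫ x, (h1 x : ℂ) * E x ∂mu1‖ := by rw [sub_add_cancel]
    _ ≤ _ := norm_add_le _ _
    _ ≤ _ := add_le_add n2 n3

lemma Jb_sq (t : ℝ) (ht : t ≠ 0) : ‖Jb t‖ ^ 2 ≤ 36 / |t| := by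
  have ht' : 0 < |t| := abs_pos.2 ht
  have := Jb_ibp t (1 / Real.sqrt |t|) ht (by positivity)
  have e : 3 / (|t| * (1 / Real.sqrt |t|)) + 3 * (1 / Real.sqrt |t|) = 6 / Real.sqrt |t| := by
    have h2 := Real.mul_self_sqrt ht'.le
    have h3 : 0 < Real.sqrt |t| := Real.sqrt_pos.2 ht'
    generalize Real.sqrt |t| = r at *
    rw [← h2]; field_simp; norm_num
  rw [e] at this
  calc ‖Jb t‖ ^ 2 ≤ (6 / Real.sqrt |t|) ^ 2 := by gcongr
    _ = 36 / |t| := by rw [div_pow, Real.sq_sqrt ht'.le]; norm_num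

lemma Jb_pow (t : ℝ) (ht : t ≠ 0) : ‖Jb t‖ ^ 2 ≤ 36 * |t| ^ (-(15/16) : ℝ) := by
  have ht' : 0 < |t| := abs_pos.2 ht
  by_cases h : |t| ≤ 1
  · have h1 : (1 : ℝ) ≤ |t| ^ (-(15/16) : ℝ) := by
      apply Real.one_le_rpow_of_pos_of_le_one_of_nonpos ht' h (by norm_num)
    have := pow_le_one₀ (n := 2) (norm_nonneg _) (Jb_norm_le_one t)
    linarith
  · push Not at h
    refine (Jb_sq t ht).trans ?_
    rw [div_eq_mul_inv, ← Real.rpow_neg_one]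
    gcongr
    · exact h.le
    · norm_num

lemma locint_abs : LocallyIntegrable (fun x : ℝ => |x| ^ (-(15/16) : ℝ)) volume := by
  refine locallyIntegrable_of_norm_le_rpow (C := 1) (α := 15/16) (by simp) (by norm_num)
    (ae_of_all _ fun x => ?_) ?_
  · rw [one_mul, Real.norm_eq_abs, Real.norm_eq_abs, abs_of_nonneg (by positivity)]
  · apply Measurable.aestronglyMeasurable
    fun_prop

lemma sinpow_integrable :
    Integrable (fun a : ℝ => |Real.sin (2 * Real.pi * a)| ^ (-(15/16) : ℝ)) mu1 := by
  have hI : ∀ c : ℝ, Integrable (fun x : ℝ => |x - c| ^ (-(15/16) : ℝ)) mu1 := by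
    intro c
    have h1 : IntervalIntegrable (fun x : ℝ => |x| ^ (-(15/16) : ℝ)) volume
        (-(1/2) - c) (1/2 - c) := by
      rw [intervalIntegrable_iff_integrableOn_Icc_of_le (by linarith)]
      exact locint_abs.integrableOn_isCompact isCompact_Icc
    have h2 := h1.comp_sub_right c
    simp only [sub_add_cancel] at h2
    rw [intervalIntegrable_iff_integrableOn_Icc_of_le (by norm_num)] at h2
    exact h2
  have hsum := ((hI 0).add (hI (1/2))).add (hI (-(1/2)))
  refine Integrable.mono' hsum ?_ ?_
  · apply Measurable.aestronglyMeasurable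
    fun_prop
  · have hne : ∀ c : ℝ, ∀ᵐ x ∂mu1, x ≠ c := fun c => by
      rw [mu1]
      exact ae_restrict_of_ae (by simp [ae_iff])
    have hm : ∀ᵐ x ∂mu1, x ∈ Set.Icc (-(1/2) : ℝ) (1/2) := ae_restrict_mem measurableSet_Icc
    filter_upwards [hne 0, hne (1/2), hne (-(1/2)), hm] with x n0 n1 n2 hx
    simp only [Pi.add_apply]
    rw [Real.norm_eq_abs, abs_of_nonneg (by positivity)]
    have aux : ∀ c, x ≠ c → 4 * |x - c| ≤ |Real.sin (2 * Real.pi * x)| →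
        |Real.sin (2 * Real.pi * x)| ^ (-(15/16) : ℝ) ≤ |x - c| ^ (-(15/16) : ℝ) := by
      intro c hc hs
      have : 0 < |x - c| := abs_pos.2 (sub_ne_zero.2 hc)
      apply Real.rpow_le_rpow_of_nonpos this (by linarith) (by norm_num)
    have p : ∀ c, 0 ≤ |x - c| ^ (-(15/16) : ℝ) := fun c => by positivity
    rcases sin_lower x hx.1 hx.2 with h | h | h
    · have := aux 0 n0 (by simpa using h); linarith [p (1/2), p (-(1/2))]
    · have := aux (1/2) n1 h; linarith [p 0, p (-(1/2))]
    · have := aux (-(1/2)) n2 (by simpa [sub_neg_eq_add] using h); linarith [p 0, p (1/2)]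

lemma sin_ne_ae (u : ℝ) : ∀ᵐ a ∂mu1, Real.sin (2 * Real.pi * (a + u)) ≠ 0 := by
  have : {a : ℝ | Real.sin (2 * Real.pi * (a + u)) = 0} ⊆
      Set.range (fun n : ℤ => (n : ℝ) / 2 - u) := by
    intro a ha
    obtain ⟨n, hn⟩ := Real.sin_eq_zero_iff.1 ha
    refine ⟨n, ?_⟩
    have := Real.pi_pos
    have h2 : (n : ℝ) = 2 * (a + u) := by
      apply mul_right_cancel₀ this.ne'
      rw [hn]; ring
    simp only
    rw [h2]; ring
  rw [mu1]
  apply ae_restrict_of_ae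
  rw [ae_iff]
  simp only [ne_eq, not_not]
  exact ((Set.countable_range _).mono this).measure_zero _

/-- The two-phase one-dimensional integral. -/
lemma two_phase (t s a : ℝ) :
    ∫ b, Complex.exp (((t * fc (a + b) + s * fc b : ℝ) : ℂ) * Complex.I) ∂mu1 =
      Jb ‖(t : ℂ) * Complex.exp ((2 * Real.pi * a : ℝ) * Complex.I) + s‖ := by
  set z := (t : ℂ) * Complex.exp ((2 * Real.pi * a : ℝ) * Complex.I) + s with hz
  set φ := Complex.arg z / (2 * Real.pi)
  have hpi := Real.pi_pos
  have key : ∀ b, t * fc (a + b) + s * fc b = ‖z‖ * fc (b + φ) := by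
    intro b
    have h1 : (z * Complex.exp ((2 * Real.pi * b : ℝ) * Complex.I)).re =
        t * fc (a + b) + s * fc b := by
      rw [hz, add_mul, mul_assoc, ← Complex.exp_add, ← add_mul, ← Complex.ofReal_add, Complex.add_re,
        Complex.re_ofReal_mul, Complex.re_ofReal_mul, Complex.exp_ofReal_mul_I_re,
        Complex.exp_ofReal_mul_I_re, ← mul_add]
      rfl
    have h2 : (z * Complex.exp ((2 * Real.pi * b : ℝ) * Complex.I)).re =
        ‖z‖ * fc (b + φ) := by
      conv_lhs => rw [← Complex.norm_mul_exp_arg_mul_I z]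
      rw [mul_assoc, ← Complex.exp_add, ← add_mul, ← Complex.ofReal_add,
        Complex.re_ofReal_mul, Complex.exp_ofReal_mul_I_re]
      congr 1
      unfold fc
      congr 1
      simp only [φ]
      field_simp
      ring
    rw [← h1, h2]
  simp_rw [key]
  rw [integral_mu1_shift (fun b => Complex.exp (((‖z‖ * fc b : ℝ) : ℂ) * Complex.I))]
  · rfl
  · intro x
    simp only [fc_periodic x]

lemma two_phase_bound (t s a : ℝ) (ht : t ≠ 0) (ha : Real.sin (2 * Real.pi * a) ≠ 0) :
    ‖∫ b, Complex.exp (((t * fc (a + b) + s * fc b : ℝ) : ℂ) * Complex.I) ∂mu1‖ ^ 2 ≤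
      36 * |t| ^ (-(15/16) : ℝ) * |Real.sin (2 * Real.pi * a)| ^ (-(15/16) : ℝ) := by
  rw [two_phase]
  set z := (t : ℂ) * Complex.exp ((2 * Real.pi * a : ℝ) * Complex.I) + s with hz
  have him : z.im = t * Real.sin (2 * Real.pi * a) := by
    rw [hz, Complex.add_im, Complex.im_ofReal_mul, Complex.exp_ofReal_mul_I_im, Complex.ofReal_im,
      add_zero]
  have h1 : |t| * |Real.sin (2 * Real.pi * a)| ≤ ‖z‖ := by
    rw [← abs_mul, ← him]; exact Complex.abs_im_le_norm z
  have hp : 0 < |t| * |Real.sin (2 * Real.pi * a)| := mul_pos (abs_pos.2 ht) (abs_pos.2 ha)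
  have := Jb_pow ‖z‖ (by linarith)
  rw [abs_of_nonneg (norm_nonneg z)] at this
  refine this.trans ?_
  rw [mul_assoc, ← Real.mul_rpow (abs_nonneg _) (abs_nonneg _)]
  have := Real.rpow_le_rpow_of_nonpos hp h1 (show (-(15/16) : ℝ) ≤ 0 by norm_num)
  linarith

/-- product measure on the cube, with variables `x = (b, c, a)` -/
def muX : Measure (ℝ × ℝ × ℝ) := mu1.prod (mu1.prod mu1)

instance muX_prob : IsProbabilityMeasure muX := by unfold muX; infer_instance

/-- the four phases -/
def phi (u : ℝ) (x : ℝ × ℝ × ℝ) : Fin 4 → ℝ :=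
  ![fc x.2.2, fc x.1, fc x.2.1, fc (x.2.2 - x.1 + x.2.1 - u)]

lemma phi_cont (u : ℝ) (i : Fin 4) : Continuous fun x => phi u x i := by
  have := fc_cont
  fin_cases i <;> simp [phi] <;> fun_prop

/-- the one-dimensional four-phase oscillatory integral -/
def Kb (u : ℝ) (t : Fin 4 → ℝ) : ℂ :=
  ∫ x, Complex.exp (((∑ i, t i * phi u x i : ℝ) : ℂ) * Complex.I) ∂muX

lemma exp_integrable {Y : Type*} [MeasurableSpace Y] [TopologicalSpace Y] [OpensMeasurableSpace Y]
    [SecondCountableTopologyEither Y ℂ]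
    (m : Measure Y) [IsFiniteMeasure m] (ψ : Y → ℝ) (hψ : Continuous ψ) :
    Integrable (fun y => Complex.exp ((ψ y : ℂ) * Complex.I)) m := by
  refine Integrable.of_bound (C := 1) (Continuous.aestronglyMeasurable (by fun_prop)) ?_
  exact ae_of_all _ fun y => (ex_norm _).le

lemma Kb_iter (u : ℝ) (t : Fin 4 → ℝ) :
    Kb u t = ∫ b, ∫ c, ∫ a, Complex.exp (((t 0 * fc a + t 1 * fc b + t 2 * fc c +
      t 3 * fc (a - b + c - u) : ℝ) : ℂ) * Complex.I) ∂mu1 ∂mu1 ∂mu1 := by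
  have hf := fc_cont
  unfold Kb muX
  have e : ∀ x : ℝ × ℝ × ℝ, (∑ i, t i * phi u x i) = t 0 * fc x.2.2 + t 1 * fc x.1 + t 2 * fc x.2.1 +
      t 3 * fc (x.2.2 - x.1 + x.2.1 - u) := by
    intro x
    simp [Fin.sum_univ_four, phi]
  simp_rw [e]
  rw [integral_prod _ (exp_integrable _ _ (by fun_prop))]
  congr 1; funext b
  rw [integral_prod _ (exp_integrable _ _ (by fun_prop))]

lemma Kb_fact (u : ℝ) (t : Fin 4 → ℝ) :
    Kb u t = ∫ a, (∫ b, Complex.exp (((t 0 * fc (a + b) + t 1 * fc b : ℝ) : ℂ) * Complex.I) ∂mu1) *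
      (∫ c, Complex.exp (((t 3 * fc ((a - u) + c) + t 2 * fc c : ℝ) : ℂ) * Complex.I) ∂mu1)
        ∂mu1 := by
  have hf := fc_cont
  rw [Kb_iter]
  have h1 : ∀ b c, (∫ a, Complex.exp (((t 0 * fc a + t 1 * fc b + t 2 * fc c +
      t 3 * fc (a - b + c - u) : ℝ) : ℂ) * Complex.I) ∂mu1) =
      ∫ a, Complex.exp (((t 0 * fc (a + b) + t 1 * fc b : ℝ) : ℂ) * Complex.I) *
        Complex.exp (((t 3 * fc ((a - u) + c) + t 2 * fc c : ℝ) : ℂ) * Complex.I) ∂mu1 := by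
    intro b c
    rw [← integral_mu1_shift (fun a => Complex.exp (((t 0 * fc a + t 1 * fc b + t 2 * fc c +
      t 3 * fc (a - b + c - u) : ℝ) : ℂ) * Complex.I)) _ b]
    · congr 1; funext a
      rw [← Complex.exp_add, ← add_mul, ← Complex.ofReal_add,
        show a + b - b + c - u = a - u + c by ring]
      congr 3
      ring
    · intro a
      simp only
      rw [fc_periodic a, show a + 1 - b + c - u = a - b + c - u + 1 by ring, fc_periodic]
  simp_rw [h1]
  have h2 : ∀ b, (∫ c, ∫ a, Complex.exp (((t 0 * fc (a + b) + t 1 * fc b : ℝ) : ℂ) * Complex.I) *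
        Complex.exp (((t 3 * fc ((a - u) + c) + t 2 * fc c : ℝ) : ℂ) * Complex.I) ∂mu1 ∂mu1) =
      ∫ a, Complex.exp (((t 0 * fc (a + b) + t 1 * fc b : ℝ) : ℂ) * Complex.I) *
        (∫ c, Complex.exp (((t 3 * fc ((a - u) + c) + t 2 * fc c : ℝ) : ℂ) * Complex.I) ∂mu1)
          ∂mu1 := by
    intro b
    rw [integral_integral_swap]
    · simp_rw [integral_const_mul]
    · refine Integrable.of_bound (C := 1) (Continuous.aestronglyMeasurable ?_) ?_
      · simp only [Function.uncurry_def]; fun_prop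
      · refine ae_of_all _ fun y => ?_
        simp only [Function.uncurry_def]
        rw [norm_mul, ex_norm, ex_norm, mul_one]
  simp_rw [h2]
  rw [integral_integral_swap]
  · simp_rw [integral_mul_const]
  · refine Integrable.of_bound (C := 1) ?_ ?_
    · apply StronglyMeasurable.aestronglyMeasurable
      simp only [Function.uncurry_def]
      apply StronglyMeasurable.mul
      · exact Continuous.stronglyMeasurable (by fun_prop)
      · apply StronglyMeasurable.integral_prod_right (f := fun (y : ℝ × ℝ) (c : ℝ) =>
          Complex.exp (((t 3 * fc ((y.2 - u) + c) + t 2 * fc c : ℝ) : ℂ) * Complex.I))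
        exact Continuous.stronglyMeasurable (by fun_prop)
    · refine ae_of_all _ fun y => ?_
      simp only [Function.uncurry_def]
      rw [norm_mul, ex_norm, one_mul]
      have := norm_integral_le_of_norm_le_const (μ := mu1) (C := 1)
        (f := fun c => Complex.exp (((t 3 * fc ((y.2 - u) + c) + t 2 * fc c : ℝ) : ℂ) * Complex.I))
        (ae_of_all _ fun x => (ex_norm _).le)
      simpa using this

lemma Kb_norm_le_one (u : ℝ) (t : Fin 4 → ℝ) : ‖Kb u t‖ ≤ 1 := by
  have := norm_integral_le_of_norm_le_const (μ := muX) (C := 1)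
    (f := fun x => Complex.exp (((∑ i, t i * phi u x i : ℝ) : ℂ) * Complex.I))
    (ae_of_all _ fun x => (ex_norm _).le)
  simpa [Kb] using this

/-- the constant in the sup bound -/
def SC : ℝ := ∫ a, |Real.sin (2 * Real.pi * a)| ^ (-(15/16) : ℝ) ∂mu1

lemma SC_nonneg : 0 ≤ SC := integral_nonneg fun a => by positivity

lemma Kb_bound (u : ℝ) (t : Fin 4 → ℝ) (h0 : t 0 ≠ 0) (h3 : t 3 ≠ 0) :
    ‖Kb u t‖ ≤ 18 * SC * (|t 0| ^ (-(15/16) : ℝ) + |t 3| ^ (-(15/16) : ℝ)) := by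
  rw [Kb_fact]
  set S : ℝ → ℝ := fun a => |Real.sin (2 * Real.pi * a)| ^ (-(15/16) : ℝ) with hS
  have hper : Function.Periodic S 1 := by
    intro x
    simp only [hS]
    rw [show 2 * Real.pi * (x + 1) = 2 * Real.pi * x + 2 * Real.pi by ring, Real.sin_add_two_pi]
  have hSi : Integrable S mu1 := sinpow_integrable
  have hshift : ∫ a, S (a - u) ∂mu1 = SC := by
    simp_rw [sub_eq_add_neg]
    rw [integral_mu1_shift S hper]; rfl
  have hSi' : Integrable (fun a => S (a - u)) mu1 := by
    have hl : IntervalIntegrable S volume (-(1/2)) (-(1/2) + 1) := by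
      rw [intervalIntegrable_iff_integrableOn_Icc_of_le (by norm_num)]
      norm_num
      have h := hSi
      unfold mu1 at h
      norm_num at h
      exact h
    have := hper.intervalIntegrable one_ne_zero hl (-(1/2) - u) (1/2 - u)
    have h2 := this.comp_sub_right u
    simp only [sub_add_cancel] at h2
    rw [intervalIntegrable_iff_integrableOn_Icc_of_le (by norm_num)] at h2
    exact h2
  have hle := norm_integral_le_of_norm_le (μ := mu1)
    (f := fun a => (∫ b, Complex.exp (((t 0 * fc (a + b) + t 1 * fc b : ℝ) : ℂ) * Complex.I) ∂mu1) *
      (∫ c, Complex.exp (((t 3 * fc ((a - u) + c) + t 2 * fc c : ℝ) : ℂ) * Complex.I) ∂mu1))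
    (g := fun a => 18 * |t 0| ^ (-(15/16) : ℝ) * S a + 18 * |t 3| ^ (-(15/16) : ℝ) * S (a - u))
    ((hSi.const_mul _).add (hSi'.const_mul _)) (by
      filter_upwards [sin_ne_ae 0, sin_ne_ae (-u)] with a ha hu
      rw [add_zero] at ha
      have b1 := two_phase_bound (t 0) (t 1) a h0 ha
      have b2 := two_phase_bound (t 3) (t 2) (a - u) h3 hu
      rw [norm_mul]
      simp only [hS]
      nlinarith [sq_nonneg (‖∫ b, Complex.exp (((t 0 * fc (a + b) + t 1 * fc b : ℝ) : ℂ) * Complex.I) ∂mu1‖ -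
        ‖∫ c, Complex.exp (((t 3 * fc ((a - u) + c) + t 2 * fc c : ℝ) : ℂ) * Complex.I) ∂mu1‖)])
  refine hle.trans ?_
  rw [integral_add (hSi.const_mul _) (hSi'.const_mul _), integral_const_mul, integral_const_mul,
    hshift]
  have : ∫ a, S a ∂mu1 = SC := rfl
  rw [this]
  apply le_of_eq; ring

/-- the weight `|t|^{-d} e^{-h|t|}` -/
def wt (h d t : ℝ) : ℝ := |t| ^ (-d) * Real.exp (-(h * |t|))

lemma wt_nonneg (h d t : ℝ) : 0 ≤ wt h d t := by unfold wt; positivity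

lemma wt_meas (h d : ℝ) : Measurable (wt h d) := by unfold wt; fun_prop

lemma wt_integrable (h d : ℝ) (hh : 0 < h) (hd : d < 1) : Integrable (wt h d) := by
  have h1 : IntegrableOn (fun t : ℝ => t ^ (-d) * Real.exp (-(h * t))) (Set.Ioi 0) := by
    have := integrableOn_rpow_mul_exp_neg_mul_rpow (s := -d) (p := 1) (b := h) (by linarith)
      one_pos hh
    simpa using this
  have hF := (integrable_indicator_iff (measurableSet_Ioi)).2 h1
  have hG := hF.comp_neg
  refine (hF.add hG).congr ?_
  have hne : ∀ᵐ t : ℝ, t ≠ 0 := by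
    rw [ae_iff]; simp
  filter_upwards [hne] with t ht
  rcases lt_or_gt_of_ne ht with h | h
  · simp [wt, Set.indicator, h, not_lt.2 h.le, abs_of_neg h]
  · simp [wt, Set.indicator, h, not_lt.2 h.le, abs_of_pos h]

lemma wt_integral (h d : ℝ) (hh : 0 < h) (hd : d < 1) :
    ∫ t, wt h d t = 2 * Real.Gamma (1 - d) * h ^ (d - 1) := by
  have := integral_comp_abs (f := fun t : ℝ => t ^ (-d) * Real.exp (-(h * t)))
  unfold wt
  rw [this]
  have h2 := Real.integral_rpow_mul_exp_neg_mul_Ioi (a := 1 - d) (r := h) (by linarith) hh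
  rw [show 1 - d - 1 = -d by ring] at h2
  rw [h2, one_div, Real.inv_rpow hh.le, ← Real.rpow_neg hh.le, neg_sub]
  ring

/-- Fourier transform -/
def ft (w : ℝ → ℝ) (x : ℝ) : ℂ := ∫ t, (w t : ℂ) * Complex.exp (((t * x : ℝ) : ℂ) * Complex.I)

lemma ft_norm_le (w : ℝ → ℝ) (hw : ∀ t, 0 ≤ w t) (x : ℝ) : ‖ft w x‖ ≤ ∫ t, w t := by
  unfold ft
  refine (norm_integral_le_integral_norm _).trans (le_of_eq ?_)
  congr 1; funext t
  rw [norm_mul, ex_norm, mul_one, Complex.norm_real, Real.norm_eq_abs, abs_of_nonneg (hw t)]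

lemma ft_meas (w : ℝ → ℝ) (hw : Measurable w) : StronglyMeasurable (ft w) := by
  unfold ft
  apply StronglyMeasurable.integral_prod_right (f := fun (x t : ℝ) =>
    (w t : ℂ) * Complex.exp (((t * x : ℝ) : ℂ) * Complex.I))
  apply Measurable.stronglyMeasurable
  fun_prop

lemma fub {ι : Type*} [Fintype ι] (w : ι → ℝ → ℝ) (hw : ∀ i, Integrable (w i))
    (hwm : ∀ i, Measurable (w i))
    {Y : Type*} [MeasurableSpace Y] (m : Measure Y) [IsFiniteMeasure m] (ψ : Y → ι → ℝ)
    (hψ : ∀ i, Measurable fun y => ψ y i) :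
    ∫ y, ∏ i, ft (w i) (ψ y i) ∂m = ∫ t : ι → ℝ, (∏ i, (w i (t i) : ℂ)) *
      ∫ y, Complex.exp (((∑ i, t i * ψ y i : ℝ) : ℂ) * Complex.I) ∂m := by
  have h1 : ∀ y, ∏ i, ft (w i) (ψ y i) = ∫ t : ι → ℝ, (∏ i, (w i (t i) : ℂ)) *
      Complex.exp (((∑ i, t i * ψ y i : ℝ) : ℂ) * Complex.I) := by
    intro y
    unfold ft
    rw [← integral_fintype_prod_volume_eq_prod
      (fun i t => (w i t : ℂ) * Complex.exp (((t * ψ y i : ℝ) : ℂ) * Complex.I))]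
    congr 1; funext t
    rw [Finset.prod_mul_distrib, ← Complex.exp_sum, Complex.ofReal_sum, Finset.sum_mul]
  simp_rw [h1]
  rw [integral_integral_swap]
  · simp_rw [integral_const_mul]
  · have hIntg : Integrable (fun t : ι → ℝ => ∏ i, w i (t i)) := Integrable.fintype_prod hw
    refine Integrable.mono' (hIntg.comp_snd m).norm ?_ ?_
    · apply Measurable.aestronglyMeasurable
      simp only [Function.uncurry_def]
      apply Measurable.mul
      · apply Finset.measurable_fun_prod
        intro i _
        have := hwm i
        fun_prop
      · have : ∀ i, Measurable fun p : Y × (ι → ℝ) => ψ p.1 i := fun i =>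
          (hψ i).comp measurable_fst
        apply Complex.measurable_exp.comp
        apply Measurable.mul_const
        apply Complex.measurable_ofReal.comp
        apply Finset.measurable_fun_sum
        intro i _
        have := this i
        fun_prop
    · refine ae_of_all _ fun p => ?_
      simp only [Function.uncurry_def]
      rw [norm_mul, ex_norm, mul_one, ← Complex.ofReal_prod, Complex.norm_real]

lemma poisson (σ x : ℝ) (hσ : 0 < σ) :
    ∫ t : ℝ, (Real.exp (-(σ * |t|)) : ℂ) * Complex.exp (((t * x : ℝ) : ℂ) * Complex.I) =
      ((2 * σ / (σ ^ 2 + x ^ 2) : ℝ) : ℂ) := by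
  have hI : Integrable (fun t : ℝ => (Real.exp (-(σ * |t|)) : ℂ) *
      Complex.exp (((t * x : ℝ) : ℂ) * Complex.I)) := by
    have := wt_integrable σ 0 hσ (by norm_num)
    refine Integrable.mono' this ?_ ?_
    · exact Continuous.aestronglyMeasurable (by fun_prop)
    · refine ae_of_all _ fun t => ?_
      rw [norm_mul, ex_norm, mul_one, Complex.norm_real, Real.norm_eq_abs, abs_of_pos (by positivity)]
      simp [wt]
  rw [← intervalIntegral.integral_Iic_add_Ioi (b := 0) hI.integrableOn hI.integrableOn]
  have e1 : ∫ t in Set.Iic (0:ℝ), (Real.exp (-(σ * |t|)) : ℂ) *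
      Complex.exp (((t * x : ℝ) : ℂ) * Complex.I) = ∫ t in Set.Iic (0:ℝ),
        Complex.exp (((σ : ℂ) + x * Complex.I) * t) := by
    apply setIntegral_congr_fun measurableSet_Iic
    intro t ht
    simp only
    rw [abs_of_nonpos ht, Complex.ofReal_exp, ← Complex.exp_add]
    congr 1; push_cast; ring
  have e2 : ∫ t in Set.Ioi (0:ℝ), (Real.exp (-(σ * |t|)) : ℂ) *
      Complex.exp (((t * x : ℝ) : ℂ) * Complex.I) = ∫ t in Set.Ioi (0:ℝ),
        Complex.exp ((-(σ : ℂ) + x * Complex.I) * t) := by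
    apply setIntegral_congr_fun measurableSet_Ioi
    intro t ht
    simp only
    rw [abs_of_pos ht, Complex.ofReal_exp, ← Complex.exp_add]
    congr 1; push_cast; ring
  rw [e1, e2, integral_exp_mul_complex_Ioi (by simpa using hσ),
    integral_exp_mul_complex_Iic (by simpa using hσ)]
  simp only [Complex.ofReal_zero, mul_zero, Complex.exp_zero]
  have n1 : (σ : ℂ) + x * Complex.I ≠ 0 := by
    intro h; have := congrArg Complex.re h; simp at this; linarith
  have n2 : -(σ : ℂ) + x * Complex.I ≠ 0 := by
    intro h; have := congrArg Complex.re h; simp at this; linarith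
  have n3 : (σ : ℂ) ^ 2 + (x : ℂ) ^ 2 ≠ 0 := by
    have : σ ^ 2 + x ^ 2 ≠ 0 := by positivity
    exact_mod_cast this
  push_cast
  rw [div_add_div _ _ n1 n2, div_eq_div_iff (mul_ne_zero n1 n2) n3]
  ring_nf
  simp only [Complex.I_sq]
  ring

/-- integrand of the subordination formula -/
def subo (h d x s : ℝ) : ℝ := s ^ (d - 1) * (2 * (s + h) / ((s + h) ^ 2 + x ^ 2))

/-- the real kernel -/
def kf (h d x : ℝ) : ℝ := (Real.Gamma d)⁻¹ * ∫ s in Set.Ioi (0:ℝ), subo h d x s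

lemma subo_nonneg (h d x s : ℝ) (hh : 0 < h) (hs : 0 < s) : 0 ≤ subo h d x s := by
  unfold subo
  have : 0 < s + h := by linarith
  positivity

lemma kf_nonneg (h d x : ℝ) (hh : 0 < h) (hd : 0 < d) : 0 ≤ kf h d x := by
  unfold kf
  have := Real.Gamma_pos_of_pos hd
  refine mul_nonneg (by positivity) (setIntegral_nonneg measurableSet_Ioi fun s hs => ?_)
  exact subo_nonneg h d x s hh hs

lemma ft_wt (h d x : ℝ) (hh : 0 < h) (hd : 0 < d) (hd1 : d < 1) :
    IntegrableOn (subo h d x) (Set.Ioi 0) ∧ ft (wt h d) x = (kf h d x : ℂ) := by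
  have hΓ := Real.Gamma_pos_of_pos hd
  set F : ℝ → ℝ → ℂ := fun t s => ((s ^ (d - 1) * Real.exp (-(s * |t|)) : ℝ) : ℂ) *
    (((Real.exp (-(h * |t|)) : ℝ) : ℂ) * Complex.exp (((t * x : ℝ) : ℂ) * Complex.I)) with hF
  have hne : ∀ᵐ t : ℝ, t ≠ 0 := by
    rw [ae_iff]; simp
  have hg : ∀ t : ℝ, t ≠ 0 → ∫ s in Set.Ioi (0:ℝ), s ^ (d - 1) * Real.exp (-(s * |t|)) =
      Real.Gamma d * |t| ^ (-d) := by
    intro t ht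
    have ht' := abs_pos.2 ht
    have := Real.integral_rpow_mul_exp_neg_mul_Ioi (a := d) (r := |t|) hd ht'
    rw [one_div, Real.inv_rpow ht'.le, ← Real.rpow_neg ht'.le] at this
    rw [mul_comm, ← this]
    congr 1; funext s; rw [mul_comm s]
  have hgi : ∀ t : ℝ, t ≠ 0 → IntegrableOn (fun s : ℝ => s ^ (d - 1) * Real.exp (-(s * |t|)))
      (Set.Ioi 0) := by
    intro t ht
    have := integrableOn_rpow_mul_exp_neg_mul_rpow (s := d - 1) (p := 1) (b := |t|) (by linarith)
      one_pos (abs_pos.2 ht)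
    simp only [Real.rpow_one, neg_mul] at this
    simpa only [mul_comm |t|] using this
  have hIntg : Integrable (Function.uncurry F) (volume.prod (volume.restrict (Set.Ioi (0:ℝ)))) := by
    have hm : Measurable (Function.uncurry F) := by
      simp only [hF, Function.uncurry_def]
      fun_prop
    rw [integrable_prod_iff hm.aestronglyMeasurable]
    constructor
    · filter_upwards [hne] with t ht
      simp only [hF, Function.uncurry_apply_pair]
      exact (hgi t ht).ofReal.mul_const _
    · have hw := (wt_integrable h d hh hd1).const_mul (Real.Gamma d)
      refine hw.congr ?_
      filter_upwards [hne] with t ht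
      have : ∫ s in Set.Ioi (0:ℝ), ‖Function.uncurry F (t, s)‖ = ∫ s in Set.Ioi (0:ℝ),
          (s ^ (d - 1) * Real.exp (-(s * |t|))) * Real.exp (-(h * |t|)) := by
        apply setIntegral_congr_fun measurableSet_Ioi
        intro s hs
        have hs' : 0 < s := hs
        simp only [hF, Function.uncurry_apply_pair]
        rw [norm_mul, norm_mul, ex_norm, Complex.norm_real, Complex.norm_real, Real.norm_eq_abs,
          Real.norm_eq_abs, abs_of_nonneg (mul_nonneg (Real.rpow_nonneg hs'.le _)
            (Real.exp_pos _).le), Real.abs_exp, mul_one]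
      rw [this, integral_mul_const, hg t ht, wt]
      ring
  have hs1 : ∀ s ∈ Set.Ioi (0:ℝ), ∫ t, F t s = ((subo h d x s : ℝ) : ℂ) := by
    intro s hs
    have hs' : 0 < s := hs
    have hp := poisson (s + h) x (by linarith)
    unfold subo
    rw [Complex.ofReal_mul, ← hp, ← integral_const_mul]
    congr 1; funext t
    simp only [hF]
    rw [show -((s + h) * |t|) = -(s * |t|) + -(h * |t|) by ring, Real.exp_add]
    push_cast
    ring
  constructor
  · have := hIntg.integral_prod_right
    have h2 : IntegrableOn (fun s => ((subo h d x s : ℝ) : ℂ)) (Set.Ioi 0) := by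
      refine IntegrableOn.congr_fun (f := fun s => ∫ t, F t s) this ?_ measurableSet_Ioi
      exact hs1
    have := h2.re
    simp only [Complex.ofReal_re, RCLike.re_to_complex] at this
    exact this
  · have e1 : ∫ t, ∫ s in Set.Ioi (0:ℝ), F t s = Real.Gamma d * ft (wt h d) x := by
      unfold ft
      rw [← integral_const_mul]
      apply integral_congr_ae
      filter_upwards [hne] with t ht
      simp only [hF]
      rw [integral_mul_const, integral_complex_ofReal, hg t ht, wt]
      push_cast; ring
    have e2 := integral_integral_swap hIntg
    rw [e1, setIntegral_congr_fun measurableSet_Ioi hs1, integral_complex_ofReal] at e2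
    have : (Real.Gamma d : ℂ) ≠ 0 := by exact_mod_cast hΓ.ne'
    unfold kf
    push_cast
    rw [← e2]
    field_simp

lemma kf_lower (h d x : ℝ) (hh : 0 < h) (hd : 0 < d) (hd1 : d < 1) :
    (Real.Gamma d)⁻¹ * (2 ^ (d - 1) * (1/5)) * (|x| + h) ^ (d - 1) ≤ kf h d x := by
  have hΓ := Real.Gamma_pos_of_pos hd
  obtain ⟨hi, -⟩ := ft_wt h d x hh hd hd1
  set m := |x| + h with hm
  have hm0 : 0 < m := by positivity
  unfold kf
  rw [mul_assoc]
  refine mul_le_mul_of_nonneg_left ?_ (by positivity)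
  have h1 : ∫ s in Set.Ioc m (2 * m), subo h d x s ≤ ∫ s in Set.Ioi (0:ℝ), subo h d x s := by
    apply setIntegral_mono_set hi
    · filter_upwards [ae_restrict_mem measurableSet_Ioi] with s hs
      exact subo_nonneg h d x s hh hs
    · exact (Set.Ioc_subset_Ioi_self.trans (Set.Ioi_subset_Ioi hm0.le)).eventuallyLE
  refine le_trans ?_ h1
  have h2 : ∀ s ∈ Set.Ioc m (2 * m), (2 * m) ^ (d - 1) * (1 / (5 * m)) ≤ subo h d x s := by
    intro s hs
    have hs0 : 0 < s := hm0.trans hs.1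
    unfold subo
    have hxm : |x| ≤ m := by linarith
    have hhm : h ≤ m := by linarith [abs_nonneg x]
    have hx2 : x ^ 2 ≤ m ^ 2 := by
      rw [← sq_abs]; gcongr
    have hsh : 0 < s + h := by linarith
    refine mul_le_mul ?_ ?_ (by positivity) (by positivity)
    · exact Real.rpow_le_rpow_of_nonpos hs0 hs.2 (by linarith)
    · rw [div_le_div_iff₀ (by positivity) (by positivity)]
      have h3 : s + h ≤ 3 * m := by linarith [hs.2]
      have h4 : m ≤ s + h := by linarith [hs.1]
      nlinarith
  have h3 := setIntegral_mono_on (μ := volume) (s := Set.Ioc m (2 * m))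
    (f := fun _ => (2 * m) ^ (d - 1) * (1 / (5 * m))) (g := subo h d x)
    (integrableOn_const (by simp)) (hi.mono_set (Set.Ioc_subset_Ioi_self.trans (Set.Ioi_subset_Ioi hm0.le)))
    measurableSet_Ioc h2
  refine le_trans (le_of_eq ?_) h3
  rw [setIntegral_const, Real.mul_rpow (by norm_num) hm0.le]
  simp
  rw [max_eq_left (by linarith)]
  field_simp
  ring

/-- the constant in the kernel lower bound -/
def ck : ℝ := (Real.Gamma (1/32))⁻¹ * (2 ^ ((1/32 : ℝ) - 1) * (1/5))

lemma ck_pos : 0 < ck := by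
  have := Real.Gamma_pos_of_pos (show (0:ℝ) < 1/32 by norm_num)
  unfold ck; positivity

lemma kf_lower' (h x : ℝ) (hh : 0 < h) :
    1 / (|x| + h) ≤ ck⁻¹ * h ^ (-(1/32) : ℝ) * kf h (1/32) x := by
  have h1 := kf_lower h (1/32) x hh (by norm_num) (by norm_num)
  change ck * _ ≤ _ at h1
  have hc := ck_pos
  have hm : 0 < |x| + h := by positivity
  have h2 : h ^ (1/32 : ℝ) * (|x| + h)⁻¹ ≤ (|x| + h) ^ ((1/32 : ℝ) - 1) := by
    rw [Real.rpow_sub hm, Real.rpow_one, div_eq_mul_inv]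
    exact mul_le_mul_of_nonneg_right (Real.rpow_le_rpow hh.le (by linarith [abs_nonneg x])
      (by norm_num)) (by positivity)
  have h3 : ck * (h ^ (1/32 : ℝ) * (|x| + h)⁻¹) ≤ kf h (1/32) x :=
    (mul_le_mul_of_nonneg_left h2 hc.le).trans h1
  calc 1 / (|x| + h) = ck⁻¹ * h ^ (-(1/32) : ℝ) * (ck * (h ^ (1/32 : ℝ) * (|x| + h)⁻¹)) := by
        have e : h ^ (-(1/32) : ℝ) * h ^ (1/32 : ℝ) = 1 := by
          rw [← Real.rpow_add hh]; norm_num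
        calc 1 / (|x| + h) = (ck⁻¹ * ck) * (h ^ (-(1/32) : ℝ) * h ^ (1/32 : ℝ)) * (|x| + h)⁻¹ := by
              rw [e, inv_mul_cancel₀ hc.ne']; simp
          _ = _ := by ring
    _ ≤ _ := mul_le_mul_of_nonneg_left h3 (by positivity)

lemma planch {Y ι : Type*} [Fintype ι] [MeasurableSpace Y] (m : Measure Y) [IsFiniteMeasure m]
    (w : ι → ℝ → ℝ) (hw : ∀ i, Integrable (w i)) (hwm : ∀ i, Measurable (w i))
    (φ : Y → ι → ℝ) (hφ : ∀ i, Measurable fun y => φ y i) :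
    ∫ z, ∏ i, ft (w i) (φ z.1 i - φ z.2 i) ∂(m.prod m) =
    ((∫ t : ι → ℝ, (∏ i, w i (t i)) *
      ‖∫ y, Complex.exp (((∑ i, t i * φ y i : ℝ) : ℂ) * Complex.I) ∂m‖ ^ 2 : ℝ) : ℂ) := by
  rw [fub w hw hwm (m.prod m) (fun z i => φ z.1 i - φ z.2 i)
    (fun i => ((hφ i).comp measurable_fst).sub ((hφ i).comp measurable_snd)),
    ← integral_complex_ofReal]
  congr 1; funext t
  push_cast
  congr 1
  rw [← Complex.mul_conj', ← integral_conj, ← integral_prod_mul]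
  congr 1; funext z
  rw [← Complex.exp_conj, ← Complex.exp_add]
  congr 1
  simp only [map_mul, Complex.conj_I, map_sum, Complex.conj_ofReal]
  rw [mul_neg, ← sub_eq_add_neg, ← sub_mul, ← Finset.sum_sub_distrib]
  congr 1
  apply Finset.sum_congr rfl
  intro i _
  ring

/-- the total mass of the weight with exponent 31/32 -/
def V0 (h : ℝ) : ℝ := 2 * Real.Gamma (1/32) * h ^ (-(1/32) : ℝ)

lemma V0_pos (h : ℝ) (hh : 0 < h) : 0 < V0 h := by
  have := Real.Gamma_pos_of_pos (show (0:ℝ) < 1/32 by norm_num)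
  unfold V0; positivity

lemma V0_eq (h : ℝ) (hh : 0 < h) : ∫ t, wt h (31/32) t = V0 h := by
  rw [wt_integral h _ hh (by norm_num), V0]
  norm_num

lemma wt_mul (h t : ℝ) : wt h (1/32) t * |t| ^ (-(15/16) : ℝ) = wt h (31/32) t := by
  unfold wt
  rcases eq_or_ne t 0 with rfl | ht
  · rw [abs_zero, Real.zero_rpow (by norm_num), Real.zero_rpow (by norm_num)]
    simp
  · rw [mul_right_comm, ← Real.rpow_add (abs_pos.2 ht)]
    norm_num

lemma kf_meas (h : ℝ) (hh : 0 < h) : Measurable (kf h (1/32)) := by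
  have : kf h (1/32) = fun x => (ft (wt h (1/32)) x).re := by
    funext x
    rw [(ft_wt h (1/32) x hh (by norm_num) (by norm_num)).2, Complex.ofReal_re]
  rw [this]
  exact Complex.measurable_re.comp (ft_meas _ (wt_meas _ _)).measurable

/-- an upper bound for the kernel -/
def kM (h : ℝ) : ℝ := ∫ t, wt h (1/32) t

lemma kf_le (h x : ℝ) (hh : 0 < h) : kf h (1/32) x ≤ kM h := by
  have := ft_norm_le (wt h (1/32)) (wt_nonneg _ _) x
  rw [(ft_wt h (1/32) x hh (by norm_num) (by norm_num)).2, Complex.norm_real] at this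
  exact (le_abs_self _).trans this

/-- the pair correlation -/
def Db (h : ℝ) : ℝ := ∫ b, ∫ b', kf h (1/32) (fc b - fc b') ∂mu1 ∂mu1

lemma kf_int {Y : Type*} [MeasurableSpace Y] (m : Measure Y) [IsFiniteMeasure m] (h : ℝ) (hh : 0 < h)
    (g : Y → ℝ) (hg : Measurable g) : Integrable (fun y => kf h (1/32) (g y)) m := by
  refine Integrable.of_bound (C := kM h) ((kf_meas h hh).comp hg).aestronglyMeasurable
    (ae_of_all _ fun y => ?_)
  rw [Real.norm_eq_abs, abs_of_nonneg (kf_nonneg _ _ _ hh (by norm_num))]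
  exact kf_le _ _ hh

lemma Db_nonneg (h : ℝ) (hh : 0 < h) : 0 ≤ Db h :=
  integral_nonneg fun _ => integral_nonneg fun _ => kf_nonneg _ _ _ hh (by norm_num)

lemma Db_le (h : ℝ) (hh : 0 < h) : Db h ≤ 36 * V0 h := by
  have hp := planch (ι := Unit) mu1 (fun _ => wt h (1/32))
    (fun _ => wt_integrable h _ hh (by norm_num)) (fun _ => wt_meas _ _) (fun y _ => fc y)
    (fun _ => fc_cont.measurable)
  simp only [Finset.univ_unique, Finset.prod_singleton, Finset.sum_singleton] at hp
  have e1 : ∀ z : ℝ × ℝ, ft (wt h (1/32)) (fc z.1 - fc z.2) =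
      ((kf h (1/32) (fc z.1 - fc z.2) : ℝ) : ℂ) := fun z =>
    (ft_wt h (1/32) _ hh (by norm_num) (by norm_num)).2
  simp_rw [e1] at hp
  rw [integral_complex_ofReal, Complex.ofReal_inj, integral_prod _ (kf_int _ h hh _
    (by have := fc_cont; fun_prop))] at hp
  change Db h = _ at hp
  have e2 := (volume_preserving_funUnique Unit ℝ).integral_comp'
    (fun t : ℝ => wt h (1/32) t * ‖Jb t‖ ^ 2)
  rw [hp]
  refine le_trans (le_of_eq e2) ?_
  have hV := (wt_integrable h (31/32) hh (by norm_num)).const_mul 36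
  rw [← V0_eq h hh, ← integral_const_mul]
  refine integral_mono_of_nonneg (ae_of_all _ fun t => mul_nonneg (wt_nonneg _ _ _) (by positivity))
    hV (ae_of_all _ fun t => ?_)
  simp only
  rw [← wt_mul]
  rcases eq_or_ne t 0 with rfl | ht
  · have : wt h (1/32) 0 = 0 := by
      unfold wt
      rw [abs_zero, Real.zero_rpow (by norm_num), zero_mul]
    rw [this, zero_mul, zero_mul, mul_zero]
  · have := mul_le_mul_of_nonneg_left (Jb_pow t ht) (wt_nonneg h (1/32) t)
    linarith

lemma prod3 (q1 q2 q3 : ℝ → ℝ) :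
    ∫ x, q1 x.1 * (q2 x.2.1 * q3 x.2.2) ∂muX =
      (∫ y, q1 y ∂mu1) * ((∫ y, q2 y ∂mu1) * ∫ y, q3 y ∂mu1) := by
  unfold muX
  rw [integral_prod_mul (f := q1) (g := fun y : ℝ × ℝ => q2 y.1 * q3 y.2),
    integral_prod_mul (f := q2) (g := q3)]

lemma shift3 (q1 q2 q3 : ℝ → ℝ) (h1 : Measurable q1) (h2 : Measurable q2) (h3 : Measurable q3)
    (M : ℝ) (b1 : ∀ x, |q1 x| ≤ M) (b2 : ∀ x, |q2 x| ≤ M) (b3 : ∀ x, |q3 x| ≤ M)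
    (hp : Function.Periodic q3 1) (u : ℝ) :
    ∫ x, q1 x.1 * (q2 x.2.1 * q3 (x.2.2 - x.1 + x.2.1 - u)) ∂muX =
      (∫ y, q1 y ∂mu1) * ((∫ y, q2 y ∂mu1) * ∫ y, q3 y ∂mu1) := by
  have hM : 0 ≤ M := (abs_nonneg _).trans (b1 0)
  unfold muX
  rw [integral_prod]
  · have : ∀ b : ℝ, ∫ y : ℝ × ℝ, q1 b * (q2 y.1 * q3 (y.2 - b + y.1 - u)) ∂(mu1.prod mu1) =
        q1 b * ((∫ y, q2 y ∂mu1) * ∫ y, q3 y ∂mu1) := by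
      intro b
      rw [integral_const_mul, integral_prod]
      · congr 1
        rw [← integral_mul_const]
        congr 1; funext c
        simp only
        rw [integral_const_mul]
        congr 1
        rw [← integral_mu1_shift q3 hp (- b + c - u)]
        congr 1; funext a; congr 1; ring
      · refine Integrable.of_bound (C := M * M) (Measurable.aestronglyMeasurable (by fun_prop))
          (ae_of_all _ fun y => ?_)
        rw [norm_mul]
        exact mul_le_mul (b2 _) (b3 _) (norm_nonneg _) hM
    simp_rw [this]
    rw [integral_mul_const]
  · refine Integrable.of_bound (C := M * (M * M)) (Measurable.aestronglyMeasurable (by fun_prop))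
          (ae_of_all _ fun y => ?_)
    rw [norm_mul, norm_mul]
    exact mul_le_mul (b1 _) (mul_le_mul (b2 _) (b3 _) (norm_nonneg _) hM) (by positivity) hM

/-- the one-variable correlation -/
def gk (h y : ℝ) : ℝ := ∫ y', kf h (1/32) (fc y - fc y') ∂mu1

lemma gk_per (h : ℝ) : Function.Periodic (gk h) 1 := by
  intro y; unfold gk; rw [fc_periodic]

lemma gk_meas (h : ℝ) (hh : 0 < h) : Measurable (gk h) := by
  have h1 := kf_meas h hh
  have h2 := fc_cont.measurable
  have : StronglyMeasurable fun y => ∫ y', kf h (1/32) (fc y - fc y') ∂mu1 := by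
    apply StronglyMeasurable.integral_prod_right (f := fun (y y' : ℝ) => kf h (1/32) (fc y - fc y'))
    apply Measurable.stronglyMeasurable
    apply h1.comp
    fun_prop
  exact this.measurable

lemma gk_bd (h y : ℝ) (hh : 0 < h) : |gk h y| ≤ kM h := by
  have := norm_integral_le_of_norm_le_const (μ := mu1) (C := kM h)
    (f := fun y' => kf h (1/32) (fc y - fc y')) (ae_of_all _ fun x => by
      rw [Real.norm_eq_abs, abs_of_nonneg (kf_nonneg _ _ _ hh (by norm_num))]
      exact kf_le _ _ hh)
  simpa [gk] using this

lemma kf_abs (h x : ℝ) (hh : 0 < h) : |kf h (1/32) x| ≤ kM h := by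
  rw [abs_of_nonneg (kf_nonneg _ _ _ hh (by norm_num))]
  exact kf_le _ _ hh

lemma kkk_int {Y : Type*} [MeasurableSpace Y] (m : Measure Y) [IsFiniteMeasure m] (h : ℝ) (hh : 0 < h)
    (g1 g2 g3 : Y → ℝ) (hg1 : Measurable g1) (hg2 : Measurable g2) (hg3 : Measurable g3) :
    Integrable (fun y => kf h (1/32) (g1 y) * (kf h (1/32) (g2 y) * kf h (1/32) (g3 y))) m := by
  have hk := kf_meas h hh
  have hM : 0 ≤ kM h := (abs_nonneg _).trans (kf_abs h 0 hh)
  refine Integrable.of_bound (C := kM h * (kM h * kM h))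
    (Measurable.aestronglyMeasurable (by fun_prop)) (ae_of_all _ fun y => ?_)
  rw [norm_mul, norm_mul]
  exact mul_le_mul (kf_abs _ _ hh) (mul_le_mul (kf_abs _ _ hh) (kf_abs _ _ hh)
    (norm_nonneg _) hM) (by positivity) hM

lemma tripA (h : ℝ) (hh : 0 < h) :
    ∫ z : (ℝ × ℝ × ℝ) × (ℝ × ℝ × ℝ), kf h (1/32) (fc z.1.1 - fc z.2.1) *
      (kf h (1/32) (fc z.1.2.1 - fc z.2.2.1) * kf h (1/32) (fc z.1.2.2 - fc z.2.2.2))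
      ∂(muX.prod muX) = Db h ^ 3 := by
  have hf := fc_cont
  rw [integral_prod _ (kkk_int _ h hh _ _ _ (by fun_prop) (by fun_prop) (by fun_prop))]
  have : ∀ x : ℝ × ℝ × ℝ, ∫ x' : ℝ × ℝ × ℝ, kf h (1/32) (fc x.1 - fc x'.1) *
      (kf h (1/32) (fc x.2.1 - fc x'.2.1) * kf h (1/32) (fc x.2.2 - fc x'.2.2)) ∂muX =
      gk h x.1 * (gk h x.2.1 * gk h x.2.2) := fun x =>
    prod3 (fun y => kf h (1/32) (fc x.1 - fc y)) (fun y => kf h (1/32) (fc x.2.1 - fc y))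
      (fun y => kf h (1/32) (fc x.2.2 - fc y))
  simp_rw [this]
  rw [prod3]
  change Db h * (Db h * Db h) = _
  ring

lemma tripB (h u : ℝ) (hh : 0 < h) :
    ∫ z : (ℝ × ℝ × ℝ) × (ℝ × ℝ × ℝ), kf h (1/32) (fc z.1.1 - fc z.2.1) *
      (kf h (1/32) (fc z.1.2.1 - fc z.2.2.1) * kf h (1/32)
        (fc (z.1.2.2 - z.1.1 + z.1.2.1 - u) - fc (z.2.2.2 - z.2.1 + z.2.2.1 - u)))
      ∂(muX.prod muX) = Db h ^ 3 := by
  have hf := fc_cont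
  have hk := kf_meas h hh
  rw [integral_prod _ (kkk_int _ h hh _ _ _ (by fun_prop) (by fun_prop) (by fun_prop))]
  have : ∀ x : ℝ × ℝ × ℝ, ∫ x' : ℝ × ℝ × ℝ, kf h (1/32) (fc x.1 - fc x'.1) *
      (kf h (1/32) (fc x.2.1 - fc x'.2.1) * kf h (1/32)
        (fc (x.2.2 - x.1 + x.2.1 - u) - fc (x'.2.2 - x'.1 + x'.2.1 - u))) ∂muX =
      gk h x.1 * (gk h x.2.1 * gk h (x.2.2 - x.1 + x.2.1 - u)) := fun x =>
    shift3 (fun y => kf h (1/32) (fc x.1 - fc y)) (fun y => kf h (1/32) (fc x.2.1 - fc y))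
      (fun y => kf h (1/32) (fc (x.2.2 - x.1 + x.2.1 - u) - fc y)) (by fun_prop) (by fun_prop)
      (by fun_prop) (kM h) (fun _ => kf_abs _ _ hh) (fun _ => kf_abs _ _ hh)
      (fun _ => kf_abs _ _ hh) (fun y => by simp only [fc_periodic y]) u
  simp_rw [this]
  rw [shift3 (gk h) (gk h) (gk h) (gk_meas h hh) (gk_meas h hh) (gk_meas h hh) (kM h)
    (fun _ => gk_bd _ _ hh) (fun _ => gk_bd _ _ hh) (fun _ => gk_bd _ _ hh) (gk_per h) u]
  change Db h * (Db h * Db h) = _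
  ring

/-- weights with the more singular one in slot `k` -/
def wv (h : ℝ) (k : Fin 4) (i : Fin 4) : ℝ → ℝ := if i = k then wt h (31/32) else wt h (1/32)

lemma wv_int (h : ℝ) (hh : 0 < h) (k i : Fin 4) : Integrable (wv h k i) := by
  unfold wv; split_ifs
  · exact wt_integrable h _ hh (by norm_num)
  · exact wt_integrable h _ hh (by norm_num)

lemma wv_meas (h : ℝ) (k i : Fin 4) : Measurable (wv h k i) := by
  unfold wv; split_ifs <;> exact wt_meas _ _

lemma V_le (h x : ℝ) (hh : 0 < h) : ‖ft (wt h (31/32)) x‖ ≤ V0 h := by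
  rw [← V0_eq h hh]; exact ft_norm_le _ (wt_nonneg _ _) x

lemma L2_bound (h u : ℝ) (hh : 0 < h) (k : Fin 4) (hk : k = 0 ∨ k = 3) :
    ∫ t : Fin 4 → ℝ, (∏ i, wv h k i (t i)) * ‖Kb u t‖ ^ 2 ≤ V0 h * Db h ^ 3 := by
  have hf := fc_cont
  have hft : ∀ x, ft (wt h (1/32)) x = (kf h (1/32) x : ℂ) := fun x =>
    (ft_wt h (1/32) x hh (by norm_num) (by norm_num)).2
  have hn : ∀ x, 0 ≤ kf h (1/32) x := fun x => kf_nonneg _ _ _ hh (by norm_num)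
  have hp := planch muX (wv h k) (wv_int h hh k) (wv_meas h k) (phi u)
    (fun i => (phi_cont u i).measurable)
  have h0 : ∫ t : Fin 4 → ℝ, (∏ i, wv h k i (t i)) * ‖Kb u t‖ ^ 2 ≤
      ‖∫ z, ∏ i, ft (wv h k i) (phi u z.1 i - phi u z.2 i) ∂(muX.prod muX)‖ := by
    rw [hp, Complex.norm_real]
    exact le_abs_self _
  refine h0.trans ?_
  rcases hk with rfl | rfl
  · rw [← tripB h u hh, ← integral_const_mul]
    refine norm_integral_le_of_norm_le ((kkk_int _ h hh _ _ _ (by fun_prop) (by fun_prop)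
      (by fun_prop)).const_mul _) (ae_of_all _ fun z => ?_)
    rw [Fin.prod_univ_four]
    change ‖ft (wt h (31/32)) (fc z.1.2.2 - fc z.2.2.2) * ft (wt h (1/32)) (fc z.1.1 - fc z.2.1) *
      ft (wt h (1/32)) (fc z.1.2.1 - fc z.2.2.1) * ft (wt h (1/32))
        (fc (z.1.2.2 - z.1.1 + z.1.2.1 - u) - fc (z.2.2.2 - z.2.1 + z.2.2.1 - u))‖ ≤ _
    rw [norm_mul, norm_mul, norm_mul, hft, hft, hft, Complex.norm_real, Complex.norm_real,
      Complex.norm_real, Real.norm_of_nonneg (hn _), Real.norm_of_nonneg (hn _),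
      Real.norm_of_nonneg (hn _), mul_assoc, mul_assoc]
    exact mul_le_mul_of_nonneg_right (V_le _ _ hh)
      (mul_nonneg (hn _) (mul_nonneg (hn _) (hn _)))
  · rw [← tripA h hh, ← integral_const_mul]
    refine norm_integral_le_of_norm_le ((kkk_int _ h hh _ _ _ (by fun_prop) (by fun_prop)
      (by fun_prop)).const_mul _) (ae_of_all _ fun z => ?_)
    rw [Fin.prod_univ_four]
    change ‖ft (wt h (1/32)) (fc z.1.2.2 - fc z.2.2.2) * ft (wt h (1/32)) (fc z.1.1 - fc z.2.1) *
      ft (wt h (1/32)) (fc z.1.2.1 - fc z.2.2.1) * ft (wt h (31/32))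
        (fc (z.1.2.2 - z.1.1 + z.1.2.1 - u) - fc (z.2.2.2 - z.2.1 + z.2.2.1 - u))‖ ≤ _
    rw [norm_mul, norm_mul, norm_mul, hft, hft, hft, Complex.norm_real, Complex.norm_real,
      Complex.norm_real, Real.norm_of_nonneg (hn _), Real.norm_of_nonneg (hn _),
      Real.norm_of_nonneg (hn _), mul_comm]
    refine (mul_le_mul_of_nonneg_right (V_le _ _ hh)
      (mul_nonneg (mul_nonneg (hn _) (hn _)) (hn _))).trans (le_of_eq ?_)
    ring

lemma Kb_meas (u : ℝ) : StronglyMeasurable (Kb u) := by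
  unfold Kb
  apply StronglyMeasurable.integral_prod_right (f := fun (t : Fin 4 → ℝ) (x : ℝ × ℝ × ℝ) =>
    Complex.exp (((∑ i, t i * phi u x i : ℝ) : ℂ) * Complex.I))
  apply Measurable.stronglyMeasurable
  have := fun i => (phi_cont u i).measurable
  apply Complex.measurable_exp.comp
  apply Measurable.mul_const
  apply Complex.measurable_ofReal.comp
  apply Finset.measurable_fun_sum
  intro i _
  have h1 : Measurable fun a : (Fin 4 → ℝ) × (ℝ × ℝ × ℝ) => phi u a.2 i :=
    (this i).comp measurable_snd
  exact ((measurable_pi_apply i).comp measurable_fst).mul h1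

lemma wK_int (w : Fin 4 → ℝ → ℝ) (hw : ∀ i, Integrable (w i)) (u : ℝ) (n : ℕ) :
    Integrable fun t : Fin 4 → ℝ => (∏ i, w i (t i)) * ‖Kb u t‖ ^ n := by
  have hIntg : Integrable (fun t : Fin 4 → ℝ => ∏ i, w i (t i)) := Integrable.fintype_prod hw
  refine hIntg.mul_bdd (c := 1) ((Kb_meas u).norm.pow n).aestronglyMeasurable (ae_of_all _ fun t => ?_)
  simp
  exact pow_le_one₀ (norm_nonneg _) (Kb_norm_le_one _ _)

lemma L3_bound (h u : ℝ) (hh : 0 < h) :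
    ∫ t : Fin 4 → ℝ, (∏ i, wt h (1/32) (t i)) * ‖Kb u t‖ ^ 3 ≤
      36 * SC * (V0 h * Db h ^ 3) := by
  have hS := SC_nonneg
  have i0 := wK_int _ (wv_int h hh 0) u 2
  have i3 := wK_int _ (wv_int h hh 3) u 2
  have hle : ∫ t : Fin 4 → ℝ, (∏ i, wt h (1/32) (t i)) * ‖Kb u t‖ ^ 3 ≤
      ∫ t : Fin 4 → ℝ, 18 * SC * ((∏ i, wv h 0 i (t i)) * ‖Kb u t‖ ^ 2 +
        (∏ i, wv h 3 i (t i)) * ‖Kb u t‖ ^ 2) := by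
    refine integral_mono_of_nonneg (ae_of_all _ fun t => mul_nonneg
      (Finset.prod_nonneg fun i _ => wt_nonneg _ _ _) (by positivity))
      ((i0.add i3).const_mul _) (ae_of_all _ fun t => ?_)
    simp only [Fin.prod_univ_four]
    change wt h (1/32) (t 0) * wt h (1/32) (t 1) * wt h (1/32) (t 2) * wt h (1/32) (t 3) *
      ‖Kb u t‖ ^ 3 ≤ 18 * SC * (wt h (31/32) (t 0) * wt h (1/32) (t 1) * wt h (1/32) (t 2) *
        wt h (1/32) (t 3) * ‖Kb u t‖ ^ 2 + wt h (1/32) (t 0) * wt h (1/32) (t 1) *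
        wt h (1/32) (t 2) * wt h (31/32) (t 3) * ‖Kb u t‖ ^ 2)
    have hw0 : wt h (1/32) 0 = 0 := by
      unfold wt
      rw [abs_zero, Real.zero_rpow (by norm_num), zero_mul]
    have n0 := wt_nonneg h (1/32) (t 0)
    have n1 := wt_nonneg h (1/32) (t 1)
    have n2 := wt_nonneg h (1/32) (t 2)
    have n3 := wt_nonneg h (1/32) (t 3)
    have m0 := wt_nonneg h (31/32) (t 0)
    have m3 := wt_nonneg h (31/32) (t 3)
    by_cases h0 : t 0 = 0
    · have : wt h (1/32) (t 0) = 0 := by rw [h0, hw0]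
      refine le_trans (le_of_eq (b := 0) ?_) (by positivity)
      rw [this]; ring
    by_cases h3 : t 3 = 0
    · have : wt h (1/32) (t 3) = 0 := by rw [h3, hw0]
      refine le_trans (le_of_eq (b := 0) ?_) (by positivity)
      rw [this]; ring
    have hK := Kb_bound u t h0 h3
    rw [← wt_mul h (t 0), ← wt_mul h (t 3)]
    have := mul_le_mul_of_nonneg_left hK (show 0 ≤ wt h (1/32) (t 0) * wt h (1/32) (t 1) *
      wt h (1/32) (t 2) * wt h (1/32) (t 3) * ‖Kb u t‖ ^ 2 by positivity)
    linarith
  refine hle.trans ?_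
  rw [integral_const_mul, integral_add i0 i3]
  have a0 := L2_bound h u hh 0 (Or.inl rfl)
  have a3 := L2_bound h u hh 3 (Or.inr rfl)
  have := mul_le_mul_of_nonneg_left (add_le_add a0 a3) (show 0 ≤ 18 * SC by positivity)
  linarith

/-- the normalized measure on the torus -/
def nu3 : Measure (Fin 3 → ℝ) := Measure.pi fun _ => mu1

instance nu3_prob : IsProbabilityMeasure nu3 := by unfold nu3; infer_instance

lemma T3_meas : (volume : Measure (Fin 3 → ℝ)).restrict T3 = nu3 := by
  unfold T3 nu3 mu1
  rw [volume_pi, Measure.restrict_pi_pi]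

lemma edisp_eq (p : Fin 3 → ℝ) : edisp p = 3 - ∑ j, fc (p j) := by
  unfold edisp fc
  rw [Finset.sum_sub_distrib]; simp

lemma edisp_cont : Continuous edisp := by
  unfold edisp; fun_prop

lemma T3_exp (t α : ℝ) : ∫ q, Complex.exp (((t * (α - edisp q) : ℝ) : ℂ) * Complex.I) ∂nu3 =
    Complex.exp (((t * (α - 3) : ℝ) : ℂ) * Complex.I) * Jb t ^ 3 := by
  have h1 := integral_fintype_prod_eq_prod (μ := fun _ : Fin 3 => mu1)
    (fun (_ : Fin 3) (x : ℝ) => Complex.exp (((t * fc x : ℝ) : ℂ) * Complex.I))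
  have h2 : ∏ _i : Fin 3, ∫ x, Complex.exp (((t * fc x : ℝ) : ℂ) * Complex.I) ∂mu1 = Jb t ^ 3 := by
    simp [Jb]
  rw [h2] at h1
  rw [← h1, nu3, ← integral_const_mul]
  congr 1; funext q
  rw [← Complex.exp_sum, ← Complex.exp_add, edisp_eq]
  congr 1
  push_cast
  rw [← Finset.sum_mul, ← Finset.mul_sum]
  ring

/-- a majorant of the cube of `Jb` -/
def GJ (t : ℝ) : ℝ := (Set.Ioc (0:ℝ) 1).indicator (fun _ => (1:ℝ)) t +
  (Set.Ioi (1:ℝ)).indicator (fun t => 216 * t ^ (-(3/2) : ℝ)) t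

lemma GJ_int : Integrable GJ := by
  apply Integrable.add
  · rw [integrable_indicator_iff measurableSet_Ioc]
    exact integrableOn_const (by simp)
  · rw [integrable_indicator_iff measurableSet_Ioi]
    exact (integrableOn_Ioi_rpow_of_lt (by norm_num) one_pos).const_mul _

lemma GJ_nonneg (t : ℝ) : 0 ≤ GJ t := by
  apply add_nonneg
  · exact Set.indicator_nonneg (fun _ _ => zero_le_one) t
  · refine Set.indicator_nonneg (fun s hs => ?_) t
    have : (0:ℝ) < s := lt_trans one_pos hs
    positivity

lemma Jb_GJ (t : ℝ) (ht : 0 < t) : ‖Jb t‖ ^ 3 ≤ GJ t := by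
  unfold GJ
  rcases le_or_gt t 1 with h | h
  · rw [Set.indicator_of_mem (show t ∈ Set.Ioc (0:ℝ) 1 from ⟨ht, h⟩), Set.indicator_of_notMem (by simpa using h), add_zero]
    exact pow_le_one₀ (norm_nonneg _) (Jb_norm_le_one t)
  · rw [Set.indicator_of_notMem (by simp [h]), Set.indicator_of_mem (by exact h), zero_add]
    have h1 := Jb_sq t ht.ne'
    rw [abs_of_pos ht] at h1
    have h2 : ‖Jb t‖ ≤ 6 * t ^ (-(1/2) : ℝ) := by
      apply le_of_sq_le_sq _ (by positivity)
      rw [mul_pow, ← Real.rpow_natCast, ← Real.rpow_natCast (t ^ _), ← Real.rpow_mul ht.le]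
      norm_num
      rw [Real.rpow_neg_one]
      simpa [div_eq_mul_inv] using h1
    calc ‖Jb t‖ ^ 3 ≤ (6 * t ^ (-(1/2) : ℝ)) ^ 3 := by gcongr
      _ = _ := by
        rw [mul_pow, ← Real.rpow_natCast (t ^ _), ← Real.rpow_mul ht.le]
        norm_num

/-- uniform bound for `Θ` -/
def CT : ℝ := ∫ t in Set.Ioi (0:ℝ), GJ t

lemma CT_nonneg : 0 ≤ CT := integral_nonneg GJ_nonneg

lemma inv_formula (x ε : ℝ) (hε : 0 < ε) :
    ((x : ℂ) + (ε : ℂ) * Complex.I)⁻¹ = -Complex.I * ∫ t in Set.Ioi (0:ℝ),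
      (Real.exp (-(ε * t)) : ℂ) * Complex.exp (((t * x : ℝ) : ℂ) * Complex.I) := by
  have e : ∀ t : ℝ, (Real.exp (-(ε * t)) : ℂ) * Complex.exp (((t * x : ℝ) : ℂ) * Complex.I) =
      Complex.exp ((-(ε : ℂ) + x * Complex.I) * t) := by
    intro t
    rw [Complex.ofReal_exp, ← Complex.exp_add]
    congr 1; push_cast; ring
  simp_rw [e]
  rw [integral_exp_mul_complex_Ioi (by simpa using hε)]
  have n1 : (x : ℂ) + ε * Complex.I ≠ 0 := by
    intro h; have := congrArg Complex.im h; simp at this; linarith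
  have n2 : -(ε : ℂ) + x * Complex.I ≠ 0 := by
    intro h; have := congrArg Complex.re h; simp at this; linarith
  simp only [Complex.ofReal_zero, mul_zero, Complex.exp_zero]
  field_simp
  ring_nf
  simp only [Complex.I_sq]
  ring

lemma ThetaEps_norm (ε α : ℝ) (hε : 0 < ε) : ‖ThetaEps ε α‖ ≤ CT := by
  unfold ThetaEps
  rw [T3_meas]
  have he := edisp_cont
  have h1 : ∀ q, ((α : ℂ) - (edisp q : ℂ) + (ε : ℂ) * Complex.I)⁻¹ = -Complex.I *
      ∫ t in Set.Ioi (0:ℝ), (Real.exp (-(ε * t)) : ℂ) *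
        Complex.exp (((t * (α - edisp q) : ℝ) : ℂ) * Complex.I) := by
    intro q
    rw [← inv_formula _ _ hε]; push_cast; rfl
  simp_rw [h1]
  rw [integral_const_mul, integral_integral_swap]
  · simp_rw [integral_const_mul, T3_exp]
    rw [norm_mul, norm_neg, Complex.norm_I, one_mul]
    refine norm_integral_le_of_norm_le GJ_int.integrableOn ?_
    filter_upwards [ae_restrict_mem measurableSet_Ioi] with t ht
    have ht' : 0 < t := ht
    rw [norm_mul, norm_mul, ex_norm, one_mul, norm_pow, Complex.norm_real, Real.norm_eq_abs,
      Real.abs_exp]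
    refine le_trans ?_ (Jb_GJ t ht')
    refine mul_le_of_le_one_left (by positivity) ?_
    rw [Real.exp_le_one_iff]
    have := mul_pos hε ht'
    linarith
  · have hi : IntegrableOn (fun t : ℝ => Real.exp (-(ε * t))) (Set.Ioi 0) := by
      have := integrableOn_rpow_mul_exp_neg_mul_rpow (s := 0) (p := 1) (b := ε) (by norm_num)
        one_pos hε
      simpa using this
    have hi2 := hi.integrable.comp_snd nu3
    refine Integrable.mono' hi2 ?_ (ae_of_all _ fun p => ?_)
    · apply Continuous.aestronglyMeasurable
      simp only [Function.uncurry_def]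
      fun_prop
    · simp only [Function.uncurry_def]
      rw [norm_mul, ex_norm, mul_one, Complex.norm_real, Real.norm_eq_abs, Real.abs_exp]

lemma ThetaEps_im (ε α : ℝ) (hε : 0 < ε) : (ThetaEps ε α).im ≤ 0 := by
  unfold ThetaEps
  rw [T3_meas]
  have he := edisp_cont
  have hne : ∀ q, (α : ℂ) - (edisp q : ℂ) + (ε : ℂ) * Complex.I ≠ 0 := by
    intro q h; have := congrArg Complex.im h; simp at this; linarith
  have hi : Integrable (fun q => ((α : ℂ) - (edisp q : ℂ) + (ε : ℂ) * Complex.I)⁻¹) nu3 := by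
    refine Integrable.of_bound (C := ε⁻¹) (Continuous.aestronglyMeasurable ?_) (ae_of_all _ fun q => ?_)
    · exact Continuous.inv₀ (by fun_prop) hne
    · rw [norm_inv]
      apply inv_anti₀ hε
      have := Complex.abs_im_le_norm ((α : ℂ) - (edisp q : ℂ) + (ε : ℂ) * Complex.I)
      simpa [abs_of_pos hε] using this
  have h2 := Complex.imCLM.integral_comp_comm hi
  simp only [Complex.imCLM_apply] at h2
  rw [← h2]
  apply integral_nonpos
  intro q
  simp only [Complex.inv_im, Pi.zero_apply]
  apply div_nonpos_of_nonpos_of_nonneg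
  · simp [hε.le]
  · exact Complex.normSq_nonneg _

lemma Theta_norm (Θ : ℝ → ℂ) (h : IsThetaLimit Θ) (α : ℝ) : ‖Θ α‖ ≤ CT := by
  refine le_of_tendsto (h α).norm ?_
  filter_upwards [self_mem_nhdsWithin] with ε hε
  exact ThetaEps_norm ε α hε

lemma Theta_im (Θ : ℝ → ℂ) (h : IsThetaLimit Θ) (α : ℝ) : (Θ α).im ≤ 0 := by
  refine le_of_tendsto ((Complex.continuous_im.tendsto _).comp (h α)) ?_
  filter_upwards [self_mem_nhdsWithin] with ε hε
  exact ThetaEps_im ε α hε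

lemma A_bound (Θ : ℝ → ℂ) (hΘ : IsThetaLimit Θ) (κ lam : ℝ) (hκ : 0 < κ) (h0 : 0 < lam)
    (h1 : lam ≤ 1) (α : ℝ) (p : Fin 3 → ℝ) :
    1 / ‖(α : ℂ) - (starRingEnd ℂ) (omegaR Θ lam p) - ((lam ^ (2 + κ) : ℝ) : ℂ) * Complex.I‖ ≤
      (CT + 2) * lam ^ (-κ) * (ck⁻¹ * (lam ^ 2) ^ (-(1/32) : ℝ)) *
        kf (lam ^ 2) (1/32) (α - edisp p) := by
  set z : ℂ := (α : ℂ) - (starRingEnd ℂ) (omegaR Θ lam p) - ((lam ^ (2 + κ) : ℝ) : ℂ) * Complex.I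
    with hz
  have hC := CT_nonneg
  set η : ℝ := lam ^ (2 + κ) with hη
  have hη0 : 0 < η := by positivity
  have hT := Theta_norm Θ hΘ (edisp p)
  have hI := Theta_im Θ hΘ (edisp p)
  have him : z.im = lam ^ 2 * (Θ (edisp p)).im - η := by
    have e2 : (lam : ℂ) ^ 2 = ((lam ^ 2 : ℝ) : ℂ) := by push_cast; rfl
    rw [hz, omegaR, e2]
    simp [-Complex.ofReal_pow]
  have hre : z.re = α - edisp p - lam ^ 2 * (Θ (edisp p)).re := by
    have e2 : (lam : ℂ) ^ 2 = ((lam ^ 2 : ℝ) : ℂ) := by push_cast; rfl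
    rw [hz, omegaR, e2]
    simp [-Complex.ofReal_pow]
    ring
  have a1 : η ≤ ‖z‖ := by
    have := Complex.abs_im_le_norm z
    rw [him] at this
    have h3 : lam ^ 2 * (Θ (edisp p)).im ≤ 0 := mul_nonpos_of_nonneg_of_nonpos (by positivity) hI
    have := neg_abs_le (lam ^ 2 * (Θ (edisp p)).im - η)
    linarith
  have a2 : |α - edisp p| ≤ ‖z‖ + CT * lam ^ 2 := by
    have h2 := Complex.abs_re_le_norm z
    have h3 := (Complex.abs_re_le_norm (Θ (edisp p))).trans hT
    have h4 : α - edisp p = z.re + lam ^ 2 * (Θ (edisp p)).re := by rw [hre]; ring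
    rw [h4]
    refine (abs_add_le _ _).trans ?_
    rw [abs_mul, abs_of_nonneg (by positivity : (0:ℝ) ≤ lam ^ 2)]
    nlinarith [sq_nonneg lam]
  have hlk : 1 ≤ lam ^ (-κ) := Real.one_le_rpow_of_pos_of_le_one_of_nonpos h0 h1 (by linarith)
  have hsq : lam ^ 2 = lam ^ (-κ) * η := by
    rw [hη, ← Real.rpow_add h0, ← Real.rpow_natCast]; norm_num
  have hA : 0 < ‖z‖ := hη0.trans_le a1
  have a3 : lam ^ 2 ≤ lam ^ (-κ) * ‖z‖ := by rw [hsq]; gcongr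
  have a4 : |α - edisp p| + lam ^ 2 ≤ (CT + 2) * lam ^ (-κ) * ‖z‖ := by
    have : ‖z‖ ≤ lam ^ (-κ) * ‖z‖ := le_mul_of_one_le_left hA.le hlk
    nlinarith
  have hh : 0 < lam ^ 2 := by positivity
  have hm : 0 < |α - edisp p| + lam ^ 2 := by positivity
  have a5 : 1 / ‖z‖ ≤ (CT + 2) * lam ^ (-κ) * (1 / (|α - edisp p| + lam ^ 2)) := by
    rw [mul_one_div, div_le_div_iff₀ hA hm, one_mul]
    exact a4
  refine a5.trans ?_
  rw [mul_assoc ((CT + 2) * lam ^ (-κ))]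
  exact mul_le_mul_of_nonneg_left (kf_lower' _ _ hh) (by positivity)

lemma swap3 (g : ℝ → ℝ → ℝ → ℝ) (hg : Continuous fun z : ℝ × ℝ × ℝ => g z.1 z.2.1 z.2.2) :
    ∫ b, ∫ c, ∫ a, Complex.exp ((g a b c : ℂ) * Complex.I) ∂mu1 ∂mu1 ∂mu1 =
    ∫ a, ∫ b, ∫ c, Complex.exp ((g a b c : ℂ) * Complex.I) ∂mu1 ∂mu1 ∂mu1 := by
  have h1 : ∀ b, ∫ c, ∫ a, Complex.exp ((g a b c : ℂ) * Complex.I) ∂mu1 ∂mu1 =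
      ∫ a, ∫ c, Complex.exp ((g a b c : ℂ) * Complex.I) ∂mu1 ∂mu1 := by
    intro b
    apply integral_integral_swap
    apply exp_integrable (mu1.prod mu1) (fun z : ℝ × ℝ => g z.2 b z.1)
    exact hg.comp (f := fun z : ℝ × ℝ => ((z.2, b, z.1) : ℝ × ℝ × ℝ)) (by fun_prop)
  simp_rw [h1]
  apply integral_integral_swap
  have h2 := exp_integrable ((mu1.prod mu1).prod mu1) (fun z : (ℝ × ℝ) × ℝ => g z.1.2 z.1.1 z.2)
    (hg.comp (f := fun z : (ℝ × ℝ) × ℝ => ((z.1.2, z.1.1, z.2) : ℝ × ℝ × ℝ)) (by fun_prop))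
  exact h2.integral_prod_left

/-- the four energies -/
def psi (α : ℝ) (u : Fin 3 → ℝ) (y : (Fin 3 → ℝ) × (Fin 3 → ℝ) × (Fin 3 → ℝ)) : Fin 4 → ℝ :=
  ![α - edisp y.1, α - edisp y.2.1, α - edisp y.2.2, α - edisp (y.1 - y.2.1 + y.2.2 - u)]

lemma psi_cont (α : ℝ) (u : Fin 3 → ℝ) (i : Fin 4) : Continuous fun y => psi α u y i := by
  have := edisp_cont
  fin_cases i <;> simp [psi] <;> fun_prop

/-- measure on the triple product of the torus -/
def nuY : Measure ((Fin 3 → ℝ) × (Fin 3 → ℝ) × (Fin 3 → ℝ)) := nu3.prod (nu3.prod nu3)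

instance nuY_prob : IsProbabilityMeasure nuY := by unfold nuY; infer_instance

lemma psi_sum (α : ℝ) (u : Fin 3 → ℝ) (t : Fin 4 → ℝ) (p q r : Fin 3 → ℝ) :
    ∑ i, t i * psi α u (p, (q, r)) i = (α - 3) * ∑ i, t i + ∑ j, (t 0 * fc (p j) + t 1 * fc (q j) +
      t 2 * fc (r j) + t 3 * fc (p j - q j + r j - u j)) := by
  rw [Fin.sum_univ_four]
  change t 0 * (α - edisp p) + t 1 * (α - edisp q) + t 2 * (α - edisp r) +
    t 3 * (α - edisp (p - q + r - u)) = _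
  simp only [edisp_eq, Fin.sum_univ_four, Fin.sum_univ_three, Pi.sub_apply, Pi.add_apply]
  ring

lemma Y_fact (α : ℝ) (u : Fin 3 → ℝ) (t : Fin 4 → ℝ) :
    ∫ y, Complex.exp (((∑ i, t i * psi α u y i : ℝ) : ℂ) * Complex.I) ∂nuY =
      Complex.exp ((((α - 3) * ∑ i, t i : ℝ) : ℂ) * Complex.I) * ∏ j, Kb (u j) t := by
  have hf := fc_cont
  have hcont : Continuous fun y => ∑ i, t i * psi α u y i := by
    have := psi_cont α u
    fun_prop
  have hIntg := exp_integrable nuY _ hcont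
  unfold nuY at *
  rw [integral_prod _ hIntg]
  have hIntg2 : ∀ p, Integrable (fun z : (Fin 3 → ℝ) × (Fin 3 → ℝ) =>
      Complex.exp (((∑ i, t i * psi α u (p, z) i : ℝ) : ℂ) * Complex.I)) (nu3.prod nu3) := by
    intro p
    apply exp_integrable
    exact hcont.comp (by fun_prop : Continuous fun z : (Fin 3 → ℝ) × (Fin 3 → ℝ) => (p, z))
  have e1 : ∀ p, ∫ z, Complex.exp (((∑ i, t i * psi α u (p, z) i : ℝ) : ℂ) * Complex.I)
      ∂(nu3.prod nu3) = ∫ q, ∫ r, Complex.exp (((∑ i, t i * psi α u (p, (q, r)) i : ℝ) : ℂ) *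
        Complex.I) ∂nu3 ∂nu3 := fun p => integral_prod _ (hIntg2 p)
  simp_rw [e1]
  set g : Fin 3 → ℝ → ℝ → ℝ → ℝ := fun j a b c =>
    t 0 * fc a + t 1 * fc b + t 2 * fc c + t 3 * fc (a - b + c - u j) with hg
  have e2 : ∀ p q r : Fin 3 → ℝ, Complex.exp (((∑ i, t i * psi α u (p, (q, r)) i : ℝ) : ℂ) * Complex.I) =
      Complex.exp ((((α - 3) * ∑ i, t i : ℝ) : ℂ) * Complex.I) *
        ∏ j, Complex.exp ((g j (p j) (q j) (r j) : ℂ) * Complex.I) := by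
    intro p q r
    rw [← Complex.exp_sum, ← Complex.exp_add, ← Finset.sum_mul, ← add_mul, ← Complex.ofReal_sum,
      ← Complex.ofReal_add]
    rw [psi_sum]
  simp_rw [e2, integral_const_mul]
  congr 1
  have e3 : ∀ p q : Fin 3 → ℝ, ∫ r, ∏ j, Complex.exp ((g j (p j) (q j) (r j) : ℂ) * Complex.I) ∂nu3 =
      ∏ j, ∫ c, Complex.exp ((g j (p j) (q j) c : ℂ) * Complex.I) ∂mu1 := fun p q =>
    integral_fintype_prod_eq_prod (μ := fun _ : Fin 3 => mu1)
      (fun j c => Complex.exp ((g j (p j) (q j) c : ℂ) * Complex.I))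
  simp_rw [e3]
  have e4 : ∀ p : Fin 3 → ℝ, ∫ q, ∏ j, ∫ c, Complex.exp ((g j (p j) (q j) c : ℂ) * Complex.I) ∂mu1 ∂nu3 =
      ∏ j, ∫ b, ∫ c, Complex.exp ((g j (p j) b c : ℂ) * Complex.I) ∂mu1 ∂mu1 := fun p =>
    integral_fintype_prod_eq_prod (μ := fun _ : Fin 3 => mu1)
      (fun j b => ∫ c, Complex.exp ((g j (p j) b c : ℂ) * Complex.I) ∂mu1)
  simp_rw [e4]
  have e5 := integral_fintype_prod_eq_prod (μ := fun _ : Fin 3 => mu1)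
      (fun j a => ∫ b, ∫ c, Complex.exp ((g j a b c : ℂ) * Complex.I) ∂mu1 ∂mu1)
  refine e5.trans ?_
  apply Finset.prod_congr rfl
  intro j _
  rw [Kb_iter, ← swap3 (g j) (by simp only [hg]; fun_prop)]

/-- the product kernel -/
def Pk (h α : ℝ) (u : Fin 3 → ℝ) (y : (Fin 3 → ℝ) × (Fin 3 → ℝ) × (Fin 3 → ℝ)) : ℝ :=
  ∏ i, kf h (1/32) (psi α u y i)

lemma Pk_meas (h α : ℝ) (u : Fin 3 → ℝ) (hh : 0 < h) : Measurable (Pk h α u) := by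
  unfold Pk
  apply Finset.measurable_fun_prod
  intro i _
  exact (kf_meas h hh).comp (psi_cont α u i).measurable

lemma Pk_nonneg (h α : ℝ) (u : Fin 3 → ℝ) (hh : 0 < h)
    (y : (Fin 3 → ℝ) × (Fin 3 → ℝ) × (Fin 3 → ℝ)) : 0 ≤ Pk h α u y :=
  Finset.prod_nonneg fun i _ => kf_nonneg _ _ _ hh (by norm_num)

lemma Pk_int (h α : ℝ) (u : Fin 3 → ℝ) (hh : 0 < h) : Integrable (Pk h α u) nuY := by
  refine Integrable.of_bound (C := kM h ^ 4) (Pk_meas h α u hh).aestronglyMeasurable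
    (ae_of_all _ fun y => ?_)
  rw [Real.norm_of_nonneg (Pk_nonneg h α u hh y)]
  unfold Pk
  refine (Finset.prod_le_prod (fun i _ => kf_nonneg _ _ _ hh (by norm_num))
    (fun i _ => kf_le h _ hh)).trans ?_
  simp

lemma Pk_bound (h α : ℝ) (u : Fin 3 → ℝ) (hh : 0 < h) :
    ∫ y, Pk h α u y ∂nuY ≤ 36 * SC * (V0 h * Db h ^ 3) := by
  have hwi : Integrable (wt h (1/32)) := wt_integrable h _ hh (by norm_num)
  have hfub := fub (fun _ : Fin 4 => wt h (1/32)) (fun _ => hwi) (fun _ => wt_meas _ _) nuY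
    (psi α u) (fun i => (psi_cont α u i).measurable)
  have e1 : ∀ y, ∏ i, ft (wt h (1/32)) (psi α u y i) = ((Pk h α u y : ℝ) : ℂ) := by
    intro y
    unfold Pk
    push_cast
    apply Finset.prod_congr rfl
    intro i _
    exact (ft_wt h (1/32) _ hh (by norm_num) (by norm_num)).2
  simp_rw [e1] at hfub
  rw [integral_complex_ofReal] at hfub
  have h1 : ∫ y, Pk h α u y ∂nuY ≤ ‖((∫ y, Pk h α u y ∂nuY : ℝ) : ℂ)‖ := by
    rw [Complex.norm_real]; exact le_abs_self _
  refine h1.trans ?_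
  rw [hfub]
  have hi := fun j => wK_int (fun _ => wt h (1/32)) (fun _ => hwi) (u j) 3
  have hsum : Integrable (fun t : Fin 4 → ℝ => (1/3) *
      ((∏ i, wt h (1/32) (t i)) * ‖Kb (u 0) t‖ ^ 3 + (∏ i, wt h (1/32) (t i)) * ‖Kb (u 1) t‖ ^ 3 +
        (∏ i, wt h (1/32) (t i)) * ‖Kb (u 2) t‖ ^ 3)) :=
    (((hi 0).add (hi 1)).add (hi 2)).const_mul _
  have h2 := norm_integral_le_of_norm_le (f := fun t : Fin 4 → ℝ =>
      (∏ i, ((wt h (1/32) (t i) : ℝ) : ℂ)) *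
      ∫ y, Complex.exp (((∑ i, t i * psi α u y i : ℝ) : ℂ) * Complex.I) ∂nuY) hsum
    (ae_of_all _ fun t => by
      rw [norm_mul, Y_fact, norm_mul, ex_norm, one_mul, ← Complex.ofReal_prod, Complex.norm_real,
        Real.norm_of_nonneg (Finset.prod_nonneg fun i _ => wt_nonneg _ _ _), norm_prod,
        Fin.prod_univ_three]
      have hW : 0 ≤ ∏ i, wt h (1/32) (t i) := Finset.prod_nonneg fun i _ => wt_nonneg _ _ _
      have n0 := norm_nonneg (Kb (u 0) t)
      have n1 := norm_nonneg (Kb (u 1) t)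
      have n2 := norm_nonneg (Kb (u 2) t)
      generalize ‖Kb (u 0) t‖ = a at *
      generalize ‖Kb (u 1) t‖ = b at *
      generalize ‖Kb (u 2) t‖ = c at *
      have h3 : a * b * c ≤ (1/3) * (a ^ 3 + b ^ 3 + c ^ 3) := by
        nlinarith [mul_nonneg (add_nonneg (add_nonneg n0 n1) n2)
          (add_nonneg (add_nonneg (sq_nonneg (a - b)) (sq_nonneg (b - c))) (sq_nonneg (c - a)))]
      have := mul_le_mul_of_nonneg_left h3 hW
      linarith)
  refine h2.trans ?_
  have h01 : Integrable (fun t : Fin 4 → ℝ => (∏ i, wt h (1/32) (t i)) * ‖Kb (u 0) t‖ ^ 3 +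
      (∏ i, wt h (1/32) (t i)) * ‖Kb (u 1) t‖ ^ 3) := (hi 0).add (hi 1)
  rw [integral_const_mul, integral_add h01 (hi 2), integral_add (hi 0) (hi 1)]
  have b0 := L3_bound h (u 0) hh
  have b1 := L3_bound h (u 1) hh
  have b2 := L3_bound h (u 2) hh
  linarith

lemma nested_le (f : (Fin 3 → ℝ) → (Fin 3 → ℝ) → (Fin 3 → ℝ) → ℝ)
    (M : (Fin 3 → ℝ) × (Fin 3 → ℝ) × (Fin 3 → ℝ) → ℝ) (B : ℝ) (hM : Measurable M)
    (hMB : ∀ y, M y ≤ B) (hf : ∀ p q r, 0 ≤ f p q r) (hfM : ∀ p q r, f p q r ≤ M (p, q, r)) :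
    ∫ p in T3, ∫ q in T3, ∫ r in T3, f p q r ≤ ∫ y, M y ∂nuY := by
  have hM0 : ∀ y, 0 ≤ M y := fun y => (hf _ _ _).trans (hfM y.1 y.2.1 y.2.2)
  have hb : ∀ y, ‖M y‖ ≤ B := fun y => by rw [Real.norm_of_nonneg (hM0 y)]; exact hMB y
  have i1 : Integrable M nuY := Integrable.of_bound (C := B) hM.aestronglyMeasurable (ae_of_all _ hb)
  have i2 : ∀ p, Integrable (fun z => M (p, z)) (nu3.prod nu3) := fun p =>
    Integrable.of_bound (C := B) (Measurable.aestronglyMeasurable (by fun_prop)) (ae_of_all _ fun z => hb _)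
  have i3 : ∀ p q, Integrable (fun r => M (p, (q, r))) nu3 := fun p q =>
    Integrable.of_bound (C := B) (Measurable.aestronglyMeasurable (by fun_prop)) (ae_of_all _ fun z => hb _)
  rw [T3_meas]
  unfold nuY at *
  rw [integral_prod _ i1]
  refine integral_mono_of_nonneg (ae_of_all _ fun p => integral_nonneg fun q =>
    integral_nonneg fun r => hf p q r) i1.integral_prod_left (ae_of_all _ fun p => ?_)
  simp only
  rw [integral_prod _ (i2 p)]
  refine integral_mono_of_nonneg (ae_of_all _ fun q =>
    integral_nonneg fun r => hf p q r) (i2 p).integral_prod_left (ae_of_all _ fun q => ?_)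
  exact integral_mono_of_nonneg (ae_of_all _ fun r => hf p q r) (i3 p q)
    (ae_of_all _ fun r => hfM p q r)

/-- For `0 < κ ≤ 1/12` there are `C > 0` and `λ₀ ∈ (0,1)` such that for
`0 < λ ≤ λ₀`, with `η = λ^{2+κ}`, every `α ∈ ℝ` and `u ∈ 𝕋³`, the four-denominator
integral with renormalized propagators is at most `C λ^{-3/4-3κ} |log η|⁴`. -/
theorem statement11 (κ : ℝ) (hκ0 : 0 < κ) (hκ : κ ≤ 1/12) :
    ∃ C lam0 : ℝ, 0 < C ∧ lam0 ∈ Set.Ioo (0 : ℝ) 1 ∧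
      ∀ Θ : ℝ → ℂ, IsThetaLimit Θ →
        ∀ lam : ℝ, 0 < lam → lam ≤ lam0 →
          ∀ η : ℝ, η = lam ^ (2 + κ) →
            ∀ α : ℝ, ∀ u : Fin 3 → ℝ,
              (∫ p in T3, ∫ q in T3, ∫ r in T3,
                  1 /
                    (‖(α : ℂ) - (starRingEnd ℂ) (omegaR Θ lam p) - (η : ℂ) * Complex.I‖ *
                      ‖(α : ℂ) - (starRingEnd ℂ) (omegaR Θ lam q) - (η : ℂ) * Complex.I‖ *
                      ‖(α : ℂ) - (starRingEnd ℂ) (omegaR Θ lam r) - (η : ℂ) * Complex.I‖ *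
                      ‖(α : ℂ) - (starRingEnd ℂ) (omegaR Θ lam (p - q + r - u)) -
                        (η : ℂ) * Complex.I‖)) ≤
                C * lam ^ (-(3/4) - 3 * κ) * |Real.log η| ^ (4 : ℕ) := by
  have hΓ := Real.Gamma_pos_of_pos (show (0:ℝ) < 1/32 by norm_num)
  have hS := SC_nonneg
  have hck := ck_pos
  have hCT := CT_nonneg
  set C0 : ℝ := (CT + 2) ^ 4 * ck⁻¹ ^ 4 * (36 * SC) * 36 ^ 3 * (2 * Real.Gamma (1/32)) ^ 4 with hC0
  have hC0n : 0 ≤ C0 := by positivity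
  refine ⟨C0 + 1, Real.exp (-1), by positivity, ⟨by positivity, by
    rw [Real.exp_lt_one_iff]; norm_num⟩, ?_⟩
  intro Θ hΘ lam hl0 hl1 η hη α u
  subst hη
  have hle1 : lam ≤ 1 := hl1.trans (by rw [Real.exp_le_one_iff]; norm_num)
  set h : ℝ := lam ^ 2 with hh
  have hh0 : 0 < h := by positivity
  set X : ℝ := lam ^ (-κ) with hX
  set Z : ℝ := h ^ (-(1/32) : ℝ) with hZ
  have hX0 : 0 < X := by positivity
  have hZ0 : 0 < Z := by positivity
  set R : ℝ := (CT + 2) * X * (ck⁻¹ * Z) with hR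
  have hR0 : 0 ≤ R := by positivity
  have hA : ∀ p, 1 / ‖(α : ℂ) - (starRingEnd ℂ) (omegaR Θ lam p) -
      ((lam ^ (2 + κ) : ℝ) : ℂ) * Complex.I‖ ≤ R * kf h (1/32) (α - edisp p) := fun p =>
    A_bound Θ hΘ κ lam hκ0 hl0 hle1 α p
  have hkn : ∀ x, 0 ≤ kf h (1/32) x := fun x => kf_nonneg _ _ _ hh0 (by norm_num)
  have hmain := nested_le (fun p q r => 1 /
      (‖(α : ℂ) - (starRingEnd ℂ) (omegaR Θ lam p) - ((lam ^ (2 + κ) : ℝ) : ℂ) * Complex.I‖ *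
        ‖(α : ℂ) - (starRingEnd ℂ) (omegaR Θ lam q) - ((lam ^ (2 + κ) : ℝ) : ℂ) * Complex.I‖ *
        ‖(α : ℂ) - (starRingEnd ℂ) (omegaR Θ lam r) - ((lam ^ (2 + κ) : ℝ) : ℂ) * Complex.I‖ *
        ‖(α : ℂ) - (starRingEnd ℂ) (omegaR Θ lam (p - q + r - u)) -
          ((lam ^ (2 + κ) : ℝ) : ℂ) * Complex.I‖))
    (fun y => R ^ 4 * Pk h α u y) (R ^ 4 * kM h ^ 4) ((Pk_meas h α u hh0).const_mul _)
    (fun y => by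
      refine mul_le_mul_of_nonneg_left ?_ (by positivity)
      unfold Pk
      refine (Finset.prod_le_prod (fun i _ => hkn _) (fun i _ => kf_le h _ hh0)).trans ?_
      simp)
    (fun p q r => by positivity)
    (fun p q r => by
      have e : R ^ 4 * Pk h α u (p, q, r) = R * kf h (1/32) (α - edisp p) *
          (R * kf h (1/32) (α - edisp q)) * (R * kf h (1/32) (α - edisp r)) *
          (R * kf h (1/32) (α - edisp (p - q + r - u))) := by
        unfold Pk
        rw [Fin.prod_univ_four]
        change R ^ 4 * (kf h (1/32) (α - edisp p) * kf h (1/32) (α - edisp q) *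
          kf h (1/32) (α - edisp r) * kf h (1/32) (α - edisp (p - q + r - u))) = _
        ring
      rw [e, one_div, mul_inv, mul_inv, mul_inv]
      have a1 := hA p
      have a2 := hA q
      have a3 := hA r
      have a4 := hA (p - q + r - u)
      rw [one_div] at a1 a2 a3 a4
      have m1 := mul_nonneg hR0 (hkn (α - edisp p))
      have m2 := mul_nonneg hR0 (hkn (α - edisp q))
      have m3 := mul_nonneg hR0 (hkn (α - edisp r))
      exact mul_le_mul (mul_le_mul (mul_le_mul a1 a2 (by positivity) m1) a3 (by positivity)
        (mul_nonneg m1 m2)) a4 (by positivity) (mul_nonneg (mul_nonneg m1 m2) m3))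
  refine hmain.trans ?_
  rw [integral_const_mul]
  have hP := Pk_bound h α u hh0
  have hD := Db_le h hh0
  have hDn := Db_nonneg h hh0
  have hV := V0_pos h hh0
  have hlog : 1 ≤ |Real.log (lam ^ (2 + κ))| ^ 4 := by
    apply one_le_pow₀
    rw [Real.log_rpow hl0]
    have : Real.log lam ≤ -1 := by
      have := Real.log_le_log hl0 hl1
      rwa [Real.log_exp] at this
    rw [abs_of_nonpos (by nlinarith)]
    nlinarith
  have hpow : X ^ 4 * Z ^ 8 ≤ lam ^ (-(3/4) - 3 * κ) := by
    have : X ^ 4 * Z ^ 8 = lam ^ (-(4 * κ) - 1/2) := by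
      rw [hX, hZ, hh, ← Real.rpow_natCast, ← Real.rpow_natCast, ← Real.rpow_natCast,
        ← Real.rpow_mul hl0.le, ← Real.rpow_mul hl0.le, ← Real.rpow_mul hl0.le,
        ← Real.rpow_add hl0]
      congr 1
      push_cast
      ring
    rw [this]
    exact Real.rpow_le_rpow_of_exponent_ge hl0 hle1 (by linarith)
  have hDb : V0 h * Db h ^ 3 ≤ V0 h * (36 * V0 h) ^ 3 := by gcongr
  calc R ^ 4 * ∫ y, Pk h α u y ∂nuY ≤ R ^ 4 * (36 * SC * (V0 h * (36 * V0 h) ^ 3)) := by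
        refine mul_le_mul_of_nonneg_left (hP.trans ?_) (by positivity)
        exact mul_le_mul_of_nonneg_left hDb (by positivity)
    _ = C0 * (X ^ 4 * Z ^ 8) := by
        rw [hR, hC0, V0, ← hZ]; ring
    _ ≤ (C0 + 1) * lam ^ (-(3/4) - 3 * κ) := by
        have : 0 ≤ lam ^ (-(3/4) - 3 * κ) := by positivity
        nlinarith [mul_le_mul_of_nonneg_left hpow hC0n]
    _ ≤ (C0 + 1) * lam ^ (-(3/4) - 3 * κ) * |Real.log (lam ^ (2 + κ))| ^ 4 :=
        le_mul_of_one_le_right (by positivity) hlog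

end
end
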